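/- arXiv:math/0701351 — 2 statements merged into one kernel-verified Lean document; each statement's English description precedes it below -/
import Mathlib

section
/- Let R be an order in a number field K and G a finite group. Then the group of units RG* of the group ring RG is finite if and only if one of the following holds: (1) K = ℚ and G is either abelian of exponent dividing 4 or dividing 6, or G is isomorphic to Q8 × A for A an elementary abelian 2-group; (2) K is an imaginary quadratic extension of ℚ and G is an elementary abelian 2-group; (3) K is isomorphic to ℚ(√−3) and G is abelian of exponent 3 or 6; (4) K is isomorphic to ℚ(√−1) and G is abelian of exponent 4. -/
/-- An order in a finite-dimensional `ℚ`-algebra `A`: a subring that is finitely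
generated as a `ℤ`-module and whose `ℚ`-span is all of `A`. -/
def IsOrderIn {A : Type} [Ring A] [Algebra ℚ A] (S : Subring A) : Prop :=
  S.toAddSubgroup.FG ∧ Submodule.span ℚ (S : Set A) = ⊤

lemma hu_mul_mem {K : Type} [Field K] [NumberField K] {R : Subring K} (hR : IsOrderIn R) (x : K) :
    ∃ N : ℤ, N ≠ 0 ∧ (N : K) * x ∈ R := by
  have hx : x ∈ Submodule.span ℚ (R : Set K) := by rw [hR.2]; trivial
  induction hx using Submodule.span_induction with
  | mem x h => exact ⟨1, one_ne_zero, by simpa using h⟩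
  | zero => exact ⟨1, one_ne_zero, by simp [R.zero_mem]⟩
  | add x y _ _ hx hy =>
    obtain ⟨N, hN, h1⟩ := hx
    obtain ⟨M, hM, h2⟩ := hy
    refine ⟨N * M, mul_ne_zero hN hM, ?_⟩
    have : ((N * M : ℤ) : K) * (x + y) = (M : K) * (N * x) + N * (M * y) := by push_cast; ring
    rw [this]
    exact R.add_mem (R.mul_mem (intCast_mem R M) h1) (R.mul_mem (intCast_mem R N) h2)
  | smul a x _ hx =>
    obtain ⟨N, hN, h1⟩ := hx
    refine ⟨a.den * N, mul_ne_zero (by exact_mod_cast a.den_ne_zero) hN, ?_⟩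
    have h2 : (a.den : K) * (a : K) = a.num := by
      have := Rat.den_mul_eq_num a
      exact_mod_cast congrArg (Rat.cast (K := K)) this
    have : ((a.den * N : ℤ) : K) * (a • x) = a.num * (N * x) := by
      rw [Rat.smul_def, ← h2]; push_cast; ring
    rw [this]
    exact R.mul_mem (intCast_mem R _) h1

lemma hu_finite_int {K : Type} [Field K] [NumberField K] {R : Subring K} (hR : IsOrderIn R) :
    Module.Finite ℤ R := by
  have h1 := hR.1
  have h2 : AddGroup.FG R := (AddGroup.fg_iff_addSubgroup_fg R.toAddSubgroup).2 h1
  exact Module.Finite.iff_addGroup_fg.2 h2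

open NumberField in
lemma hu_conductor {K : Type} [Field K] [NumberField K] {R : Subring K} (hR : IsOrderIn R) :
    ∃ N : ℤ, N ≠ 0 ∧ ∀ x : 𝓞 K, (N : K) * x ∈ R := by
  obtain ⟨S, hS⟩ := (Module.Finite.fg_top : (⊤ : Submodule ℤ (𝓞 K)).FG)
  choose f hf0 hf using fun x : K => hu_mul_mem hR x
  refine ⟨∏ s ∈ S, f s, Finset.prod_ne_zero_iff.2 fun s _ => hf0 _, fun x => ?_⟩
  have hx : x ∈ Submodule.span ℤ (S : Set (𝓞 K)) := by rw [hS]; trivial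
  induction hx using Submodule.span_induction with
  | mem x h =>
    classical
    rw [← Finset.prod_erase_mul S _ h, Int.cast_mul, mul_assoc]
    exact R.mul_mem (intCast_mem R _) (hf _)
  | zero => simp [R.zero_mem]
  | add x y _ _ hx hy =>
    have h : ((x + y : 𝓞 K) : K) = x + y := rfl
    rw [h, mul_add]; exact R.add_mem hx hy
  | smul a x _ hx =>
    have h : ((a • x : 𝓞 K) : K) = a * x := by
      rw [zsmul_eq_mul]; simp
    rw [h, mul_left_comm]
    exact R.mul_mem (intCast_mem R _) hx

open NumberField in
lemma hu_torsion {K : Type} [Field K] [NumberField K] {R : Subring K} (hR : IsOrderIn R)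
    (hfin : Finite Rˣ) (u : (𝓞 K)ˣ) : IsOfFinOrder u := by
  obtain ⟨N, hN, hNR⟩ := hu_conductor hR
  let I : Ideal (𝓞 K) := Ideal.span {(N : 𝓞 K)}
  have hI : I ≠ ⊥ := by
    simp only [I, ne_eq, Ideal.span_singleton_eq_bot]
    exact_mod_cast hN
  have : Finite (𝓞 K ⧸ I) := Ideal.finiteQuotientOfFreeOfNeBot I hI
  let v := Units.map (Ideal.Quotient.mk I : 𝓞 K →* 𝓞 K ⧸ I) u
  obtain ⟨m, hm, hv⟩ := isOfFinOrder_iff_pow_eq_one.1 (isOfFinOrder_of_finite v)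
  have mem : ∀ w : (𝓞 K)ˣ, Ideal.Quotient.mk I (w : 𝓞 K) = 1 → ((w : 𝓞 K) : K) ∈ R := by
    intro w hw
    rw [← map_one (Ideal.Quotient.mk I), Ideal.Quotient.eq, Ideal.mem_span_singleton] at hw
    obtain ⟨c, hc⟩ := hw
    have : ((w : 𝓞 K) : K) = 1 + N * c := by
      rw [sub_eq_iff_eq_add'] at hc
      rw [hc]; simp
    rw [this]
    exact R.add_mem R.one_mem (hNR c)
  have h1 : Ideal.Quotient.mk I ((u ^ m : (𝓞 K)ˣ) : 𝓞 K) = 1 := by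
    have := congrArg Units.val hv
    simpa [v] using this
  have h2 : Ideal.Quotient.mk I (((u ^ m)⁻¹ : (𝓞 K)ˣ) : 𝓞 K) = 1 := by
    have : (v ^ m)⁻¹ = 1 := by rw [hv, inv_one]
    have h3 := congrArg Units.val this
    have h4 : (v ^ m)⁻¹ = Units.map (Ideal.Quotient.mk I : 𝓞 K →* 𝓞 K ⧸ I) (u ^ m)⁻¹ := by
      simp [v]
    rw [h4] at h3
    exact h3
  let r : Rˣ := ⟨⟨_, mem _ h1⟩, ⟨_, mem _ h2⟩, Subtype.ext (by
      change (((u ^ m : (𝓞 K)ˣ) : 𝓞 K) : K) * (((u ^ m)⁻¹ : (𝓞 K)ˣ) : 𝓞 K) = 1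
      rw [← map_mul, Units.mul_inv, map_one]), Subtype.ext (by
      change ((((u ^ m)⁻¹ : (𝓞 K)ˣ) : 𝓞 K) : K) * (((u ^ m) : (𝓞 K)ˣ) : 𝓞 K) = 1
      rw [← map_mul, Units.inv_mul, map_one])⟩
  obtain ⟨t, ht, hr⟩ := isOfFinOrder_iff_pow_eq_one.1 (isOfFinOrder_of_finite r)
  refine isOfFinOrder_iff_pow_eq_one.2 ⟨m * t, by positivity, ?_⟩
  rw [pow_mul]
  apply Units.ext
  apply RingOfIntegers.ext
  have := congrArg (fun q : Rˣ => ((q : R) : K)) hr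
  simpa [r] using this

open NumberField InfinitePlace in
lemma hu_realPlaces {K : Type} [Field K] [NumberField K] :
    nrRealPlaces K = 0 ↔ IsEmpty (K →+* ℝ) := by
  classical
  rw [nrRealPlaces, Fintype.card_eq_zero_iff]
  constructor
  · intro h
    refine ⟨fun f => h.false ⟨InfinitePlace.mk (Complex.ofRealHom.comp f), ?_⟩⟩
    rw [isReal_mk_iff]
    ext x
    simp
  · intro h
    exact ⟨fun w => h.false (embedding_of_isReal w.2)⟩

open NumberField InfinitePlace in
lemma hu_field {K : Type} [Field K] [NumberField K] {R : Subring K} (hR : IsOrderIn R)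
    (hfin : Finite Rˣ) : Module.finrank ℚ K = 1 ∨
      (Module.finrank ℚ K = 2 ∧ IsEmpty (K →+* ℝ)) := by
  have h0 : Units.rank K = 0 := by
    by_contra hne
    have h1 : Units.torsion K = ⊤ := by
      rw [eq_top_iff]; intro u _
      exact hu_torsion hR hfin u
    let i : Fin (Units.rank K) := ⟨0, Nat.pos_of_ne_zero hne⟩
    have hu : Units.fundSystem K i ∈ Units.torsion K := by rw [h1]; trivial
    have h2 := (Units.exist_unique_eq_mul_prod K (Units.fundSystem K i)).unique
      (y₁ := (⟨_, hu⟩, 0)) (y₂ := (1, Pi.single i 1)) (by simp) (by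
        rw [Finset.prod_eq_single i]
        · simp
        · intro j _ hj; simp [hj]
        · simp)
    have h3 := congrFun (congrArg Prod.snd h2) i
    simp at h3
  have h1 := card_eq_nrRealPlaces_add_nrComplexPlaces K
  have h2 := card_add_two_mul_card_eq_rank K
  have h3 : 0 < Fintype.card (InfinitePlace K) := Fintype.card_pos
  unfold Units.rank at h0
  rcases Nat.eq_zero_or_pos (nrRealPlaces K) with h | h
  · right
    exact ⟨by omega, hu_realPlaces.1 h⟩
  · left; omega

open NumberField InfinitePlace in
lemma hu_units_finite {L : Type} [Field L] [NumberField L] (h1 : Module.finrank ℚ L = 2)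
    (h2 : IsEmpty (L →+* ℝ)) :
    {z : L | IsIntegral ℤ z ∧ ∃ w, IsIntegral ℤ w ∧ z * w = 1}.Finite := by
  have h0 : Units.rank L = 0 := by
    have h3 := card_eq_nrRealPlaces_add_nrComplexPlaces L
    have h4 := card_add_two_mul_card_eq_rank L
    have h5 := hu_realPlaces.2 h2
    unfold Units.rank; omega
  have h1 : Finite (𝓞 L)ˣ := by
    have : Function.Surjective (fun t : Units.torsion L => (t : (𝓞 L)ˣ)) := by
      intro u
      obtain ⟨⟨t, e⟩, h, -⟩ := Units.exist_unique_eq_mul_prod L u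
      refine ⟨t, ?_⟩
      have : IsEmpty (Fin (Units.rank L)) := by rw [h0]; infer_instance
      simpa using h.symm
    exact Finite.of_surjective _ this
  refine (Set.finite_range (fun u : (𝓞 L)ˣ => ((u : 𝓞 L) : L))).subset ?_
  rintro z ⟨hz, w, hw, hzw⟩
  refine ⟨⟨⟨z, hz⟩, ⟨w, hw⟩, ?_, ?_⟩, rfl⟩
  · exact RingOfIntegers.ext hzw
  · exact RingOfIntegers.ext (by rw [mul_comm] at hzw; exact hzw)

lemma hu_no_real {L : Type} [Field L] (α : L) (c : ℕ) (hc : 0 < c) (h : α ^ 2 = -(c : L)) :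
    IsEmpty (L →+* ℝ) := by
  refine ⟨fun f => ?_⟩
  have := congrArg f h
  simp only [map_pow, map_neg, map_natCast] at this
  have h2 : (0 : ℝ) < c := by exact_mod_cast hc
  nlinarith [sq_nonneg (f α)]

open NumberField in
lemma hu_sqrt {K : Type} [Field K] [NumberField K] {R : Subring K} (hR : IsOrderIn R)
    (h2 : Module.finrank ℚ K = 2) (hre : IsEmpty (K →+* ℝ)) :
    ∃ (s : R) (d : ℤ), 0 < d ∧ s ^ 2 = -(d : R) := by
  obtain ⟨θ, hθ⟩ : ∃ θ : K, ∀ q : ℚ, algebraMap ℚ K q ≠ θ := by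
    by_contra hcon
    push Not at hcon
    have := finrank_eq_one (R := ℚ) (1 : K) one_ne_zero (fun w => by
      obtain ⟨q, hq⟩ := hcon w
      exact ⟨q, by rw [← hq, Algebra.smul_def, mul_one]⟩)
    omega
  have hspan : ∀ θ : K, (∀ q : ℚ, algebraMap ℚ K q ≠ θ) → ∀ w : K, ∃ a b : ℚ, w = a + b * θ := by
    intro θ hθ w
    have hli : LinearIndependent ℚ ![(1 : K), θ] := by
      rw [LinearIndependent.pair_iff' one_ne_zero]
      intro a ha
      exact hθ a (by rw [← ha, Algebra.smul_def, mul_one])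
    have htop := hli.span_eq_top_of_card_eq_finrank (by simp [h2])
    have hw : w ∈ Submodule.span ℚ (Set.range ![(1 : K), θ]) := by rw [htop]; trivial
    rw [Matrix.range_cons, Matrix.range_cons, Matrix.range_empty, Set.union_empty, Set.singleton_union, Submodule.mem_span_pair] at hw
    obtain ⟨a, b, h⟩ := hw
    exact ⟨a, b, by rw [← h, Rat.smul_def, Rat.smul_def, mul_one]⟩
  obtain ⟨a, b, hab⟩ := hspan θ hθ (θ ^ 2)
  let s : K := θ - b / 2
  let r : ℚ := a + b ^ 2 / 4
  have hs : s ^ 2 = r := by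
    simp only [s, r]; push_cast
    linear_combination hab
  have hsQ : ∀ q : ℚ, algebraMap ℚ K q ≠ s := by
    intro q hq
    apply hθ (q + b / 2)
    simp only [s, eq_ratCast] at hq ⊢
    push_cast
    rw [hq]; ring
  have hr : r < 0 := by
    by_contra hr
    push Not at hr
    obtain ⟨φ⟩ : Nonempty (K →+* ℂ) := inferInstance
    have h3 : φ s ^ 2 = ((Real.sqrt r : ℝ) : ℂ) ^ 2 := by
      rw [← map_pow, hs, map_ratCast, ← Complex.ofReal_pow, Real.sq_sqrt (by exact_mod_cast hr)]
      simp
    have h4 : (starRingEnd ℂ) (φ s) = φ s := by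
      rcases sq_eq_sq_iff_eq_or_eq_neg.1 h3 with h | h <;> rw [h] <;> simp
    have h5 : ComplexEmbedding.IsReal φ := by
      ext w
      obtain ⟨a, b, rfl⟩ := hspan s hsQ w
      simp [h4]
    exact hre.false h5.embedding
  let s1 : K := r.den * s
  obtain ⟨N, hN, hNR⟩ := hu_mul_mem hR s1
  refine ⟨⟨_, hNR⟩, N ^ 2 * (r.den * -r.num), ?_, ?_⟩
  · have : r.num < 0 := Rat.num_neg.2 hr
    have h6 : (0 : ℤ) < r.den := by exact_mod_cast r.den_pos
    have h7 : 0 < N ^ 2 := by positivity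
    have h8 : 0 < -r.num := by omega
    positivity
  · apply Subtype.ext
    have h6 : (r.den : K) * (r : K) = r.num := by
      have := Rat.den_mul_eq_num r
      exact_mod_cast congrArg (Rat.cast (K := K)) this
    simp only [s1]
    push_cast
    linear_combination (N : K) ^ 2 * r.den ^ 2 * hs + (N : K) ^ 2 * r.den * h6


/-- Noncommuting elements in a group all of whose cyclic subgroups are normal and with small orders. -/
lemma hu_conj {G : Type} [Group G] [Finite G]
    (hn : ∀ g h : G, h * g * h⁻¹ ∈ Subgroup.zpowers g)
    (ho : ∀ g : G, orderOf g ∈ ({1, 2, 3, 4, 6} : Set ℕ)) (x y : G) :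
    x * y * x⁻¹ = y ∨ x * y * x⁻¹ = y⁻¹ := by
  classical
  have h1 : x * y * x⁻¹ ∈ Subgroup.zpowers y := hn y x
  have hf : IsOfFinOrder y := isOfFinOrder_of_finite y
  rw [← hf.mem_powers_iff_mem_zpowers, hf.mem_powers_iff_mem_range_orderOf] at h1
  simp only [Finset.mem_image, Finset.mem_range] at h1
  obtain ⟨k, hk, hky⟩ := h1
  have h2 : orderOf (y ^ k) = orderOf y := by
    rw [hky]
    exact (MulAut.conj x).orderOf_eq y
  have hpos := hf.orderOf_pos
  have h3 : k.gcd (orderOf y) = 1 := by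
    rw [hf.orderOf_pow] at h2
    have h4 := Nat.gcd_dvd_left (orderOf y) k
    obtain ⟨c, hc⟩ := h4
    rw [Nat.gcd_comm]
    have h5 : 0 < (orderOf y).gcd k := Nat.gcd_pos_of_pos_left _ hpos
    have h6 : orderOf y / (orderOf y).gcd k = c := by
      nth_rewrite 1 [hc]; exact Nat.mul_div_cancel_left _ h5
    rw [h6] at h2
    rw [h2] at hc
    have : 1 * orderOf y = (orderOf y).gcd k * orderOf y := by simpa using hc
    exact (Nat.eq_of_mul_eq_mul_right hpos this).symm
  have h4 : k % orderOf y = 1 % orderOf y ∨ (k + 1) % orderOf y = 0 := by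
    have := ho y
    simp only [Set.mem_insert_iff, Set.mem_singleton_iff] at this
    clear hky h2
    generalize orderOf y = n at hk h3 this ⊢
    rcases this with rfl | rfl | rfl | rfl | rfl <;> interval_cases k <;> revert h3 <;> decide
  rcases h4 with h | h
  · left
    rw [← hky]
    have := (pow_inj_mod (x := y) (n := k) (m := 1)).2 h
    simpa using this
  · right
    rw [← hky]
    have : y ^ (k + 1) = 1 := orderOf_dvd_iff_pow_eq_one.1 (Nat.dvd_of_mod_eq_zero h)
    rw [pow_succ] at this
    exact eq_inv_of_mul_eq_one_left this

lemma hu_pair {G : Type} [Group G] 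
    (hc : ∀ x y : G, x * y * x⁻¹ = y ∨ x * y * x⁻¹ = y⁻¹) (x y : G) (hxy : x * y ≠ y * x) :
    x * y * x⁻¹ = y⁻¹ ∧ x ^ 2 = y ^ 2 ∧ x ^ 4 = 1 := by
  have h1 : x * y * x⁻¹ = y⁻¹ := by
    rcases hc x y with h | h
    · exact absurd (by rw [mul_inv_eq_iff_eq_mul] at h; exact h) hxy
    · exact h
  have h2 : y * x * y⁻¹ = x⁻¹ := by
    rcases hc y x with h | h
    · exact absurd (by rw [mul_inv_eq_iff_eq_mul] at h; exact h.symm) hxy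
    · exact h
  have h3 : x ^ 2 = (y ^ 2)⁻¹ := by
    have e1 : x * y * x⁻¹ * y⁻¹ = (y ^ 2)⁻¹ := by rw [h1]; group
    have e2 : x * y * x⁻¹ * y⁻¹ = x ^ 2 := by
      have : x * y * x⁻¹ * y⁻¹ = x * (y * x * y⁻¹)⁻¹ := by group
      rw [this, h2, inv_inv, sq]
    rw [← e1, e2]
  have h4 : x * y ^ 2 * x⁻¹ = (y ^ 2)⁻¹ := by
    have : x * y ^ 2 * x⁻¹ = (x * y * x⁻¹) ^ 2 := by rw [conj_pow]
    rw [this, h1]; group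
  have h5 : x * y ^ 2 * x⁻¹ = y ^ 2 := by
    have : y ^ 2 = (x ^ 2)⁻¹ := by rw [h3]; simp
    rw [this]; group
  have h6 : x ^ 2 = y ^ 2 := by rw [h3, ← h4, h5]
  refine ⟨h1, h6, ?_⟩
  have : x ^ 4 = x ^ 2 * x ^ 2 := by group
  rw [this]
  nth_rewrite 2 [h6]
  rw [h3]; simp

/-- The homomorphism from the quaternion group determined by two elements. -/
def huHom {G : Type} [Group G] (x y : G) (h4 : x ^ 4 = 1) (h2 : y ^ 2 = x ^ 2)
    (hc : x * y = y * x⁻¹) : QuaternionGroup 2 →* G where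
  toFun q := match q with
    | .a i => x ^ (ZMod.val (n := 4) i)
    | .xa i => y * x ^ (ZMod.val (n := 4) i)
  map_one' := by
    change x ^ (ZMod.val (n := 4) 0) = 1
    simp
  map_mul' := by
    have hcx : y * x = x⁻¹ * y := by
      rw [eq_inv_mul_iff_mul_eq, ← mul_assoc, hc]; simp
    have hi : x⁻¹ = x ^ 3 := by
      rw [inv_eq_iff_mul_eq_one, ← pow_succ', h4]
    rw [hi] at hc
    have key : ∀ k : ℕ, x ^ k * y = y * x ^ (3 * k) := by
      intro k
      induction k with
      | zero => simp
      | succ k ih => rw [pow_succ', mul_assoc, ih, ← mul_assoc, hc, mul_assoc, ← pow_add]; ring_nf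
    have hm : ∀ a b : ℕ, a % 4 = b % 4 → x ^ a = x ^ b := by
      intro a b h
      rw [← Nat.div_add_mod a 4, ← Nat.div_add_mod b 4, pow_add, pow_add, pow_mul, pow_mul, h4, h]
      simp
    have v1 : ∀ i j : ZMod 4, (ZMod.val (i + j)) % 4 = (i.val + j.val) % 4 := by decide
    have v2 : ∀ i j : ZMod 4, (ZMod.val (j - i)) % 4 = (3 * i.val + j.val) % 4 := by decide
    have v3 : ∀ i j : ZMod 4, (ZMod.val (((2 : ℕ) : ZMod 4) + j - i)) % 4 = (2 + (3 * i.val + j.val)) % 4 := by decide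
    rintro (i | i) (j | j)
    · change x ^ (ZMod.val (n := 4) (i + j)) = x ^ (ZMod.val (n := 4) i) * x ^ (ZMod.val (n := 4) j)
      rw [← pow_add]; exact hm _ _ (v1 i j)
    · change y * x ^ (ZMod.val (n := 4) (j - i)) = x ^ (ZMod.val (n := 4) i) * (y * x ^ (ZMod.val (n := 4) j))
      rw [← mul_assoc, key, mul_assoc, ← pow_add]; congr 1; exact hm _ _ (v2 i j)
    · change y * x ^ (ZMod.val (n := 4) (i + j)) = y * x ^ (ZMod.val (n := 4) i) * x ^ (ZMod.val (n := 4) j)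
      rw [mul_assoc, ← pow_add]; congr 1; exact hm _ _ (v1 i j)
    · change x ^ (ZMod.val (n := 4) (((2 : ℕ) : ZMod 4) + j - i)) = y * x ^ (ZMod.val (n := 4) i) * (y * x ^ (ZMod.val (n := 4) j))
      rw [← mul_assoc, mul_assoc y, key, ← mul_assoc, ← pow_two y, h2, mul_assoc, ← pow_add, ← pow_add]
      exact hm _ _ (v3 i j)

lemma hu_sep {C : Type} [CommGroup C] [Finite C] (hC : ∀ c : C, c ^ 2 = 1) (z : C) (hz : z ≠ 1) :
    ∃ χ : C →* ℤˣ, χ z = -1 := by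
  have : HasEnoughRootsOfUnity ℤ 2 := ⟨⟨-1, IsPrimitiveRoot.neg_one 0 (by decide)⟩, inferInstance⟩
  have : HasEnoughRootsOfUnity ℤ (Monoid.exponent C) :=
    HasEnoughRootsOfUnity.of_dvd ℤ (n := 2) (Monoid.exponent_dvd_of_forall_pow_eq_one hC)
  obtain ⟨χ, hχ⟩ := CommGroup.exists_apply_ne_one_of_hasEnoughRootsOfUnity C ℤ hz
  exact ⟨χ, (Int.units_eq_one_or _).resolve_left hχ⟩

lemma hu_struct {G : Type} [Group G] [Finite G]
    (hc : ∀ x y : G, x * y * x⁻¹ = y ∨ x * y * x⁻¹ = y⁻¹) (x y : G) (hxy : x * y ≠ y * x) :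
    ∃ (A : Type) (_ : CommGroup A), (∀ a : A, a ^ 2 = 1) ∧
            Nonempty (G ≃* QuaternionGroup 2 × A) := by
  obtain ⟨hi, hsq, h4⟩ := hu_pair hc x y hxy
  obtain ⟨hi', -, -⟩ := hu_pair hc y x (Ne.symm hxy)
  have hz : x ^ 2 ≠ 1 := by
    intro h
    apply hxy
    have : y⁻¹ = y := by
      rw [inv_eq_iff_mul_eq_one, ← sq, ← hsq, h]
    rw [this, mul_inv_eq_iff_eq_mul] at hi
    exact hi
  have hxy' : x * y = y * x⁻¹ := by
    have : y * x⁻¹ * y⁻¹ = x := by rw [← conj_inv, hi', inv_inv]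
    rw [mul_inv_eq_iff_eq_mul] at this
    exact this.symm
  let C : Subgroup G := Subgroup.centralizer {x, y}
  have memC : ∀ c : G, c * x * c⁻¹ = x → c * y * c⁻¹ = y → c ∈ C := by
    intro c h1 h2
    rw [mul_inv_eq_iff_eq_mul] at h1 h2
    rw [Subgroup.mem_centralizer_iff]
    rintro h (rfl | rfl)
    · exact h1.symm
    · exact h2.symm
  have Cx : ∀ c ∈ C, x * c = c * x := fun c hcC => Subgroup.mem_centralizer_iff.1 hcC x (by simp)
  have Cy : ∀ c ∈ C, y * c = c * y := fun c hcC => Subgroup.mem_centralizer_iff.1 hcC y (by simp)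
  have Csq : ∀ c ∈ C, c ^ 2 = 1 := by
    intro c hcC
    have h1 : (c * x) * y ≠ y * (c * x) := by
      intro h
      apply hxy
      rw [← mul_assoc, Cy c hcC, mul_assoc, mul_assoc] at h
      exact mul_left_cancel h
    obtain ⟨-, h2, -⟩ := hu_pair hc _ _ h1
    have h3 : (c * x) ^ 2 = c ^ 2 * x ^ 2 := (show Commute c x from (Cx c hcC).symm).mul_pow 2
    rw [h3, hsq] at h2
    simpa using h2
  have Ccomm : ∀ c d : C, c * d = d * c := by
    intro c d
    have h1 : ∀ e : C, e⁻¹ = e := fun e => by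
      rw [inv_eq_iff_mul_eq_one, ← sq]; exact Subtype.ext (Csq e e.2)
    rw [← h1 (c * d), mul_inv_rev, h1, h1]
  let _ : CommGroup C := { (inferInstance : Group C) with mul_comm := Ccomm }
  have zC : x ^ 2 ∈ C := by
    apply memC
    · group
    · rw [hsq]; group
  obtain ⟨χ, hχ⟩ := hu_sep (C := C) (fun c => Subtype.ext (Csq c c.2)) ⟨x ^ 2, zC⟩
    (fun h => hz (congrArg Subtype.val h))
  let φ := huHom x y h4 hsq.symm hxy'
  have φa : ∀ i : ZMod 4, φ (.a i) = x ^ i.val := fun i => rfl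
  have φx : ∀ i : ZMod 4, φ (.xa i) = y * x ^ i.val := fun i => rfl
  let ψ : χ.ker →* G := C.subtype.comp χ.ker.subtype
  have hcomm : ∀ q a, Commute (φ q) (ψ a) := by
    intro q a
    have hx : Commute x (ψ a) := Cx _ a.1.2
    have hy : Commute y (ψ a) := Cy _ a.1.2
    rcases q with i | i
    · exact hx.pow_left _
    · exact hy.mul_left (hx.pow_left _)
  let Φ : QuaternionGroup 2 × χ.ker →* G := φ.noncommCoprod ψ hcomm
  have Φapp : ∀ q a, Φ (q, a) = φ q * ψ a := fun q a => rfl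
  have hinj : Function.Injective Φ := by
    rw [injective_iff_map_eq_one]
    rintro ⟨q, a⟩ h
    rw [Φapp, mul_eq_one_iff_eq_inv, ← map_inv] at h
    have hmem : φ q ∈ C := by rw [h]; exact (a⁻¹).1.2
    have hker : χ ⟨φ q, hmem⟩ = 1 := by
      have : (⟨φ q, hmem⟩ : C) = (a⁻¹).1 := Subtype.ext h
      rw [this]; exact (a⁻¹).2
    have hq : q = 1 := by
      rcases q with i | i
      · change ZMod 4 at i
        have h5 := Cy _ hmem
        rw [φa] at h5
        have h6 : i = 0 ∨ i = 1 ∨ i = 2 ∨ i = 3 := by clear * -; revert i; decide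
        rcases h6 with rfl | rfl | rfl | rfl
        · rfl
        · exact absurd h5.symm (by rw [show (1 : ZMod 4).val = 1 from rfl, pow_one]; exact hxy)
        · exfalso
          have : (⟨φ (.a 2), hmem⟩ : C) = ⟨x ^ 2, zC⟩ := Subtype.ext rfl
          rw [this, hχ] at hker
          exact absurd hker (by decide)
        · exfalso
          apply hxy
          change y * x ^ 3 = x ^ 3 * y at h5
          have h7 : x ^ 3 = x⁻¹ := by
            rw [eq_inv_iff_mul_eq_one, ← pow_succ, h4]
          rw [h7] at h5
          have h8 : Commute y x⁻¹ := h5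
          exact (Commute.inv_right_iff.1 h8).eq.symm
      · exfalso
        change ZMod 4 at i
        have h5 := Cx _ hmem
        rw [φx, ← mul_assoc, mul_assoc y, ← pow_succ, pow_succ', ← mul_assoc] at h5
        exact hxy (mul_right_cancel h5)
    subst hq
    rw [map_one] at h
    have : a⁻¹ = 1 := Subtype.ext (Subtype.ext h.symm)
    rw [inv_eq_one] at this
    rw [this]; rfl
  have hrx : x ∈ Φ.range := ⟨(.a 1, 1), by rw [Φapp, φa, show (1 : ZMod 4).val = 1 from rfl]; simp⟩
  have hry : y ∈ Φ.range := ⟨(.xa 0, 1), by rw [Φapp, φx]; simp⟩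
  have hrC : ∀ c ∈ C, c ∈ Φ.range := by
    intro c hcC
    rcases Int.units_eq_one_or (χ ⟨c, hcC⟩) with h | h
    · exact ⟨(1, ⟨⟨c, hcC⟩, h⟩), by rw [Φapp, map_one, one_mul]; rfl⟩
    · have h1 : χ (⟨x ^ 2, zC⟩ * ⟨c, hcC⟩) = 1 := by rw [map_mul, hχ, h]; decide
      have h2 : x ^ 2 * c ∈ Φ.range :=
        ⟨(1, ⟨⟨x ^ 2, zC⟩ * ⟨c, hcC⟩, h1⟩), by rw [Φapp, map_one, one_mul]; rfl⟩
      exact (Subgroup.mul_mem_cancel_left _ (Subgroup.pow_mem _ hrx 2)).1 h2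
  have hsurj : Function.Surjective Φ := by
    intro w
    change w ∈ Φ.range
    have hix : ∀ w : G, w * x * w⁻¹ = x⁻¹ → w * x⁻¹ * w⁻¹ = x := fun w h => by
      rw [← conj_inv, h, inv_inv]
    have hiy : ∀ w : G, w * y * w⁻¹ = y⁻¹ → w * y⁻¹ * w⁻¹ = y := fun w h => by
      rw [← conj_inv, h, inv_inv]
    rcases hc w x with h1 | h1 <;> rcases hc w y with h2 | h2
    · exact hrC w (memC w h1 h2)
    · have : w * x ∈ C := by
        apply memC
        · rw [show w * x * x * (w * x)⁻¹ = w * x * w⁻¹ by group, h1]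
        · rw [show w * x * y * (w * x)⁻¹ = w * (x * y * x⁻¹) * w⁻¹ by group, hi, hiy w h2]
      exact (Subgroup.mul_mem_cancel_right _ hrx).1 (hrC _ this)
    · have : w * y ∈ C := by
        apply memC
        · rw [show w * y * x * (w * y)⁻¹ = w * (y * x * y⁻¹) * w⁻¹ by group, hi', hix w h1]
        · rw [show w * y * y * (w * y)⁻¹ = w * y * w⁻¹ by group, h2]
      exact (Subgroup.mul_mem_cancel_right _ hry).1 (hrC _ this)
    · have : w * (x * y) ∈ C := by
        apply memC
        · rw [show w * (x * y) * x * (w * (x * y))⁻¹ = w * (x * (y * x * y⁻¹) * x⁻¹) * w⁻¹ by group, hi',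
            show x * x⁻¹ * x⁻¹ = x⁻¹ by group, hix w h1]
        · rw [show w * (x * y) * y * (w * (x * y))⁻¹ = w * (x * y * x⁻¹) * w⁻¹ by group, hi, hiy w h2]
      exact (Subgroup.mul_mem_cancel_right _ (Subgroup.mul_mem _ hrx hry)).1 (hrC _ this)
  refine ⟨χ.ker, inferInstance, fun a => Subtype.ext (Subtype.ext (Csq _ a.1.2)), ⟨(MulEquiv.ofBijective Φ ⟨hinj, hsurj⟩).symm⟩⟩


lemma hu_finite_of_inj {S T : Type*} [Ring S] [Ring T] (f : S →+* T) (hf : Function.Injective f)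
    (h : Finite Tˣ) : Finite Sˣ :=
  Finite.of_injective (Units.map (f : S →* T)) (Units.map_injective hf)

lemma hu_nil {S : Type*} [Ring S] (hfin : Finite Sˣ)
    (htf : ∀ n : ℕ, n ≠ 0 → ∀ s : S, (n : S) * s = 0 → s = 0) (η : S) (h : η * η = 0) : η = 0 := by
  have key : ∀ k l : ℤ, k + l = 0 → (1 + (k : S) * η) * (1 + (l : S) * η) = 1 := by
    intro k l hkl
    have h1 : (k : S) * η * ((l : S) * η) = 0 := by
      rw [mul_assoc, ← mul_assoc η, ← (Int.cast_commute l η).eq, mul_assoc (l : S), h]; simp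
    rw [mul_add, add_mul, add_mul, h1]
    simp only [one_mul, mul_one, add_zero]
    rw [add_assoc, ← add_mul, ← Int.cast_add, hkl]; simp
  let f : ℕ → Sˣ := fun k => ⟨1 + ((k : ℤ) : S) * η, 1 + ((-(k : ℤ) : ℤ) : S) * η,
    key _ _ (by ring), key _ _ (by ring)⟩
  obtain ⟨i, j, hij, he⟩ := Finite.exists_ne_map_eq_of_infinite f
  have he' : 1 + ((i : ℤ) : S) * η = 1 + ((j : ℤ) : S) * η := congrArg Units.val he
  have he2 : ((i : ℕ) : S) * η = (j : S) * η := by simpa using add_left_cancel he'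
  wlog hlt : i < j generalizing i j
  · exact this j i hij.symm he.symm he'.symm he2.symm (by omega)
  apply htf (j - i) (by omega)
  rw [Nat.cast_sub hlt.le, sub_mul, he2, sub_self]

open MonoidAlgebra in
lemma hu_tf {R G : Type*} [CommRing R] [IsDomain R] [CharZero R] [Monoid G] (n : ℕ) (hn : n ≠ 0)
    (s : MonoidAlgebra R G) (h : (n : MonoidAlgebra R G) * s = 0) : s = 0 := by
  rw [← nsmul_eq_mul, ← Nat.cast_smul_eq_nsmul R] at h
  ext g
  have := congrArg (fun t => t.coeff g) h
  simpa [hn] using this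

open MonoidAlgebra in
lemma hu_bicyclic {R G : Type*} [CommRing R] [IsDomain R] [CharZero R] [Group G] [Finite G]
    (hfin : Finite (MonoidAlgebra R G)ˣ) (g h : G) : h * g * h⁻¹ ∈ Subgroup.zpowers g := by
  classical
  set N : MonoidAlgebra R G := ∑ i ∈ Finset.range (orderOf g), single (g ^ i) 1 with hN
  have hpow : ∀ i : ℕ, (single (g ^ i) 1 : MonoidAlgebra R G) = (single g 1) ^ i := by
    intro i; rw [single_pow, one_pow]
  have hgN : N * (1 - single g 1) = 0 := by
    have h1 : N = ∑ i ∈ Finset.range (orderOf g), (single g 1 : MonoidAlgebra R G) ^ i := by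
      rw [hN]; exact Finset.sum_congr rfl fun i _ => hpow i
    have h2 := geom_sum_mul (single g 1 : MonoidAlgebra R G) (orderOf g)
    rw [← h1, ← hpow, pow_orderOf_eq_one, ← one_def, sub_self] at h2
    rw [← neg_sub, mul_neg, h2, neg_zero]
  have h0 := hu_nil hfin (fun n hn s => hu_tf n hn s) ((1 - single g 1) * (single h⁻¹ 1 * N)) (by
    rw [mul_assoc, mul_assoc, ← mul_assoc N, hgN]; simp)
  rw [sub_mul, one_mul, sub_eq_zero, hN, Finset.mul_sum, Finset.mul_sum] at h0
  have h1 := congrArg (fun t => t.coeff h⁻¹) h0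
  simp only [single_mul_single, coeff_sum, Finsupp.finsetSum_apply, coeff_single, one_mul,
    Finsupp.single_apply] at h1
  rw [Finset.sum_eq_single 0] at h1
  · by_contra hcon
    rw [Finset.sum_eq_zero] at h1
    · simp at h1
    · intro i _
      rw [if_neg]
      intro he
      apply hcon
      have : h * g * h⁻¹ = (g ^ i)⁻¹ := by
        rw [eq_inv_iff_mul_eq_one]
        rw [← mul_assoc] at he
        rw [mul_assoc, mul_assoc, ← mul_assoc g, he]; simp
      rw [this]
      exact Subgroup.inv_mem _ (Subgroup.npow_mem_zpowers g i)
  · intro i hi hi0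
    rw [if_neg]
    intro he
    rw [mul_eq_left] at he
    exact hi0 (Nat.eq_zero_of_dvd_of_lt (orderOf_dvd_of_pow_eq_one he) (Finset.mem_range.1 hi))
  · intro h; exact absurd (Finset.mem_range.2 (orderOf_pos g)) h

/-- The embedding of a cyclic group given by an element. -/
noncomputable def huCyc {G : Type*} [Group G] [Finite G] (g : G) (n : ℕ) [NeZero n] (hn : orderOf g = n) :
    Multiplicative (ZMod n) →* G where
  toFun k := g ^ (k.toAdd.val)
  map_one' := by simp
  map_mul' a b := by
    rw [toAdd_mul, ZMod.val_add, ← pow_add, ← pow_mod_orderOf g (_ + _), hn]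

lemma huCyc_inj {G : Type*} [Group G] [Finite G] (g : G) (n : ℕ) [NeZero n] (hn : orderOf g = n) :
    Function.Injective (huCyc g n hn) := by
  intro a b h
  have h1 : g ^ (a.toAdd.val) = g ^ (b.toAdd.val) := h
  have := pow_injOn_Iio_orderOf (x := g) (by simpa [hn] using ZMod.val_lt a.toAdd)
    (by simpa [hn] using ZMod.val_lt b.toAdd) h1
  exact ZMod.val_injective n this

lemma hu_cyc {R G : Type*} [CommRing R] [Group G] [Finite G] (hfin : Finite (MonoidAlgebra R G)ˣ)
    (g : G) (n : ℕ) [NeZero n] (hn : orderOf g = n) :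
    Finite (MonoidAlgebra R (Multiplicative (ZMod n)))ˣ :=
  hu_finite_of_inj (MonoidAlgebra.mapDomainRingHom R (huCyc g n hn))
    (MonoidAlgebra.mapDomain_injective (huCyc_inj g n hn)) hfin

lemma hu_pell (D : ℤ) (hD : 0 < D) (hs : ¬ IsSquare D) :
    ∃ X Y : ℕ → ℤ, (∀ n, X n ^ 2 - D * Y n ^ 2 = 1) ∧ Function.Injective (fun n => Y n ^ 2) := by
  obtain ⟨a, ha⟩ := Pell.IsFundamental.exists_of_not_isSquare hD hs
  refine ⟨fun n => (a ^ (n : ℤ)).x, fun n => (a ^ (n : ℤ)).y, fun n => Pell.Solution₁.prop _, ?_⟩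
  have hm := ha.y_strictMono
  have h0 : ∀ n : ℕ, 0 ≤ (a ^ (n : ℤ)).y := by
    intro n
    have := hm.monotone (show (0 : ℤ) ≤ n by positivity)
    simpa using this
  intro i j hij
  have := (sq_eq_sq₀ (h0 i) (h0 j)).1 hij
  exact_mod_cast hm.injective this

lemma hu_key4 {T : Type*} [CommRing T] (γ σ d x y : T) (hγ : γ ^ 4 = 1) (hσ : σ ^ 2 = -d)
    (h : x ^ 2 - (d) * y ^ 2 = 1) :
    (1 + (d * y ^ 2 + x * y * σ * γ) * (1 - γ ^ 2)) * (1 + (d * y ^ 2 - x * y * σ * γ) * (1 - γ ^ 2)) = 1 := by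
  grind

lemma hu_key3 {T : Type*} [CommRing T] (γ σ d x y : T) (hγ : γ ^ 3 = 1) (hσ : σ ^ 2 = -d)
    (h : x ^ 2 - (3 * d) * y ^ 2 = 1) :
    (1 + 2 * d * y ^ 2 * (2 - γ - γ ^ 2) + 2 * x * y * σ * (γ - γ ^ 2)) * (1 + 2 * d * y ^ 2 * (2 - γ - γ ^ 2) - 2 * x * y * σ * (γ - γ ^ 2)) = 1 := by
  grind

open MonoidAlgebra in
lemma hu_four {R : Type*} [CommRing R] [IsDomain R] [CharZero R]
    (hfin : Finite (MonoidAlgebra R (Multiplicative (ZMod 4)))ˣ) (s : R) (d : ℤ) (hd : 0 < d)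
    (hs : s ^ 2 = -(d : R)) : IsSquare (d) := by
  by_contra hsq
  obtain ⟨X, Y, hXY, hinj⟩ := hu_pell (d) (by omega) hsq
  let γ : MonoidAlgebra R (Multiplicative (ZMod 4)) := single (Multiplicative.ofAdd 1) 1
  have hγ2 : γ ^ 2 = single (Multiplicative.ofAdd 2) 1 := by
    simp only [γ, single_pow, one_pow]; rfl
  have hγ3 : γ ^ 3 = single (Multiplicative.ofAdd 3) 1 := by
    simp only [γ, single_pow, one_pow]; rfl
  have hγ : γ ^ 4 = 1 := by
    simp only [γ, single_pow, one_pow]; rfl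
  let σ : MonoidAlgebra R (Multiplicative (ZMod 4)) := algebraMap R _ s
  have hσ : σ ^ 2 = -(d : MonoidAlgebra R (Multiplicative (ZMod 4))) := by
    simp only [σ]; rw [← map_pow, hs, map_neg, map_intCast]
  have key : ∀ x y : ℤ, x ^ 2 - (d) * y ^ 2 = 1 →
      (1 + ((d * y ^ 2 : ℤ) + (x * y : ℤ) * σ * γ) * (1 - γ ^ 2)) *
      (1 + ((d * y ^ 2 : ℤ) - (x * y : ℤ) * σ * γ) * (1 - γ ^ 2)) = 1 := by
    intro x y hxy
    have hxy' : (x : MonoidAlgebra R (Multiplicative (ZMod 4))) ^ 2 - (d) * y ^ 2 = 1 := by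
      exact_mod_cast congrArg (Int.cast (R := MonoidAlgebra R (Multiplicative (ZMod 4)))) hxy
    push_cast
    exact hu_key4 γ σ d x y hγ hσ hxy'
  let U : ℕ → (MonoidAlgebra R (Multiplicative (ZMod 4)))ˣ := fun n =>
    ⟨_, _, key (X n) (Y n) (hXY n), by rw [mul_comm]; exact key (X n) (Y n) (hXY n)⟩
  apply not_injective_infinite_finite U
  intro i j hij
  apply hinj
  have h1 := congrArg (fun t => t.val.coeff 1) hij
  have h2 : ∀ n, (U n).val.coeff 1 = 1 + 1 * d * Y n ^ 2 := by
    intro n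
    have : (U n).val = (1 + 1 * d * Y n ^ 2 : R) • 1 + ((X n * Y n : R) * s) • γ + (-(d * Y n ^ 2) : R) • γ ^ 2 + (-((X n * Y n : R) * s)) • γ ^ 3 := by
      simp only [Algebra.smul_def, map_mul, map_intCast, U, map_neg, map_sub, map_add, map_one, map_pow, map_ofNat]
      push_cast
      simp only [σ]
      ring
    rw [this]
    rw [hγ2, hγ3, one_def]
    simp only [γ, coeff_add, coeff_smul, Finsupp.add_apply, Finsupp.smul_apply, coeff_single]
    have e1 : (Multiplicative.ofAdd (1 : ZMod 4)) ≠ 1 := by decide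
    have e2 : (Multiplicative.ofAdd (2 : ZMod 4)) ≠ 1 := by decide
    have e3 : (Multiplicative.ofAdd (3 : ZMod 4)) ≠ 1 := by decide
    simp [e1, e2, e3]
  simp only [h2] at h1
  have hd' : (d : R) ≠ 0 := by exact_mod_cast hd.ne'
  have h3 : ((Y i ^ 2 : ℤ) : R) = ((Y j ^ 2 : ℤ) : R) := by
    push_cast
    have h4 : (1 * d : R) * (Y i : R) ^ 2 = (1 * d) * (Y j : R) ^ 2 := by linear_combination h1
    exact mul_left_cancel₀ (by simp [hd']) h4
  exact_mod_cast h3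

open MonoidAlgebra in
lemma hu_three {R : Type*} [CommRing R] [IsDomain R] [CharZero R]
    (hfin : Finite (MonoidAlgebra R (Multiplicative (ZMod 3)))ˣ) (s : R) (d : ℤ) (hd : 0 < d)
    (hs : s ^ 2 = -(d : R)) : IsSquare (3 * d) := by
  by_contra hsq
  obtain ⟨X, Y, hXY, hinj⟩ := hu_pell (3 * d) (by omega) hsq
  let γ : MonoidAlgebra R (Multiplicative (ZMod 3)) := single (Multiplicative.ofAdd 1) 1
  have hγ2 : γ ^ 2 = single (Multiplicative.ofAdd 2) 1 := by
    simp only [γ, single_pow, one_pow]; rfl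
  have hγ3 : γ ^ 3 = single (Multiplicative.ofAdd 3) 1 := by
    simp only [γ, single_pow, one_pow]; rfl
  have hγ : γ ^ 3 = 1 := by
    simp only [γ, single_pow, one_pow]; rfl
  let σ : MonoidAlgebra R (Multiplicative (ZMod 3)) := algebraMap R _ s
  have hσ : σ ^ 2 = -(d : MonoidAlgebra R (Multiplicative (ZMod 3))) := by
    simp only [σ]; rw [← map_pow, hs, map_neg, map_intCast]
  have key : ∀ x y : ℤ, x ^ 2 - (3 * d) * y ^ 2 = 1 →
      (1 + (2 * d * y ^ 2 : ℤ) * (2 - γ - γ ^ 2) + (2 * x * y : ℤ) * σ * (γ - γ ^ 2)) *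
      (1 + (2 * d * y ^ 2 : ℤ) * (2 - γ - γ ^ 2) - (2 * x * y : ℤ) * σ * (γ - γ ^ 2)) = 1 := by
    intro x y hxy
    have hxy' : (x : MonoidAlgebra R (Multiplicative (ZMod 3))) ^ 2 - (3 * d) * y ^ 2 = 1 := by
      exact_mod_cast congrArg (Int.cast (R := MonoidAlgebra R (Multiplicative (ZMod 3)))) hxy
    push_cast
    exact hu_key3 γ σ d x y hγ hσ hxy'
  let U : ℕ → (MonoidAlgebra R (Multiplicative (ZMod 3)))ˣ := fun n =>
    ⟨_, _, key (X n) (Y n) (hXY n), by rw [mul_comm]; exact key (X n) (Y n) (hXY n)⟩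
  apply not_injective_infinite_finite U
  intro i j hij
  apply hinj
  have h1 := congrArg (fun t => t.val.coeff 1) hij
  have h2 : ∀ n, (U n).val.coeff 1 = 1 + 4 * d * Y n ^ 2 := by
    intro n
    have : (U n).val = (1 + 4 * d * Y n ^ 2 : R) • 1 + ((2 * X n * Y n : R) * s - 2 * d * Y n ^ 2) • γ + (-((2 * X n * Y n : R) * s) - 2 * d * Y n ^ 2 : R) • γ ^ 2 := by
      simp only [Algebra.smul_def, map_mul, map_intCast, U, map_neg, map_sub, map_add, map_one, map_pow, map_ofNat]
      push_cast
      simp only [σ]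
      ring
    rw [this]
    rw [hγ2, one_def]
    simp only [γ, coeff_add, coeff_smul, Finsupp.add_apply, Finsupp.smul_apply, coeff_single]
    have e1 : (Multiplicative.ofAdd (1 : ZMod 3)) ≠ 1 := by decide
    have e2 : (Multiplicative.ofAdd (2 : ZMod 3)) ≠ 1 := by decide
    
    simp [e1, e2]
  simp only [h2] at h1
  have hd' : (d : R) ≠ 0 := by exact_mod_cast hd.ne'
  have h3 : ((Y i ^ 2 : ℤ) : R) = ((Y j ^ 2 : ℤ) : R) := by
    push_cast
    have h4 : (4 * d : R) * (Y i : R) ^ 2 = (4 * d) * (Y j : R) ^ 2 := by linear_combination h1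
    exact mul_left_cancel₀ (by simp [hd']) h4
  exact_mod_cast h3


lemma hu_bass_alg {T : Type*} [CommRing T] (γ : T) (n k l m c : ℕ) (r r' : ℤ) (hγ : γ ^ n = 1)
    (hkl : k * l = 1 + c * n) (hr : (k : ℤ) ^ m = 1 - n * r) (hr' : (l : ℤ) ^ m = 1 - n * r')
    (hn : n ≠ 0) :
    ((∑ i ∈ Finset.range k, γ ^ i) ^ m + r * ∑ i ∈ Finset.range n, γ ^ i) *
    ((∑ i ∈ Finset.range l, (γ ^ k) ^ i) ^ m + r' * ∑ i ∈ Finset.range n, γ ^ i) = 1 := by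
  set N := ∑ i ∈ Finset.range n, γ ^ i with hN
  set a := ∑ i ∈ Finset.range k, γ ^ i with ha
  set b := ∑ i ∈ Finset.range l, (γ ^ k) ^ i with hb
  have hg : γ * N = N := by
    have := mul_geom_sum γ n
    rw [hγ, sub_self, sub_mul, one_mul, sub_eq_zero] at this
    exact this
  have hgi : ∀ i, γ ^ i * N = N := by
    intro i
    induction i with
    | zero => simp
    | succ i ih => rw [pow_succ, mul_assoc, hg, ih]
  have hsum : ∀ (t : ℕ) (f : ℕ → ℕ), (∑ i ∈ Finset.range t, γ ^ (f i)) * N = t * N := by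
    intro t f
    rw [Finset.sum_mul, Finset.sum_congr rfl fun i _ => hgi (f i)]
    simp
  have haN : a * N = k * N := hsum k id
  have hbN : b * N = l * N := by
    rw [← hsum l (fun i => k * i)]
    simp only [hb, pow_mul]
  have hNN : N * N = n * N := hsum n id
  have hab : a * b = 1 + c * N := by
    have h1 : a * b = ∑ i ∈ Finset.range (k * l), γ ^ i := by
      clear_value N
      rw [ha, hb]
      clear haN hbN hr hr' ha hb hkl hN hgi hsum
      induction l with
      | zero => simp
      | succ l ih =>
        rw [Finset.sum_range_succ, mul_add, ih, Nat.mul_succ, Finset.sum_range_add, ← pow_mul,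
          Finset.sum_mul]
        congr 1
        exact Finset.sum_congr rfl fun i _ => by rw [pow_add, mul_comm]
    have h2 : ∀ c : ℕ, ∑ i ∈ Finset.range (1 + c * n), γ ^ i = 1 + c * N := by
      intro c
      induction c with
      | zero => simp
      | succ c ih =>
        rw [Nat.succ_mul, ← add_assoc, Finset.sum_range_add, ih]
        have : ∑ i ∈ Finset.range n, γ ^ (1 + c * n + i) = N := by
          have h3 : ∀ i, γ ^ (1 + c * n + i) = γ * γ ^ i := by
            intro i
            rw [pow_add, pow_add, mul_comm c, pow_mul, hγ]; simp
          rw [Finset.sum_congr rfl fun i _ => h3 i, ← Finset.mul_sum, ← hN, hg]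
        rw [this]; push_cast; ring
    rw [h1, hkl, h2]
  have hpow : ∀ (x : T) (t : T), x * N = t * N → ∀ m : ℕ, x ^ m * N = t ^ m * N := by
    intro x t h m
    induction m with
    | zero => simp
    | succ m ih => rw [pow_succ, mul_assoc, h, mul_left_comm, ih, pow_succ]; ring
  have ham : a ^ m * N = (1 - n * r) * N := by
    rw [hpow a k haN m]; congr 1
    exact_mod_cast congrArg (Int.cast (R := T)) hr
  have hbm : b ^ m * N = (1 - n * r') * N := by
    rw [hpow b l hbN m]; congr 1
    exact_mod_cast congrArg (Int.cast (R := T)) hr'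
  -- `(1 + c N)^m = 1 + e N` with `n e = (1 + c n)^m - 1`
  have hex : ∀ m : ℕ, ∃ e : ℤ, (1 + (c : T) * N) ^ m = 1 + e * N ∧ (n : ℤ) * e = (1 + c * n) ^ m - 1 := by
    intro m
    induction m with
    | zero => exact ⟨0, by simp, by simp⟩
    | succ m ih =>
      obtain ⟨e, h1, h2⟩ := ih
      refine ⟨e + c + e * c * n, ?_, ?_⟩
      · rw [pow_succ, h1]; push_cast
        linear_combination (e * c : T) * hNN
      · rw [pow_succ]; linear_combination (1 + c * n : ℤ) * h2
  obtain ⟨e, he, he'⟩ := hex m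
  have hfin : e + r + r' - n * r * r' = 0 := by
    have h1 : ((k * l : ℕ) : ℤ) = 1 + c * n := by rw [hkl]; push_cast; ring
    have h2 : ((1 + c * n : ℤ)) ^ m = (1 - n * r) * (1 - n * r') := by
      rw [← h1, ← hr, ← hr']; push_cast; rw [mul_pow]
    have hn' : (n : ℤ) ≠ 0 := by exact_mod_cast hn
    apply mul_left_cancel₀ hn'
    rw [h2] at he'
    linear_combination he'
  have habm : a ^ m * b ^ m = 1 + e * N := by rw [← mul_pow, hab, he]
  have hfin' : (e : T) + r + r' - n * r * r' = 0 := by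
    exact_mod_cast congrArg (Int.cast (R := T)) hfin
  linear_combination habm + r' * ham + r * hbm + r * r' * hNN + N * hfin'

lemma hu_zeta {n k : ℕ} (ζ : ℂ) (hζ : IsPrimitiveRoot ζ n) (h1 : 1 < k) (h2 : k + 1 < n)
    (h : ‖ζ ^ k - 1‖ = ‖ζ - 1‖) : False := by
  have hn : n ≠ 0 := by omega
  have hnorm : ‖ζ‖ = 1 := hζ.norm'_eq_one hn
  have h0 : ζ ≠ 0 := hζ.ne_zero hn
  have hc : (starRingEnd ℂ) ζ = ζ⁻¹ := (Complex.inv_eq_conj hnorm).symm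
  have e1 := Complex.mul_conj' (ζ ^ k - 1)
  have e2 := Complex.mul_conj' (ζ - 1)
  rw [h, ← e2] at e1
  simp only [map_sub, map_pow, map_one, hc] at e1
  obtain ⟨j, rfl⟩ : ∃ j, k = j + 1 := ⟨k - 1, by omega⟩
  have e3 : (ζ ^ (j + 2) - 1) * (ζ ^ j - 1) = 0 := by
    have : ζ ^ j ≠ 0 := pow_ne_zero _ h0
    rw [inv_pow, pow_succ] at e1
    field_simp at e1
    have : (ζ ^ (j + 2) - 1) * (ζ ^ j - 1) * ζ ^ 0 = 0 := by
      rw [pow_add]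
      generalize ζ ^ j = w at *
      first
      | linear_combination e1
      | linear_combination -e1
    simpa using this
  rcases mul_eq_zero.1 e3 with h | h
  · have := hζ.dvd_of_pow_eq_one _ (sub_eq_zero.1 h)
    have := Nat.le_of_dvd (by omega) this
    omega
  · have := hζ.dvd_of_pow_eq_one _ (sub_eq_zero.1 h)
    have := Nat.le_of_dvd (by omega) this
    omega

open MonoidAlgebra in
lemma hu_bass {n : ℕ} [NeZero n] 
    (hfin : Finite (MonoidAlgebra ℤ (Multiplicative (ZMod n)))ˣ) (k : ℕ) (h1 : 1 < k) (h2 : k + 1 < n)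
    (hk : k.Coprime n) : False := by
  have hn : n ≠ 0 := by omega
  let m := n.totient
  have hm : 0 < m := Nat.totient_pos.2 (by omega)
  have tot : ∀ a : ℕ, a.Coprime n → ∃ r : ℤ, (a : ℤ) ^ m = 1 - n * r := by
    intro a ha
    have h3 := (Nat.ModEq.pow_totient ha)
    have h4 := (Int.natCast_modEq_iff.2 h3).dvd
    obtain ⟨r, hr⟩ := h4
    refine ⟨r, ?_⟩
    push_cast at hr
    rw [← hr]; ring
  let l := k ^ (m - 1)
  have hl : l.Coprime n := Nat.Coprime.pow_left _ hk
  obtain ⟨r, hr⟩ := tot k hk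
  obtain ⟨r', hr'⟩ := tot l hl
  obtain ⟨c, hc⟩ : ∃ c : ℕ, k * l = 1 + c * n := by
    have h3 : k * l = k ^ m := by rw [mul_comm, ← pow_succ, Nat.sub_add_cancel hm]
    have h4 : 1 ≤ k ^ m := Nat.one_le_pow _ _ (by omega)
    obtain ⟨c, hc⟩ := (Nat.modEq_iff_dvd' h4).1 (Nat.ModEq.pow_totient hk).symm
    exact ⟨c, by rw [h3, mul_comm c]; omega⟩
  let γ : MonoidAlgebra ℤ (Multiplicative (ZMod n)) := single (Multiplicative.ofAdd 1) 1
  have hγ : γ ^ n = 1 := by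
    simp only [γ, single_pow, one_pow, ← ofAdd_nsmul, one_def]; simp
  have key := hu_bass_alg γ n k l m c r r' hγ hc hr hr' hn
  let u : (MonoidAlgebra ℤ (Multiplicative (ZMod n)))ˣ := ⟨_, _, key, by rw [mul_comm]; exact key⟩
  obtain ⟨t, ht, hut⟩ := isOfFinOrder_iff_pow_eq_one.1 (isOfFinOrder_of_finite u)
  let χ : Multiplicative (ZMod n) →* ℂ := (ZMod.stdAddChar (N := n)).toMonoidHom
  let φ : MonoidAlgebra ℤ (Multiplicative (ZMod n)) →+* ℂ := (MonoidAlgebra.lift ℤ ℂ _ χ : _ →ₐ[ℤ] ℂ)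
  let ζ := φ γ
  have hζ : IsPrimitiveRoot ζ n := by
    have : ζ = ZMod.stdAddChar (N := n) 1 := by
      simp [ζ, φ, γ, χ]
    rw [this]
    have h3 := ZMod.stdAddChar_coe (N := n) 1
    have h4 := Complex.isPrimitiveRoot_exp n hn
    simp only [Int.cast_one] at h3
    rw [h3]
    convert h4 using 2
    ring
  have hN : ∑ i ∈ Finset.range n, ζ ^ i = 0 := hζ.geom_sum_eq_zero (by omega)
  have h3 : φ u = (∑ i ∈ Finset.range k, ζ ^ i) ^ m := by
    change φ (_ ^ m + _ * _) = _
    simp only [map_add, map_mul, map_pow, map_sum]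
    change _ + _ * (∑ i ∈ Finset.range n, ζ ^ i) = _
    rw [hN]; simp [ζ]
  have h4 : (φ u) ^ t = 1 := by
    rw [← map_pow, ← Units.val_pow_eq_pow_val, hut]; simp
  rw [h3, ← pow_mul] at h4
  have h5 : ‖∑ i ∈ Finset.range k, ζ ^ i‖ = 1 := by
    have := congrArg norm h4
    rw [norm_pow, norm_one] at this
    exact (pow_eq_one_iff_of_nonneg (norm_nonneg _) (by positivity)).1 this
  apply hu_zeta ζ hζ h1 h2
  rw [← geom_sum_mul, norm_mul, h5, one_mul]

lemma hu_order {R G : Type*} [CommRing R] [CharZero R] [Group G] [Finite G]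
    (hfin : Finite (MonoidAlgebra R G)ˣ) (g : G) : orderOf g ∈ ({1, 2, 3, 4, 6} : Set ℕ) := by
  obtain ⟨n, hn⟩ : ∃ n, orderOf g = n := ⟨_, rfl⟩
  have hpos : 0 < n := hn ▸ orderOf_pos g
  have : NeZero n := ⟨hpos.ne'⟩
  have h1 := hu_cyc hfin g n hn
  have h2 : Finite (MonoidAlgebra ℤ (Multiplicative (ZMod n)))ˣ := by
    refine hu_finite_of_inj (MonoidAlgebra.mapRingHom _ (Int.castRingHom R)) ?_ h1
    intro a b hab
    ext i
    have := congrArg (fun t => t.coeff i) hab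
    simpa using this
  rw [hn]
  by_contra hcon
  simp only [Set.mem_insert_iff, Set.mem_singleton_iff, not_or] at hcon
  obtain ⟨k, hk1, hk2, hk3⟩ : ∃ k, 1 < k ∧ k + 1 < n ∧ k.Coprime n := by
    have : n % 2 = 1 ∨ n % 4 = 0 ∨ n % 4 = 2 := by omega
    rcases this with h | h | h
    · exact ⟨2, by omega, by omega, by rw [Nat.coprime_two_left]; exact Nat.odd_iff.2 h⟩
    · obtain ⟨j, rfl⟩ : ∃ j, n = 4 * (j + 1) := ⟨n / 4 - 1, by omega⟩
      refine ⟨2 * j + 1, by omega, by omega, ?_⟩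
      have h3 : (2 * j + 1).Coprime (j + 1) := by
        rw [show 2 * j + 1 = j + (j + 1) by ring, Nat.coprime_add_self_left]; simp
      have h4 : (2 * j + 1).Coprime 2 := by rw [Nat.coprime_two_right]; exact ⟨j, rfl⟩
      rw [show 4 * (j + 1) = 2 * (2 * (j + 1)) by ring]
      exact h4.mul_right (h4.mul_right h3)
    · obtain ⟨j, rfl⟩ : ∃ j, n = 2 * (2 * (j + 1) + 1) := ⟨n / 4 - 1, by omega⟩
      refine ⟨2 * j + 1, by omega, by omega, ?_⟩
      have h4 : (2 * j + 1).Coprime 2 := by rw [Nat.coprime_two_right]; exact ⟨j, rfl⟩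
      refine h4.mul_right ?_
      rw [show 2 * (j + 1) + 1 = 2 + (2 * j + 1) by ring, Nat.coprime_add_self_right]
      exact h4
  exact hu_bass h2 k hk1 hk2 hk3

open MonoidAlgebra in
lemma hu_q8 {R G : Type*} [CommRing R] [IsDomain R] [CharZero R] [Group G] 
    (hfin : Finite (MonoidAlgebra R G)ˣ) (s : R) (N : ℤ) (hN : N ≠ 0) (hs : s ^ 2 = -(N : R) ^ 2)
    (x y : G) (hxy : x * y ≠ y * x) (hc : x * y * x⁻¹ = y⁻¹) (hsq : x ^ 2 = y ^ 2) (h4 : x ^ 4 = 1) :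
    False := by
  classical
  let X : MonoidAlgebra R G := single x 1
  let Y : MonoidAlgebra R G := single y 1
  let Z : MonoidAlgebra R G := single (x ^ 2) 1
  have hXX : X * X = Z := by simp only [X, Z, single_mul_single, one_mul, sq]
  have hYY : Y * Y = Z := by simp only [Y, Z, single_mul_single, one_mul, hsq]; rw [sq]
  have hZZ : Z * Z = 1 := by
    simp only [Z, single_mul_single, one_mul, ← pow_add]
    rw [h4]; rfl
  have hXY : X * Y = Y * X * Z := by
    simp only [X, Y, Z, single_mul_single, one_mul]
    congr 1
    rw [mul_inv_eq_iff_eq_mul] at hc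
    have : y⁻¹ = y * x ^ 2 := by
      rw [hsq, inv_eq_iff_mul_eq_one, ← pow_succ', ← pow_succ', show 2 + 1 + 1 = 2 * 2 from rfl, pow_mul, ← hsq, ← pow_mul, h4]
    rw [hc, this]; group
  have hXZ : X * Z = Z * X := by rw [← hXX, mul_assoc]
  have hYZ : Y * Z = Z * Y := by rw [← hYY, mul_assoc]
  have h0 := hu_nil hfin (fun n hn s => hu_tf n hn s) ((((N : R) • X + s • Y)) * (1 - Z)) (by
    have e1 : (((N : R) • X + s • Y)) * (1 - Z) = (1 - Z) * (((N : R) • X + s • Y)) := by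
      simp only [mul_sub, sub_mul, mul_add, add_mul, mul_one, one_mul, smul_mul_assoc, mul_smul_comm, hXZ, hYZ]
      module
    have e2 : (((N : R) • X + s • Y)) * (((N : R) • X + s • Y)) = (s * N) • (Y * X * (1 + Z)) := by
      simp only [mul_add, add_mul, smul_mul_assoc, mul_smul_comm, hXX, hYY, hXY, mul_one]
      have hs' : s • s • Z = -((N : R) • (N : R) • Z) := by
        rw [smul_smul, smul_smul, ← sq, hs, neg_smul, ← sq]
      simp only [smul_add]
      rw [hs']
      module
    have e3 : (1 + Z) * (1 - Z) = 0 := by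
      simp only [mul_sub, add_mul, mul_one, one_mul, hZZ]; abel
    rw [mul_assoc, ← mul_assoc (1 - Z), ← e1, mul_assoc _ (1 - Z), ← mul_assoc, e2, smul_mul_assoc, mul_assoc (Y * X), ← mul_assoc (1 + Z), e3]
    simp)
  have h1 := congrArg (fun t => t.coeff x) h0
  have d1 : y ≠ x := by rintro rfl; exact hxy rfl
  have d3 : x ^ 2 ≠ 1 := by
    intro h
    apply hxy
    rw [hsq, sq, ← inv_eq_iff_mul_eq_one] at h
    rw [h, mul_inv_eq_iff_eq_mul] at hc
    exact hc
  have d2 : x * x ^ 2 ≠ x := by simpa using d3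
  have d4 : y * x ^ 2 ≠ x := by
    intro h
    apply hxy
    rw [hsq, ← pow_succ'] at h
    rw [← h]; group
  simp [X, Y, Z, mul_sub, add_mul, single_mul_single, coeff_sub, d1, d2, d4, hN] at h1

lemma hu_abelian {R L G : Type} [CommRing R] [Module.Finite ℤ R] [Field L] [NumberField L]
    (hL : Module.finrank ℚ L = 2) (hre : IsEmpty (L →+* ℝ)) (f : R →+* L)
    (hf : Function.Injective f) [CommGroup G] [Finite G] (n : ℕ) [NeZero n] (ζ : L)
    (hζ : IsPrimitiveRoot ζ n) (hn : Monoid.exponent G ∣ n) :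
    Finite (MonoidAlgebra R G)ˣ := by
  classical
  have : Fintype G := Fintype.ofFinite G
  have h1 : HasEnoughRootsOfUnity L n := ⟨⟨ζ, hζ⟩, inferInstance⟩
  have h2 : HasEnoughRootsOfUnity L (Monoid.exponent G) := HasEnoughRootsOfUnity.of_dvd L hn
  let _ : Algebra R L := f.toAlgebra
  let φ : (G →* Lˣ) → MonoidAlgebra R G →ₐ[R] L := fun χ =>
    MonoidAlgebra.lift R L G ((Units.coeHom L).comp χ)
  have hfinG : Finite (G →* Lˣ) := by
    infer_instance
  have hS := hu_units_finite hL hre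
  have hIntegral : ∀ (u : MonoidAlgebra R G), IsIntegral ℤ u := fun u => IsIntegral.of_finite ℤ u
  have hinj : Function.Injective (fun (u : MonoidAlgebra R G) (χ : G →* Lˣ) => φ χ u) := by
    intro u v huv
    have hli := linearIndependent_monoidHom (G →* Lˣ) L
    let ev : G → ((G →* Lˣ) →* L) := fun g =>
      { toFun := fun χ => (χ g : L)
        map_one' := by simp
        map_mul' := by intro a b; simp }
    have hev : Function.Injective ev := by
      intro g h hgh
      by_contra hne
      obtain ⟨χ, hχ⟩ := CommGroup.exists_apply_ne_one_of_hasEnoughRootsOfUnity G L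
        (a := g * h⁻¹) (by rwa [ne_eq, mul_inv_eq_one])
      apply hχ
      have := DFunLike.congr_fun hgh χ
      have h3 : χ g = χ h := Units.ext this
      rw [map_mul, map_inv, h3, mul_inv_cancel]
    have hli2 := hli.comp ev hev
    rw [Fintype.linearIndependent_iff] at hli2
    have h4 := hli2 (fun g => f (u.coeff g) - f (v.coeff g)) (by
      funext χ
      have h5 := congrFun huv χ
      simp only [φ, MonoidAlgebra.lift_apply] at h5
      rw [Finsupp.sum_fintype _ _ (by simp), Finsupp.sum_fintype _ _ (by simp)] at h5
      simp only [Finset.sum_apply, Pi.smul_apply, Function.comp_apply, smul_eq_mul, sub_mul,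
        Finset.sum_sub_distrib, Pi.zero_apply]
      rw [sub_eq_zero]
      simp only [Algebra.smul_def] at h5
      exact h5)
    ext g
    exact hf (sub_eq_zero.1 (h4 g))
  have hfin : (Set.univ.pi fun _ : G →* Lˣ =>
    {z : L | IsIntegral ℤ z ∧ ∃ w, IsIntegral ℤ w ∧ z * w = 1}).Finite := Set.Finite.pi fun _ => hS
  have := hfin.to_subtype
  refine Finite.of_injective (β := (Set.univ.pi fun _ : G →* Lˣ =>
    {z : L | IsIntegral ℤ z ∧ ∃ w, IsIntegral ℤ w ∧ z * w = 1}))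
    (fun u => ⟨fun χ => φ χ u, fun χ _ => ⟨?_, φ χ (u⁻¹ : (MonoidAlgebra R G)ˣ), ?_, ?_⟩⟩) ?_
  · exact map_isIntegral_int (φ χ) (hIntegral _)
  · exact map_isIntegral_int (φ χ) (hIntegral _)
  · rw [← map_mul, Units.mul_inv, map_one]
  · intro u v huv
    exact Units.ext (hinj (congrArg Subtype.val huv))

lemma hu_abelian' {R L G : Type} [CommRing R] [Module.Finite ℤ R] [Field L] [NumberField L]
    (hL : Module.finrank ℚ L = 2) (hre : IsEmpty (L →+* ℝ)) (f : R →+* L)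
    (hf : Function.Injective f) [Group G] [Finite G] (hc : ∀ a b : G, a * b = b * a)
    (n : ℕ) [NeZero n] (ζ : L)
    (hζ : IsPrimitiveRoot ζ n) (hn : Monoid.exponent G ∣ n) :
    Finite (MonoidAlgebra R G)ˣ := by
  let I : CommGroup G := { (inferInstance : Group G) with mul_comm := hc }
  exact @hu_abelian R L G _ _ _ _ hL hre f hf I _ n _ ζ hζ hn

lemma hu_prim6 {L : Type} [Field L] [CharZero L] (α : L) (h : α ^ 2 = -3) :
    IsPrimitiveRoot ((1 + α) / 2) 6 := by
  have h3 : ((1 + α) / 2) ^ 3 = -1 := by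
    have : α ^ 3 = -3 * α := by rw [pow_succ, h]
    linear_combination (1 / 8 : L) * this + (3 / 8 : L) * h
  have h2 : ((1 + α) / 2) ^ 2 = (α - 1) / 2 := by linear_combination (1 / 4 : L) * h
  refine (IsPrimitiveRoot.iff (by norm_num)).2 ⟨?_, ?_⟩
  · rw [show (6 : ℕ) = 3 * 2 by norm_num, pow_mul, h3]; norm_num
  · intro l hl0 hl6 hl
    have e1 : (α : L) ≠ 1 := by
      rintro rfl
      have : (4 : L) = 0 := by linear_combination h
      norm_num at this
    have e2 : (α : L) ≠ 3 := by
      rintro rfl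
      have : (12 : L) = 0 := by linear_combination h
      norm_num at this
    have e3 : (α : L) ≠ -1 := by
      rintro rfl
      have : (4 : L) = 0 := by linear_combination h
      norm_num at this
    have e4 : (α : L) ≠ -3 := by
      rintro rfl
      have : (12 : L) = 0 := by linear_combination h
      norm_num at this
    interval_cases l
    · apply e1; linear_combination 2 * hl
    · apply e2; rw [h2] at hl; linear_combination 2 * hl
    · rw [h3] at hl; norm_num at hl
    · rw [show (4 : ℕ) = 3 + 1 by norm_num, pow_add, h3] at hl
      apply e4; linear_combination -2 * hl
    · rw [show (5 : ℕ) = 3 + 2 by norm_num, pow_add, h3, h2] at hl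
      apply e3; linear_combination -2 * hl

lemma hu_prim4 {L : Type} [Field L] [CharZero L] (α : L) (h : α ^ 2 = -1) :
    IsPrimitiveRoot α 4 := by
  have := IsPrimitiveRoot.orderOf α
  have h4 : orderOf α = 2 ^ (1 + 1) := by
    apply orderOf_eq_prime_pow
    · rw [pow_one, h]; norm_num
    · rw [show (2 ^ (1 + 1)) = 2 * 2 by norm_num, pow_mul, h]; norm_num
  rw [h4] at this
  exact this

lemma hu_exists_field (n : ℕ) (hn : n = 4 ∨ n = 6) : ∃ (L : Type) (_ : Field L) (_ : NumberField L)
    (ζ : L), Module.finrank ℚ L = 2 ∧ IsEmpty (L →+* ℝ) ∧ IsPrimitiveRoot ζ n := by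
  have : NeZero n := ⟨by omega⟩
  have : NeZero ((n : ℕ) : ℚ) := NeZero.charZero
  have : IsCyclotomicExtension {n} ℚ (CyclotomicField n ℚ) :=
    CyclotomicField.isCyclotomicExtension n ℚ
  refine ⟨CyclotomicField n ℚ, inferInstance, inferInstance, IsCyclotomicExtension.zeta n ℚ _,
    ?_, ?_, IsCyclotomicExtension.zeta_spec n ℚ _⟩
  · rw [IsCyclotomicExtension.finrank (n := n) _ (Polynomial.cyclotomic.irreducible_rat (by omega))]
    rcases hn with rfl | rfl <;> decide
  · have hz := IsCyclotomicExtension.zeta_spec n ℚ (CyclotomicField n ℚ)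
    refine ⟨fun f => ?_⟩
    have h1 : IsPrimitiveRoot (f (IsCyclotomicExtension.zeta n ℚ (CyclotomicField n ℚ))) n :=
      hz.map_of_injective f.injective
    set x := f (IsCyclotomicExtension.zeta n ℚ (CyclotomicField n ℚ))
    have h2 : x ^ n = 1 := h1.pow_eq_one
    have h3 : x ^ 2 ≠ 1 := h1.pow_ne_one_of_pos_of_lt (by norm_num) (by omega)
    apply h3
    have hn0 : n ≠ 0 := by omega
    have h4 : (x ^ 2) ^ n = 1 := by rw [← pow_mul, mul_comm, pow_mul, h2, one_pow]
    exact (pow_eq_one_iff_of_nonneg (sq_nonneg x) hn0).1 h4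

lemma hu_ringEquiv_int {K : Type} [Field K] [NumberField K] {R : Subring K} (hR : IsOrderIn R)
    (h1 : Module.finrank ℚ K = 1) : Nonempty (R ≃+* ℤ) := by
  have := hu_finite_int hR
  have hb : Function.Bijective (Int.castRingHom R) := by
    refine ⟨?_, ?_⟩
    · intro a b hab
      exact Int.cast_injective (α := K) (congrArg (fun r : R => (r : K)) hab)
    · intro r
      have hi : IsIntegral ℤ (r : K) := map_isIntegral_int R.subtype (IsIntegral.of_finite ℤ r)
      obtain ⟨q, hq⟩ := (finrank_eq_one_iff_of_nonzero' (1 : K) one_ne_zero).1 h1 r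
      rw [Rat.smul_def, mul_one] at hq
      rw [← hq] at hi
      have hi2 : IsIntegral ℤ q := by
        rw [← isIntegral_algebraMap_iff (algebraMap ℚ K).injective (R := ℤ)]
        simpa using hi
      obtain ⟨m, hm⟩ := IsIntegrallyClosed.isIntegral_iff.1 hi2
      refine ⟨m, Subtype.ext ?_⟩
      rw [← hq, ← hm]
      simp
  exact ⟨(RingEquiv.ofBijective _ hb).symm⟩

lemma hu_quat_units : Finite (Quaternion ℤ)ˣ := by
  have hb : ∀ u : (Quaternion ℤ)ˣ, Quaternion.normSq (u : Quaternion ℤ) = 1 := by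
    intro u
    have h1 : IsUnit (Quaternion.normSq (u : Quaternion ℤ)) := u.isUnit.map Quaternion.normSq
    rcases Int.isUnit_iff.1 h1 with h | h
    · exact h
    · rw [Quaternion.normSq_def'] at h
      nlinarith [sq_nonneg (u : Quaternion ℤ).re, sq_nonneg (u : Quaternion ℤ).imI,
        sq_nonneg (u : Quaternion ℤ).imJ, sq_nonneg (u : Quaternion ℤ).imK]
  have hle : ∀ x y : ℤ, 0 ≤ y → x ^ 2 + y = 1 → x ∈ Set.Icc (-1 : ℤ) 1 := by
    intro x y hy h
    constructor <;> nlinarith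
  refine Finite.of_injective
    (β := Set.Icc (-1 : ℤ) 1 × Set.Icc (-1 : ℤ) 1 × Set.Icc (-1 : ℤ) 1 × Set.Icc (-1 : ℤ) 1)
    (fun u => (⟨(u : Quaternion ℤ).re, hle _ ((u : Quaternion ℤ).imI ^ 2 +
        (u : Quaternion ℤ).imJ ^ 2 + (u : Quaternion ℤ).imK ^ 2) (by positivity) ?_⟩,
      ⟨(u : Quaternion ℤ).imI, hle _ ((u : Quaternion ℤ).re ^ 2 +
        (u : Quaternion ℤ).imJ ^ 2 + (u : Quaternion ℤ).imK ^ 2) (by positivity) ?_⟩,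
      ⟨(u : Quaternion ℤ).imJ, hle _ ((u : Quaternion ℤ).re ^ 2 +
        (u : Quaternion ℤ).imI ^ 2 + (u : Quaternion ℤ).imK ^ 2) (by positivity) ?_⟩,
      ⟨(u : Quaternion ℤ).imK, hle _ ((u : Quaternion ℤ).re ^ 2 +
        (u : Quaternion ℤ).imI ^ 2 + (u : Quaternion ℤ).imJ ^ 2) (by positivity) ?_⟩)) ?_
  any_goals (have h := hb u; rw [Quaternion.normSq_def'] at h; linarith)
  intro u v huv
  simp only [Prod.mk.injEq, Subtype.mk.injEq] at huv
  exact Units.ext (QuaternionAlgebra.ext huv.1 huv.2.1 huv.2.2.1 huv.2.2.2)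

/-- The value of the standard two-dimensional representation of the quaternion group. -/
def huQ (q : QuaternionGroup 2) : Quaternion ℤ :=
  match q with
  | .a i => (![⟨1, 0, 0, 0⟩, ⟨0, 1, 0, 0⟩, ⟨-1, 0, 0, 0⟩, ⟨0, -1, 0, 0⟩] : Fin 4 → Quaternion ℤ) i
  | .xa i => (![⟨0, 0, 1, 0⟩, ⟨0, 0, 0, -1⟩, ⟨0, 0, -1, 0⟩, ⟨0, 0, 0, 1⟩] : Fin 4 → Quaternion ℤ) i

/-- The standard quaternion representation. -/
def huQhom : QuaternionGroup 2 →* Quaternion ℤ where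
  toFun := huQ
  map_one' := by rfl
  map_mul' := by
    rintro (i | i) (j | j) <;> 
    fin_cases i <;> fin_cases j <;> rfl

/-- The values of the four linear characters. -/
def huL (e d : ℤ) (q : QuaternionGroup 2) : ℤ :=
  match q with
  | .a i => (![1, e, 1, e] : Fin 4 → ℤ) i
  | .xa i => (![d, d * e, d, d * e] : Fin 4 → ℤ) i

/-- The four linear characters. -/
def huLhom (e d : ℤ) (he : e * e = 1) (hd : d * d = 1) : QuaternionGroup 2 →* ℤ where
  toFun := huL e d
  map_one' := by rfl
  map_mul' := by
    rcases mul_self_eq_one_iff.1 he with rfl | rfl <;>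
    rcases mul_self_eq_one_iff.1 hd with rfl | rfl <;>
    rintro (i | i) (j | j) <;>
    fin_cases i <;> fin_cases j <;> rfl

/-- The ring homomorphism out of the integral group ring of the quaternion group. -/
noncomputable def huQring : MonoidAlgebra ℤ (QuaternionGroup 2) →+*
    ℤ × ℤ × ℤ × ℤ × Quaternion ℤ :=
  let F := fun (e d : ℤ) (he : e * e = 1) (hd : d * d = 1) =>
    (MonoidAlgebra.lift ℤ ℤ (QuaternionGroup 2) (huLhom e d he hd)).toRingHom
  (F 1 1 rfl rfl).prod ((F 1 (-1) rfl rfl).prod ((F (-1) 1 rfl rfl).prod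
    ((F (-1) (-1) rfl rfl).prod
      (MonoidAlgebra.lift ℤ (Quaternion ℤ) (QuaternionGroup 2) huQhom).toRingHom)))

lemma hu_sum_Q8 {M : Type} [AddCommMonoid M] (f : QuaternionGroup 2 → M) :
    ∑ q, f q = (f (.a 0) + f (.a 1) + f (.a 2) + f (.a 3)) +
      (f (.xa 0) + f (.xa 1) + f (.xa 2) + f (.xa 3)) := by
  let e : (ZMod 4 ⊕ ZMod 4) ≃ QuaternionGroup 2 :=
    { toFun := fun s => Sum.elim QuaternionGroup.a QuaternionGroup.xa s
      invFun := fun q => match q with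
        | .a i => Sum.inl i
        | .xa i => Sum.inr i
      left_inv := by rintro (i | i) <;> rfl
      right_inv := by rintro (i | i) <;> rfl }
  rw [← e.sum_comp f, Fintype.sum_sum_type]
  congr 1
  · exact Fin.sum_univ_four (fun i : Fin 4 => f (.a i))
  · exact Fin.sum_univ_four (fun i : Fin 4 => f (.xa i))

lemma hu_lift_sum {A H : Type} [Semiring A] [Algebra ℤ A] [Monoid H] [Fintype H] (F : H →* A)
    (u : MonoidAlgebra ℤ H) : MonoidAlgebra.lift ℤ A H F u = ∑ q, u.coeff q • F q := by
  rw [MonoidAlgebra.lift_apply, Finsupp.sum_fintype _ _ (fun i => zero_smul ℤ (F i))]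

lemma hu_Q8_units : Finite (MonoidAlgebra ℤ (QuaternionGroup 2))ˣ := by
  have := hu_quat_units
  have h1 : Finite (ℤ × Quaternion ℤ)ˣ := Finite.of_equiv _ MulEquiv.prodUnits.toEquiv.symm
  have h2 : Finite (ℤ × ℤ × Quaternion ℤ)ˣ := Finite.of_equiv _ MulEquiv.prodUnits.toEquiv.symm
  have h3 : Finite (ℤ × ℤ × ℤ × Quaternion ℤ)ˣ := Finite.of_equiv _ MulEquiv.prodUnits.toEquiv.symm
  have h4 : Finite (ℤ × ℤ × ℤ × ℤ × Quaternion ℤ)ˣ :=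
    Finite.of_equiv _ MulEquiv.prodUnits.toEquiv.symm
  refine hu_finite_of_inj huQring ?_ h4
  rw [injective_iff_map_eq_zero]
  intro u hu
  simp only [huQring, RingHom.prod_apply, Prod.mk_eq_zero, AlgHom.toRingHom_eq_coe,
    RingHom.coe_coe, hu_lift_sum, hu_sum_Q8] at hu
  obtain ⟨e1, e2, e3, e4, e5⟩ := hu
  simp only [Algebra.smul_def, eq_intCast] at e5
  have f1 := congrArg QuaternionAlgebra.re e5
  have f2 := congrArg QuaternionAlgebra.imI e5
  have f3 := congrArg QuaternionAlgebra.imJ e5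
  have f4 := congrArg QuaternionAlgebra.imK e5
  clear e5
  have l0 : ∀ e d he hd, huLhom e d he hd (.a 0) = 1 := fun _ _ _ _ => rfl
  have l1 : ∀ e d he hd, huLhom e d he hd (.a 1) = e := fun _ _ _ _ => rfl
  have l2 : ∀ e d he hd, huLhom e d he hd (.a 2) = 1 := fun _ _ _ _ => rfl
  have l3 : ∀ e d he hd, huLhom e d he hd (.a 3) = e := fun _ _ _ _ => rfl
  have l4 : ∀ e d he hd, huLhom e d he hd (.xa 0) = d := fun _ _ _ _ => rfl
  have l5 : ∀ e d he hd, huLhom e d he hd (.xa 1) = d * e := fun _ _ _ _ => rfl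
  have l6 : ∀ e d he hd, huLhom e d he hd (.xa 2) = d := fun _ _ _ _ => rfl
  have l7 : ∀ e d he hd, huLhom e d he hd (.xa 3) = d * e := fun _ _ _ _ => rfl
  have q0 : huQhom (.a 0) = ⟨1, 0, 0, 0⟩ := rfl
  have q1 : huQhom (.a 1) = ⟨0, 1, 0, 0⟩ := rfl
  have q2 : huQhom (.a 2) = ⟨-1, 0, 0, 0⟩ := rfl
  have q3 : huQhom (.a 3) = ⟨0, -1, 0, 0⟩ := rfl
  have q4 : huQhom (.xa 0) = ⟨0, 0, 1, 0⟩ := rfl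
  have q5 : huQhom (.xa 1) = ⟨0, 0, 0, -1⟩ := rfl
  have q6 : huQhom (.xa 2) = ⟨0, 0, -1, 0⟩ := rfl
  have q7 : huQhom (.xa 3) = ⟨0, 0, 0, 1⟩ := rfl
  simp only [l0, l1, l2, l3, l4, l5, l6, l7, smul_eq_mul] at e1 e2 e3 e4
  simp only [Quaternion.re_add, Quaternion.imI_add,
    Quaternion.imJ_add, Quaternion.imK_add, Quaternion.re_mul, Quaternion.imI_mul,
    Quaternion.imJ_mul, Quaternion.imK_mul, Quaternion.re_intCast, Quaternion.imI_intCast,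
    Quaternion.imJ_intCast, Quaternion.imK_intCast, Quaternion.re_zero, Quaternion.imI_zero,
    Quaternion.imJ_zero, Quaternion.imK_zero, Int.cast_id] at f1 f2 f3 f4
  simp only [q0, q1, q2, q3, q4, q5, q6, q7] at f1 f2 f3 f4
  clear l0 l1 l2 l3 l4 l5 l6 l7 q0 q1 q2 q3 q4 q5 q6 q7
  have z0 : u.coeff (.a 0) = 0 := by linarith
  have z1 : u.coeff (.a 1) = 0 := by linarith
  have z2 : u.coeff (.a 2) = 0 := by linarith
  have z3 : u.coeff (.a 3) = 0 := by linarith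
  have z4 : u.coeff (.xa 0) = 0 := by linarith
  have z5 : u.coeff (.xa 1) = 0 := by linarith
  have z6 : u.coeff (.xa 2) = 0 := by linarith
  have z7 : u.coeff (.xa 3) = 0 := by linarith
  ext q
  rcases q with i | i <;> fin_cases i
  exacts [z0, z1, z2, z3, z4, z5, z6, z7]

/-- Twisted projection of the group ring of a product. -/
noncomputable def huTw {H A : Type} [Group H] [CommGroup A] (χ : A →* ℤˣ) :
    MonoidAlgebra ℤ (H × A) →+* MonoidAlgebra ℤ H :=
  (MonoidAlgebra.lift ℤ (MonoidAlgebra ℤ H) (H × A)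
    { toFun := fun p => MonoidAlgebra.single p.1 ((χ p.2 : ℤˣ) : ℤ)
      map_one' := by simp [MonoidAlgebra.one_def]
      map_mul' := by intro p q; simp [MonoidAlgebra.single_mul_single] }).toRingHom

lemma hu_prod_units {H A : Type} [Group H] [Finite H] [CommGroup A] [Finite A]
    (hA : ∀ a : A, a ^ 2 = 1) (hfin : Finite (MonoidAlgebra ℤ H)ˣ) :
    Finite (MonoidAlgebra ℤ (H × A))ˣ := by
  classical
  have : Fintype H := Fintype.ofFinite H
  have : Fintype A := Fintype.ofFinite A
  have : Finite (A →* ℤˣ) := DFunLike.finite _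
  have h1 : Finite ((A →* ℤˣ) → MonoidAlgebra ℤ H)ˣ :=
    Finite.of_equiv _ MulEquiv.piUnits.toEquiv.symm
  refine hu_finite_of_inj (RingHom.pi fun χ : A →* ℤˣ => huTw (H := H) χ) ?_ h1
  rw [injective_iff_map_eq_zero]
  intro u hu
  let ev : A → ((A →* ℤˣ) →* ℤ) := fun a =>
    { toFun := fun χ => ((χ a : ℤˣ) : ℤ)
      map_one' := by simp
      map_mul' := by intro a b; simp }
  have hev : Function.Injective ev := by
    intro g h hgh
    by_contra hne
    obtain ⟨χ, hχ⟩ := hu_sep hA (g * h⁻¹) (by rwa [ne_eq, mul_inv_eq_one])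
    have h3 : χ g = χ h := Units.ext (DFunLike.congr_fun hgh χ)
    rw [map_mul, map_inv, h3, mul_inv_cancel] at hχ
    exact absurd hχ (by decide)
  have hli := (linearIndependent_monoidHom (A →* ℤˣ) ℤ).comp ev hev
  rw [Fintype.linearIndependent_iff] at hli
  ext ⟨q, a⟩
  refine hli (fun a => u.coeff (q, a)) ?_ a
  funext χ
  have h0 : huTw (H := H) χ u = 0 := congrFun hu χ
  have h2 := congrArg (fun t => t.coeff q) h0
  simp only [huTw, AlgHom.toRingHom_eq_coe, RingHom.coe_coe, hu_lift_sum] at h2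
  rw [Fintype.sum_prod_type] at h2
  simp [Finsupp.single_apply] at h2
  simpa [ev] using h2

/-- Let `R` be an order in a number field `K` and `G` a finite
group. Then the unit group of the group ring `RG` is finite iff one of:
(1) `K = ℚ` and `G` is abelian of exponent dividing 4 or 6, or `G ≅ Q₈ × A` with
`A` an elementary abelian 2-group; (2) `K` is imaginary quadratic and `G` is an
elementary abelian 2-group; (3) `K ≅ ℚ(√−3)` and `G` is abelian of exponent 3 or
6; (4) `K ≅ ℚ(√−1)` and `G` is abelian of exponent 4. -/
theorem group_ring_units_finite_iff
    (K : Type) [Field K] [NumberField K] (R : Subring K) (hR : IsOrderIn R)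
    (G : Type) [Group G] [Finite G] :
    Finite (MonoidAlgebra ↥R G)ˣ ↔
      (Module.finrank ℚ K = 1 ∧
        (((∀ a b : G, a * b = b * a) ∧
            (Monoid.exponent G ∣ 4 ∨ Monoid.exponent G ∣ 6)) ∨
          ∃ (A : Type) (_ : CommGroup A), (∀ a : A, a ^ 2 = 1) ∧
            Nonempty (G ≃* QuaternionGroup 2 × A))) ∨
      (Module.finrank ℚ K = 2 ∧ IsEmpty (K →+* ℝ) ∧
        (∀ a b : G, a * b = b * a) ∧ (∀ g : G, g ^ 2 = 1)) ∨
      (Module.finrank ℚ K = 2 ∧ (∃ α : K, α ^ 2 = -3) ∧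
        (∀ a b : G, a * b = b * a) ∧
        (Monoid.exponent G = 3 ∨ Monoid.exponent G = 6)) ∨
      (Module.finrank ℚ K = 2 ∧ (∃ α : K, α ^ 2 = -1) ∧
        (∀ a b : G, a * b = b * a) ∧ Monoid.exponent G = 4) := by
  have hRfin := hu_finite_int hR
  have hcz : CharZero R := ⟨fun a b hab => by
    exact Nat.cast_injective (R := K) (congrArg (fun r : R => (r : K)) hab)⟩
  constructor
  · intro hfin
    have hRu : Finite Rˣ := hu_finite_of_inj (MonoidAlgebra.singleOneRingHom (R := R) (M := G))
      (fun a b hab => by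
        simpa using congrArg (fun t => t.coeff 1) hab) hfin
    have hord := hu_order hfin
    have hc := hu_conj (hu_bicyclic hfin) hord
    have hexp : (∀ a b : G, a * b = b * a) → ∃ g : G, orderOf g = Monoid.exponent G := by
      intro hab
      let I : CommGroup G := { (inferInstance : Group G) with mul_comm := hab }
      exact Monoid.exists_orderOf_eq_exponent (G := G) Monoid.ExponentExists.of_finite
    rcases hu_field hR hRu with h1 | ⟨h2, hre⟩
    · left
      refine ⟨h1, ?_⟩
      by_cases hab : ∀ a b : G, a * b = b * a
      · left
        refine ⟨hab, ?_⟩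
        obtain ⟨g, hg⟩ := hexp hab
        have := hord g
        rw [hg] at this
        simp only [Set.mem_insert_iff, Set.mem_singleton_iff] at this
        rcases this with h | h | h | h | h <;> rw [h] <;> decide
      · right
        push Not at hab
        obtain ⟨x, y, hxy⟩ := hab
        exact hu_struct hc x y hxy
    · right
      obtain ⟨s, d, hd, hs⟩ := hu_sqrt hR h2 hre
      have hsK : (s : K) ^ 2 = -(d : K) := by
        have := congrArg (fun r : R => (r : K)) hs
        simpa using this
      have four : ∀ g : G, orderOf g = 4 → IsSquare d := fun g hg =>
        hu_four (hu_cyc hfin g 4 hg) s d hd hs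
      have three : ∀ g : G, orderOf g = 3 → IsSquare (3 * d) := fun g hg =>
        hu_three (hu_cyc hfin g 3 hg) s d hd hs
      by_cases hab : ∀ a b : G, a * b = b * a
      · obtain ⟨g, hg⟩ := hexp hab
        have := hord g
        rw [hg] at this
        simp only [Set.mem_insert_iff, Set.mem_singleton_iff] at this
        have case2 : Monoid.exponent G ∣ 2 → ∀ g : G, g ^ 2 = 1 := fun h g =>
          Monoid.exponent_dvd_iff_forall_pow_eq_one.1 h g
        have case3 : IsSquare (3 * d) → ∃ α : K, α ^ 2 = -3 := by
          rintro ⟨e, he⟩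
          have he0 : (e : K) ≠ 0 := by
            intro h
            have : e = 0 := by exact_mod_cast h
            subst this; omega
          refine ⟨3 * s / e, ?_⟩
          have heK : (3 : K) * d = e * e := by exact_mod_cast congrArg (Int.cast (R := K)) he
          rw [div_pow, div_eq_iff (pow_ne_zero 2 he0)]
          linear_combination 9 * hsK - 3 * heK
        rcases this with h | h | h | h | h
        · exact Or.inl ⟨h2, hre, hab, case2 (by rw [h]; decide)⟩
        · exact Or.inl ⟨h2, hre, hab, case2 (by rw [h])⟩
        · exact Or.inr (Or.inl ⟨h2, case3 (three g (by rw [hg, h])), hab, Or.inl h⟩)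
        · refine Or.inr (Or.inr ⟨h2, ?_, hab, h⟩)
          obtain ⟨e, he⟩ := four g (by rw [hg, h])
          have he0 : (e : K) ≠ 0 := by
            intro h
            have : e = 0 := by exact_mod_cast h
            subst this; omega
          refine ⟨s / e, ?_⟩
          have heK : (d : K) = e * e := by exact_mod_cast congrArg (Int.cast (R := K)) he
          rw [div_pow, div_eq_iff (pow_ne_zero 2 he0)]
          linear_combination hsK - heK
        · refine Or.inr (Or.inl ⟨h2, case3 (three (g ^ 2) ?_), hab, Or.inr h⟩)
          rw [orderOf_pow, hg, h]; decide
      · exfalso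
        push Not at hab
        obtain ⟨x, y, hxy⟩ := hab
        obtain ⟨p1, p2, p3⟩ := hu_pair hc x y hxy
        have hx2 : x ^ 2 ≠ 1 := by
          intro hx
          rw [hx] at p2
          have hyi : y⁻¹ = y := by
            rw [inv_eq_iff_mul_eq_one, ← pow_two, ← p2]
          rw [hyi, mul_inv_eq_iff_eq_mul] at p1
          exact hxy p1
        have hx4 : orderOf x = 4 := by
          have := orderOf_eq_prime_pow (p := 2) (n := 1) (x := x) (by simpa using hx2)
            (by simpa using p3)
          simpa using this
        obtain ⟨e, he⟩ := four x hx4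
        have he0 : e ≠ 0 := by
          rintro rfl; omega
        refine hu_q8 hfin s e he0 ?_ x y hxy p1 p2 p3
        rw [hs, he]; push_cast; ring
  · rintro (⟨h1, (⟨hab, he⟩ | ⟨A, _, hA, ⟨e⟩⟩)⟩ | ⟨h2, hre, hab, he⟩ | ⟨h2, ⟨α, hα⟩, hab, he⟩ |
      ⟨h2, ⟨α, hα⟩, hab, he⟩)
    · obtain ⟨eR⟩ := hu_ringEquiv_int hR h1
      obtain ⟨n, hn, hen⟩ : ∃ n, (n = 4 ∨ n = 6) ∧ Monoid.exponent G ∣ n := by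
        rcases he with h | h
        · exact ⟨4, Or.inl rfl, h⟩
        · exact ⟨6, Or.inr rfl, h⟩
      have : NeZero n := ⟨by omega⟩
      obtain ⟨L, _, _, ζ, hL, hre, hζ⟩ := hu_exists_field n hn
      refine hu_abelian' hL hre ((Int.castRingHom L).comp eR.toRingHom) ?_ hab n ζ hζ hen
      exact (Int.cast_injective (α := L)).comp eR.injective
    · obtain ⟨eR⟩ := hu_ringEquiv_int hR h1
      have : Finite (QuaternionGroup 2 × A) := Finite.of_equiv G e.toEquiv
      have : Finite A := Finite.of_surjective (Prod.snd : QuaternionGroup 2 × A → A)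
        Prod.snd_surjective
      have hfin := hu_prod_units hA hu_Q8_units
      refine hu_finite_of_inj (((MonoidAlgebra.mapRingEquiv _ eR).trans
        (MonoidAlgebra.mapDomainRingEquiv ℤ e)) :
          MonoidAlgebra R G →+* MonoidAlgebra ℤ (QuaternionGroup 2 × A)) ?_ hfin
      exact RingEquiv.injective _
    · refine hu_abelian' h2 hre R.subtype Subtype.val_injective hab 2 (-1) ?_
        (Monoid.exponent_dvd_iff_forall_pow_eq_one.2 he)
      exact IsPrimitiveRoot.neg_one 0 (by norm_num)
    · refine hu_abelian' h2 (hu_no_real α 3 (by norm_num) (by simpa using hα)) R.subtype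
        Subtype.val_injective hab 6 _ (hu_prim6 α hα) ?_
      rcases he with h | h <;> rw [h] <;> decide
    · refine hu_abelian' h2 (hu_no_real α 1 (by norm_num) (by simpa using hα)) R.subtype
        Subtype.val_injective hab 4 _ (hu_prim4 α hα) ?_
      rw [he]
end

section
/- Let R be an order in a number field K and G a finite group. Then the group of units RG* of the group ring RG is virtually abelian if and only if either G is abelian, or K is totally real and G is isomorphic to Q8 × A for A an elementary abelian 2-group. -/
section GroupTheory

/-- power of a product in a class-two situation -/
theorem mul_pow_of_comm_eq {G : Type*} [Group G] (x y d : G) (h : x * y = y * x * d)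
    (hx : Commute d x) (hy : Commute d y) (n : ℕ) :
    (y * x) ^ n = y ^ n * x ^ n * d ^ (n.choose 2) := by
  have h1 : ∀ m : ℕ, x ^ m * y = y * x ^ m * d ^ m := by
    intro m
    induction m with
    | zero => simp
    | succ m ih =>
      calc x ^ (m+1) * y = x ^ m * (x * y) := by rw [pow_succ]; group
        _ = (x ^ m * y) * x * d := by rw [h]; group
        _ = y * x ^ m * (d ^ m * x) * d := by rw [ih]; group
        _ = y * x ^ m * (x * d ^ m) * d := by rw [(hx.pow_left m).eq]
        _ = _ := by rw [pow_succ, pow_succ]; group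
  induction n with
  | zero => simp
  | succ n ih =>
    have hc : (n+1).choose 2 = n + n.choose 2 := by
      rw [Nat.choose_succ_succ' n 1]; simp
    calc (y * x) ^ (n+1) = y ^ n * x ^ n * (d ^ (n.choose 2) * (y * x)) := by
          rw [pow_succ, ih]; group
      _ = y ^ n * (x ^ n * y) * x * d ^ (n.choose 2) := by
          rw [((hy.mul_right hx).pow_left _).eq]; group
      _ = y ^ (n+1) * x ^ n * (d ^ n * x) * d ^ (n.choose 2) := by
          rw [h1, pow_succ]; group
      _ = y ^ (n+1) * x ^ n * (x * d ^ n) * d ^ (n.choose 2) := by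
          rw [(hx.pow_left n).eq]
      _ = _ := by rw [hc, pow_add, pow_succ x]; group

/-- commutator-like element moves through powers -/
theorem pow_mul_of_comm_eq {G : Type*} [Group G] (x y d : G) (h : x * y = y * x * d)
    (hx : Commute d x) (m : ℕ) : x ^ m * y = y * x ^ m * d ^ m := by
  induction m with
  | zero => simp
  | succ m ih =>
    calc x ^ (m+1) * y = x ^ m * (x * y) := by rw [pow_succ]; group
      _ = (x ^ m * y) * x * d := by rw [h]; group
      _ = y * x ^ m * (d ^ m * x) * d := by rw [ih]; group
      _ = y * x ^ m * (x * d ^ m) * d := by rw [(hx.pow_left m).eq]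
      _ = _ := by rw [pow_succ, pow_succ]; group

theorem mul_pow_of_comm_eq' {G : Type*} [Group G] (x y d : G) (h : x * y = y * x * d)
    (hy : Commute d y) (m : ℕ) : x * y ^ m = y ^ m * x * d ^ m := by
  induction m with
  | zero => simp
  | succ m ih =>
    calc x * y ^ (m+1) = (x * y ^ m) * y := by rw [pow_succ]; group
      _ = y ^ m * x * (d ^ m * y) := by rw [ih]; group
      _ = y ^ m * (x * y) * d ^ m := by rw [(hy.pow_left m).eq]; group
      _ = y ^ (m+1) * x * (d * d ^ m) := by rw [h, pow_succ]; group
      _ = _ := by rw [pow_succ' d]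

/-- A finite group with all cyclic subgroups normal that is not abelian contains a
quaternion pair. -/
theorem exists_quaternion_pair {G : Type*} [Group G] [Finite G]
    (hN : ∀ a b : G, b⁻¹ * a * b ∈ Subgroup.zpowers a)
    (hG : ¬ ∀ a b : G, a * b = b * a) :
    ∃ i j z : G, i ^ 2 = z ∧ j ^ 2 = z ∧ z ^ 2 = 1 ∧ z ≠ 1 ∧ i * j = j * i * z := by
  classical
  -- minimal noncentral element
  have hex : ∃ n : ℕ, ∃ a b : G, orderOf a = n ∧ a * b ≠ b * a := by
    push Not at hG
    obtain ⟨a, b, h⟩ := hG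
    exact ⟨_, a, b, rfl, h⟩
  obtain ⟨a, b0, han, hab0⟩ := Nat.find_spec hex
  have hamin : ∀ x y : G, orderOf x < orderOf a → x * y = y * x := by
    intro x y hx
    by_contra hne
    rw [han] at hx
    exact Nat.find_min hex hx ⟨x, y, rfl, hne⟩
  have hex2 : ∃ n : ℕ, ∃ b : G, orderOf b = n ∧ a * b ≠ b * a := ⟨_, b0, rfl, hab0⟩
  obtain ⟨b, hbn, hab⟩ := Nat.find_spec hex2
  have hbmin : ∀ y : G, orderOf y < orderOf b → a * y = y * a := by
    intro y hy
    by_contra hne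
    rw [hbn] at hy
    exact Nat.find_min hex2 hy ⟨y, rfl, hne⟩
  clear hbn han hab0
  have hale : orderOf a ≤ orderOf b := by
    by_contra hlt
    push Not at hlt
    exact hab (hamin b a hlt).symm
  -- commutator
  obtain ⟨c, hc⟩ : ∃ c, c = a⁻¹ * b⁻¹ * a * b := ⟨_, rfl⟩
  have hcomm : a * b = b * a * c := by rw [hc]; group
  have hca : c ∈ Subgroup.zpowers a := by
    have : c = a⁻¹ * (b⁻¹ * a * b) := by rw [hc]; group
    rw [this]
    exact mul_mem (inv_mem (Subgroup.mem_zpowers a)) (hN a b)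
  have hcb : c ∈ Subgroup.zpowers b := by
    have : c = (a⁻¹ * b * a)⁻¹ * b := by rw [hc]; group
    rw [this]
    exact mul_mem (inv_mem (hN b a)) (Subgroup.mem_zpowers b)
  have hc1 : c ≠ 1 := by
    intro h; rw [h, mul_one] at hcomm; exact hab hcomm
  have cca : Commute c a := by
    obtain ⟨k, hk⟩ := Subgroup.mem_zpowers_iff.1 hca
    rw [← hk]; exact (Commute.refl a).zpow_left k
  have ccb : Commute c b := by
    obtain ⟨k, hk⟩ := Subgroup.mem_zpowers_iff.1 hcb
    rw [← hk]; exact (Commute.refl b).zpow_left k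
  have ha1 : a ≠ 1 := by rintro rfl; simp at hab
  have hb1 : b ≠ 1 := by rintro rfl; simp at hab
  have hcpa : ∀ p : ℕ, p.Prime → p ∣ orderOf a → c ^ p = 1 := by
    intro p hp hd
    have hlt : orderOf (a ^ p) < orderOf a := by
      rw [orderOf_pow_of_dvd hp.ne_zero hd]
      exact Nat.div_lt_self (orderOf_pos a) hp.one_lt
    have h1 := hamin (a ^ p) b hlt
    have h2 := pow_mul_of_comm_eq a b c hcomm cca p
    rw [h1] at h2
    simpa using h2.symm
  have hcpb : ∀ p : ℕ, p.Prime → p ∣ orderOf b → c ^ p = 1 := by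
    intro p hp hd
    have hlt : orderOf (b ^ p) < orderOf b := by
      rw [orderOf_pow_of_dvd hp.ne_zero hd]
      exact Nat.div_lt_self (orderOf_pos b) hp.one_lt
    have h1 := hbmin (b ^ p) hlt
    have h2 := mul_pow_of_comm_eq' a b c hcomm ccb p
    rw [h1] at h2
    simpa using h2.symm
  obtain ⟨p, hp, hpa⟩ := Nat.exists_prime_and_dvd (n := orderOf a) (by simpa using ha1)
  have hpc : orderOf c = p := by
    have := Fact.mk hp
    exact orderOf_eq_prime (hcpa p hp hpa) hc1
  have hprime_a : ∀ q : ℕ, q.Prime → q ∣ orderOf a → q = p := by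
    intro q hq hd
    have := Fact.mk hq
    rw [← hpc, orderOf_eq_prime (hcpa q hq hd) hc1]
  have hprime_b : ∀ q : ℕ, q.Prime → q ∣ orderOf b → q = p := by
    intro q hq hd
    have := Fact.mk hq
    rw [← hpc, orderOf_eq_prime (hcpb q hq hd) hc1]
  obtain ⟨k, hk⟩ : ∃ k, orderOf a = p ^ k :=
    ⟨_, Nat.eq_prime_pow_of_unique_prime_dvd (orderOf_pos a).ne' (fun {q} hq hd => hprime_a q hq hd)⟩
  obtain ⟨l, hl⟩ : ∃ l, orderOf b = p ^ l :=
    ⟨_, Nat.eq_prime_pow_of_unique_prime_dvd (orderOf_pos b).ne' (fun {q} hq hd => hprime_b q hq hd)⟩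
  have hkl : k ≤ l := by
    rw [hk, hl] at hale
    exact (Nat.pow_le_pow_iff_right hp.one_lt).1 hale
  -- c is a power of a and of b
  obtain ⟨u, hu⟩ : ∃ u : ℕ, a ^ u = c := by
    have := (mem_powers_iff_mem_zpowers (x := a) (y := c)).2 hca
    exact (Submonoid.mem_powers_iff _ _).1 this
  obtain ⟨w, hw⟩ : ∃ w : ℕ, b ^ w = c := by
    have := (mem_powers_iff_mem_zpowers (x := b) (y := c)).2 hcb
    exact (Submonoid.mem_powers_iff _ _).1 this
  have hcp : c ^ p = 1 := hcpa p hp hpa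
  have hk1 : 1 ≤ k := by
    rcases Nat.eq_zero_or_pos k with h | h
    · rw [h, pow_zero] at hk; exact absurd (orderOf_eq_one_iff.1 hk) ha1
    · exact h
  obtain ⟨k', rfl⟩ : ∃ k', k = k' + 1 := ⟨k - 1, by omega⟩
  obtain ⟨l', rfl⟩ : ∃ l', l = l' + 1 := ⟨l - 1, by omega⟩
  obtain ⟨v, hv⟩ : p ^ k' ∣ u := by
    have : p ^ (k' + 1) ∣ u * p := by
      rw [← hk]; apply orderOf_dvd_of_pow_eq_one; rw [pow_mul, hu, hcp]
    rw [pow_succ] at this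
    exact Nat.dvd_of_mul_dvd_mul_right hp.pos this
  obtain ⟨w', hw'⟩ : p ^ l' ∣ w := by
    have : p ^ (l' + 1) ∣ w * p := by
      rw [← hl]; apply orderOf_dvd_of_pow_eq_one; rw [pow_mul, hw, hcp]
    rw [pow_succ] at this
    exact Nat.dvd_of_mul_dvd_mul_right hp.pos this
  obtain ⟨q, hq⟩ : ∃ q, q = p ^ k' := ⟨_, rfl⟩
  have haqp : (a ^ q) ^ p = 1 := by
    rw [← pow_mul, hq, ← pow_succ, ← hk, pow_orderOf_eq_one]
  have hcv : c = (a ^ q) ^ v := by rw [← pow_mul, hq, ← hv, hu]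
  have hvp : Nat.Coprime v p := by
    rw [Nat.coprime_comm, hp.coprime_iff_not_dvd]
    rintro ⟨t, rfl⟩
    rw [pow_mul, haqp, one_pow] at hcv
    exact hc1 hcv
  have hk'1 : 1 ≤ k' := by
    rcases Nat.eq_zero_or_pos k' with h | h
    · exfalso
      rw [h, pow_zero] at hq
      rw [hq, pow_one] at hcv haqp
      obtain ⟨v', hv'⟩ := Nat.exists_mul_mod_eq_one_of_coprime hvp hp.one_lt
      have : a = c ^ v' := by
        rw [hcv, ← pow_mul, ← pow_mod_orderOf a (v * v'), hk, h, zero_add, pow_one, hv'.2, pow_one]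
      apply hab
      rw [this]; exact (ccb.pow_left v').eq
    · exact h
  obtain ⟨v', hv'⟩ := Nat.exists_mul_mod_eq_one_of_coprime hvp hp.one_lt
  have haq : a ^ q = c ^ v' := by
    have ho : orderOf (a ^ q) = p := by
      have := Fact.mk hp
      refine orderOf_eq_prime haqp ?_
      intro h; rw [h, one_pow] at hcv; exact hc1 hcv
    rw [hcv, ← pow_mul, ← pow_mod_orderOf (a ^ q) (v * v'), ho, hv'.2, pow_one]
  obtain ⟨t, ht⟩ : ∃ t, l' = k' + t := ⟨l' - k', by omega⟩
  obtain ⟨s, hs⟩ : ∃ s, s = p ^ t * w' * v' := ⟨_, rfl⟩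
  have hbs : b ^ (s * q) = a ^ q := by
    rw [haq, ← hw, ← pow_mul]
    congr 1
    rw [hs, hq, hw', ht, pow_add]; ring
  -- the new element
  have hy : a * (b ^ s)⁻¹ = (b ^ s)⁻¹ * a * (c ^ s)⁻¹ := by
    have h1 := mul_pow_of_comm_eq' a b c hcomm ccb s
    have h2 : Commute (c ^ s) a := cca.pow_left s
    have h3 : a * b ^ s = b ^ s * (a * c ^ s) := by rw [h1]; group
    have h4 : (b ^ s)⁻¹ * a * b ^ s = a * c ^ s := by
      rw [mul_assoc, h3]; group
    have h5 : a = b^s * (a * c^s) * (b^s)⁻¹ := by rw [← h4]; group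
    have h6 : Commute (c^s) (b^s) := (ccb.pow_left s).pow_right s
    have h7 : Commute (c ^ s)  (b ^ s)⁻¹ := h6.inv_right
    have h8 : (b^s)⁻¹ * a = a * (b^s)⁻¹ * c^s := by
      calc (b^s)⁻¹ * a = (b^s)⁻¹ * (b^s * (a * c^s) * (b^s)⁻¹) := by rw [← h5]
        _ = a * (c^s * (b^s)⁻¹) := by group
        _ = _ := by rw [h7.eq]; group
    rw [h8]; group
  have hpow := mul_pow_of_comm_eq a (b ^ s)⁻¹ (c ^ s)⁻¹ hy
    (cca.pow_left s).inv_left ((ccb.pow_left s).pow_right s).inv_inv q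
  have hpow2 : ((b ^ s)⁻¹ * a) ^ q = ((c ^ s)⁻¹) ^ (q.choose 2) := by
    rw [hpow, inv_pow, ← pow_mul, hbs]; simp
  have hnotcomm : ((b ^ s)⁻¹ * a) * b ≠ b * ((b ^ s)⁻¹ * a) := by
    intro h
    apply hab
    have h1 : (b ^ s)⁻¹ * (a * b) = (b^s)⁻¹ * (b * a) := by
      have h2 : b * (b ^ s)⁻¹ = (b^s)⁻¹ * b := ((Commute.refl b).pow_right s).inv_right.eq
      calc (b ^ s)⁻¹ * (a * b) = b * ((b ^ s)⁻¹ * a) := by rw [← h]; group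
        _ = (b * (b ^ s)⁻¹) * a := by group
        _ = _ := by rw [h2]; group
    exact mul_left_cancel h1
  have hqlt : q < orderOf a := by rw [hk, hq]; exact Nat.pow_lt_pow_right hp.one_lt (by omega)
  have hqpos : 0 < q := by rw [hq]; exact pow_pos hp.pos _
  have hne : ((c ^ s)⁻¹) ^ (q.choose 2) ≠ 1 := by
    intro h1
    rw [h1] at hpow2
    have : orderOf ((b ^ s)⁻¹ * a) < orderOf a :=
      lt_of_le_of_lt (orderOf_le_of_pow_eq_one hqpos hpow2) hqlt
    exact hnotcomm (hamin _ _ this)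
  have hnd : ¬ p ∣ s * q.choose 2 := by
    rintro ⟨r, hr⟩
    apply hne
    rw [inv_pow, ← pow_mul, hr, pow_mul, hcp]; simp
  have ht0 : t = 0 := by
    by_contra h
    apply hnd
    rw [hs]
    exact Dvd.dvd.mul_right (Dvd.dvd.mul_right (Dvd.dvd.mul_right (dvd_pow_self p h) _) _) _
  have hpq : p ∣ q := by rw [hq]; exact dvd_pow_self p (by omega)
  have hch : q.choose 2 * 2 = q * (q - 1) := Nat.choose_two_right q ▸ Nat.div_mul_cancel (Nat.even_mul_pred_self q).two_dvd
  have hp2 : p = 2 := by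
    by_contra h
    apply hnd
    apply Dvd.dvd.mul_left
    have : p ∣ q.choose 2 * 2 := by rw [hch]; exact hpq.mul_right _
    rcases hp.dvd_mul.1 this with h1 | h1
    · exact h1
    · exact absurd ((Nat.prime_dvd_prime_iff_eq hp Nat.prime_two).1 h1) h
  subst hp2
  have hk'2 : k' = 1 := by
    by_contra h
    apply hnd
    apply Dvd.dvd.mul_left
    have h4 : 4 ∣ q := by
      rw [hq]; exact (pow_dvd_pow 2 (show 2 ≤ k' by omega) : 2 ^ 2 ∣ 2 ^ k')
    obtain ⟨r, hr⟩ := h4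
    refine ⟨r * (q - 1), ?_⟩
    have : q.choose 2 * 2 = 4 * r * (q - 1) := by rw [hch]; congr 1
    nlinarith
  have hq2 : q = 2 := by rw [hq, hk'2]; rfl
  have hl'1 : l' = 1 := by omega
  have hac : a ^ 2 = c := by
    have h2 : v % 2 = 1 := by
      have := hvp; rw [Nat.coprime_two_right] at this; exact Nat.odd_iff.1 this
    rw [hq2] at hcv haqp
    rw [hcv, ← Nat.div_add_mod v 2, h2, pow_add, pow_mul, haqp]; simp
  have hbc : b ^ 2 = c := by
    have hb4 : (b ^ 2) ^ 2 = 1 := by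
      rw [← pow_mul]; have := pow_orderOf_eq_one b; rwa [hl, hl'1] at this
    rw [← hw, hw', hl'1, pow_one, pow_mul]
    rcases Nat.even_or_odd' w' with ⟨r, hr | hr⟩
    · exfalso; apply hc1
      rw [← hw, hw', hl'1, pow_one, pow_mul, hr, pow_mul, hb4, one_pow]
    · rw [hr, pow_add, pow_mul _ 2, hb4]; simp
  exact ⟨a, b, c, hac, hbc, hcp, hc1, hcomm⟩

end GroupTheory

section GroupTheory2

variable {G : Type} [Group G]

theorem quat_sq_of_pow_four {i j z : G} (hi : i ^ 2 = z) (hj : j ^ 2 = z) (hz2 : z ^ 2 = 1)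
    (hz1 : z ≠ 1) (hij : i * j = j * i * z)
    (hN : ∀ a b : G, b⁻¹ * a * b ∈ Subgroup.zpowers a)
    {x : G} (hxi : Commute x i) (hxj : Commute x j) (hx : x ^ 4 = 1) : x ^ 2 = 1 := by
  have hiz : Commute i z := by rw [← hi]; exact (Commute.refl i).pow_right 2
  have hxz : Commute x z := by rw [← hi]; exact hxi.pow_right 2
  have hinc : ∀ y : G, Commute y j → i ≠ y := by
    rintro y hy rfl
    rw [hy.eq] at hij
    exact hz1 (by simpa using hij.symm)
  have hjz : Commute z j := by
    rw [← hj]; exact (Commute.refl j).pow_left 2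
  have hmem : z ∈ Subgroup.zpowers (i * x) := by
    have h1 : z = (i * x)⁻¹ * (j⁻¹ * (i * x) * j) := by
      have : j⁻¹ * (i * x) * j = i * x * z := by
        calc j⁻¹ * (i * x) * j = j⁻¹ * i * (x * j) := by group
          _ = j⁻¹ * (i * j) * x := by rw [hxj.eq]; group
          _ = i * (z * x) := by rw [hij]; group
          _ = _ := by rw [← hxz.eq]; group
      rw [this]; group
    rw [h1]
    exact mul_mem (inv_mem (Subgroup.mem_zpowers _)) (hN (i * x) j)
  have h4 : (i * x) ^ 4 = 1 := by
    rw [hxi.symm.mul_pow, hx, show (4:ℕ) = 2 * 2 by norm_num, pow_mul, hi, hz2, one_mul]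
  obtain ⟨k, hk⟩ := Subgroup.mem_zpowers_iff.1 hmem
  have hk' : (i * x) ^ (k % 4) = z := by
    rw [← hk]
    conv_rhs => rw [← Int.emod_add_mul_ediv k 4]
    rw [zpow_add, zpow_mul]
    have : (i * x) ^ (4 : ℤ) = 1 := by exact_mod_cast h4
    rw [this]; simp
  have hlt := Int.emod_lt_of_pos k (show (0:ℤ) < 4 by norm_num)
  have hge := Int.emod_nonneg k (show (4:ℤ) ≠ 0 by norm_num)
  generalize k % 4 = r at *
  have hsq : (i * x) ^ 2 = z * x ^ 2 := by rw [hxi.symm.mul_pow, hi]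
  interval_cases r
  · simp at hk'; exact absurd hk'.symm hz1
  · exfalso
    rw [zpow_one] at hk'
    exact hinc (z * x⁻¹) (hjz.mul_left hxj.inv_left) (by rw [← hk']; group)
  · have h2 : (i * x) ^ 2 = z := by exact_mod_cast hk'
    rw [hsq] at h2
    simpa using h2
  · exfalso
    have h3 : (i * x) ^ 3 = z := by exact_mod_cast hk'
    have h5 : z * (i * x) = 1 := by rw [← h3, ← pow_succ, h4]
    refine hinc (z⁻¹ * x⁻¹) (hjz.inv_left.mul_left hxj.inv_left) ?_
    have : i * x = z⁻¹ := (inv_eq_of_mul_eq_one_right h5).symm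
    rw [← this]; group

theorem quat_centralizer_sq [Finite G] {i j z : G} (hi : i ^ 2 = z) (hj : j ^ 2 = z) (hz2 : z ^ 2 = 1)
    (hz1 : z ≠ 1) (hij : i * j = j * i * z)
    (hN : ∀ a b : G, b⁻¹ * a * b ∈ Subgroup.zpowers a)
    (hodd : ∀ g : G, Commute g i → Commute g j → Odd (orderOf g) → g = 1)
    {x : G} (hxi : Commute x i) (hxj : Commute x j) : x ^ 2 = 1 := by
  obtain ⟨k, m, hm, hkm⟩ := Nat.exists_eq_two_pow_mul_odd (orderOf_pos x).ne'
  have h1 : x ^ (2 ^ k) = 1 := by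
    apply hodd _ (hxi.pow_left _) (hxj.pow_left _)
    rw [orderOf_pow_of_dvd (by positivity) (by rw [hkm]; exact dvd_mul_right _ _), hkm,
      Nat.mul_div_cancel_left _ (by positivity)]
    exact hm
  clear hkm
  induction k with
  | zero => rw [pow_zero, pow_one] at h1; rw [h1, one_pow]
  | succ k ih =>
    rcases Nat.eq_zero_or_pos k with rfl | hk
    · simpa using h1
    · apply ih
      obtain ⟨k, rfl⟩ : ∃ k', k = k' + 1 := ⟨k - 1, by omega⟩
      rw [pow_succ, pow_mul]
      apply quat_sq_of_pow_four hi hj hz2 hz1 hij hN (hxi.pow_left _) (hxj.pow_left _)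
      rw [← pow_mul, ← h1]; congr 1; ring

theorem quat_pow_mod {i : G} (h4 : i ^ 4 = 1) (n : ℕ) : i ^ (n % 4) = i ^ n := by
  conv_rhs => rw [← Nat.mod_add_div n 4]
  rw [pow_add, pow_mul, h4]; simp

theorem quat_iso [Finite G] {i j z : G} (hi : i ^ 2 = z) (hj : j ^ 2 = z) (hz2 : z ^ 2 = 1)
    (hz1 : z ≠ 1) (hij : i * j = j * i * z)
    (hN : ∀ a b : G, b⁻¹ * a * b ∈ Subgroup.zpowers a)
    (hC : ∀ x : G, Commute x i → Commute x j → x ^ 2 = 1) :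
    ∃ (A : Type) (_ : CommGroup A), (∀ a : A, a ^ 2 = 1) ∧
          Nonempty (G ≃* QuaternionGroup 2 × A) := by
  classical
  have hiz : Commute z i := by rw [← hi]; exact (Commute.refl i).pow_left 2
  have hjz : Commute z j := by rw [← hj]; exact (Commute.refl j).pow_left 2
  have hi4 : i ^ 4 = 1 := by rw [show 4 = 2 * 2 by norm_num, pow_mul, hi, hz2]
  have hj4 : j ^ 4 = 1 := by rw [show 4 = 2 * 2 by norm_num, pow_mul, hj, hz2]
  have hiinv : i⁻¹ = i * z := by
    rw [inv_eq_iff_mul_eq_one, ← hi, ← mul_assoc, ← pow_two, ← pow_add, hi4]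
  have hjinv : j⁻¹ = j * z := by
    rw [inv_eq_iff_mul_eq_one, ← hj, ← mul_assoc, ← pow_two, ← pow_add, hj4]
  have hzz : z * z = 1 := by rw [← pow_two, hz2]
  have hji : j * i = i * j * z := by rw [hij, mul_assoc, hzz, mul_one]
  have hnij : ¬ Commute i j := fun h => by
    rw [h.eq] at hij; exact hz1 (by simpa using hij.symm)
  -- the hom from the quaternion group
  have hpj : ∀ n : ℕ, i ^ n * j = j * i ^ (3 * n) := by
    intro n
    induction n with
    | zero => simp
    | succ n ih =>
      rw [pow_succ', mul_assoc, ih, ← mul_assoc, hij]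
      rw [show 3 * (n+1) = 1 + 2 + 3 * n by ring, pow_add, pow_add, pow_one, hi]; group
  have hval : ∀ (k : ZMod 4) (n : ℕ), (n : ZMod 4) = k → i ^ k.val = i ^ n := by
    rintro k n rfl
    rw [ZMod.val_natCast, quat_pow_mod hi4]
  let f : QuaternionGroup 2 → G := fun q => match q with
    | .a k => i ^ (k : ZMod 4).val
    | .xa k => j * i ^ (k : ZMod 4).val
  have f_a : ∀ k : ZMod (2 * 2), f (.a k) = i ^ ZMod.val (n := 4) k := fun k => rfl
  have f_xa : ∀ k : ZMod (2 * 2), f (.xa k) = j * i ^ ZMod.val (n := 4) k := fun k => rfl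
  have h4z : (4 : ZMod 4) = 0 := by decide
  let φ : QuaternionGroup 2 →* G := MonoidHom.mk' f (by
    rintro (k | k) (l | l)
    · rw [QuaternionGroup.a_mul_a, f_a, f_a, f_a, ← pow_add]
      apply hval; simp
    · rw [QuaternionGroup.a_mul_xa, f_xa, f_a, f_xa, ← mul_assoc, hpj, mul_assoc, ← pow_add]
      congr 1
      apply hval
      push_cast
      rw [ZMod.natCast_zmod_val, ZMod.natCast_zmod_val]
      have : (3 : ZMod 4) = -1 := by decide
      rw [this]; ring
    · rw [QuaternionGroup.xa_mul_a, f_xa, f_a, f_xa, mul_assoc, ← pow_add]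
      congr 1
      apply hval; simp
    · rw [QuaternionGroup.xa_mul_xa, f_xa, f_a, f_xa]
      have : j * i ^ ZMod.val (n := 4) k * (j * i ^ ZMod.val (n := 4) l)
          = i ^ (2 + 3 * ZMod.val (n := 4) k + ZMod.val (n := 4) l) := by
        rw [pow_add, pow_add, hi, ← hj, pow_two, mul_assoc, ← mul_assoc _ j, hpj]; group
      rw [this]
      apply hval
      push_cast
      rw [ZMod.natCast_zmod_val, ZMod.natCast_zmod_val]
      have : (3 : ZMod 4) = -1 := by decide
      rw [this]; ring)
  have hφ : ∀ q, φ q = f q := fun q => rfl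
  -- the elementary abelian complement
  let P : Subgroup G → Prop := fun A => (∀ x ∈ A, Commute x i ∧ Commute x j) ∧ z ∉ A
  obtain ⟨A, hA⟩ : ∃ A, Maximal P A := by
    have hfin : ({A | P A} : Set (Subgroup G)).Finite := Set.toFinite _
    obtain ⟨A, hA⟩ := hfin.exists_maximal ⟨⊥, by
      refine ⟨?_, ?_⟩
      · intro x hx; rw [Subgroup.mem_bot.1 hx]; exact ⟨Commute.one_left _, Commute.one_left _⟩
      · simpa using hz1⟩
    exact ⟨A, hA⟩
  obtain ⟨hAC, hzA⟩ := hA.1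
  have hcc : ∀ x y : G, Commute x i → Commute x j → Commute y i → Commute y j → Commute x y := by
    intro x y h1 h2 h3 h4
    have e1 := hC x h1 h2
    have e2 := hC y h3 h4
    have e3 := hC (x * y) (h1.mul_left h3) (h2.mul_left h4)
    rw [pow_two] at e1 e2 e3
    have i1 : x⁻¹ = x := inv_eq_of_mul_eq_one_left e1
    have i2 : y⁻¹ = y := inv_eq_of_mul_eq_one_left e2
    have i3 : (x * y)⁻¹ = x * y := inv_eq_of_mul_eq_one_left e3
    rw [mul_inv_rev, i1, i2] at i3
    exact i3.symm
  have hcA : ∀ c : G, Commute c i → Commute c j → c ∈ A ∨ z * c ∈ A := by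
    intro c h1 h2
    by_contra hcon
    push Not at hcon
    have hc2 : c * c = 1 := by rw [← pow_two]; exact hC c h1 h2
    have hcinv : c⁻¹ = c := inv_eq_of_mul_eq_one_left hc2
    have comm : ∀ y ∈ A, y * c = c * y := fun y hy =>
      (hcc y c (hAC y hy).1 (hAC y hy).2 h1 h2).eq
    have comm' : ∀ y, y * c ∈ A → y * c = c * y := fun y hy => by
      have := comm _ hy
      rw [mul_assoc, hc2, mul_one, ← mul_assoc] at this
      calc y * c = (c * y * c) * c := by rw [← this]
        _ = _ := by rw [mul_assoc, hc2, mul_one]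
    let A' : Subgroup G :=
      { carrier := {x | x ∈ A ∨ x * c ∈ A}
        one_mem' := Or.inl A.one_mem
        mul_mem' := by
          rintro x y (hx | hx) (hy | hy)
          · exact Or.inl (mul_mem hx hy)
          · right; rw [mul_assoc]; exact mul_mem hx hy
          · right
            have : x * y * c = x * c * y := by rw [mul_assoc, comm y hy, mul_assoc]
            rw [this]; exact mul_mem hx hy
          · left
            have : x * y = (x * c) * (y * c) := by
              rw [comm' y hy, mul_assoc, ← mul_assoc c, hc2, one_mul]
            rw [this]; exact mul_mem hx hy
        inv_mem' := by
          rintro x (hx | hx)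
          · exact Or.inl (inv_mem hx)
          · right
            have : x⁻¹ * c = (x * c)⁻¹ := by rw [comm' x hx, mul_inv_rev, hcinv]
            show x⁻¹ * c ∈ A
            rw [this]; exact inv_mem hx }
    have hPA' : P A' := by
      refine ⟨?_, ?_⟩
      · rintro x (hx | hx)
        · exact hAC x hx
        · have e : x = (x * c) * c := by rw [mul_assoc, hc2, mul_one]
          rw [e]
          exact ⟨(hAC _ hx).1.mul_left h1, (hAC _ hx).2.mul_left h2⟩
      · rintro (hx | hx)
        · exact hzA hx
        · exact hcon.2 hx
    have hle : A' ≤ A := hA.2 hPA' (fun x hx => Or.inl hx)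
    exact hcon.1 (hle (Or.inr (by rw [hc2]; exact A.one_mem)))
  have hAcomm : ∀ x y : A, x * y = y * x := fun x y =>
    Subtype.ext (hcc x y (hAC x x.2).1 (hAC x x.2).2 (hAC y y.2).1 (hAC y y.2).2).eq
  let instA : CommGroup A := { (inferInstance : Group A) with mul_comm := hAcomm }
  have hcommφ : ∀ (q : QuaternionGroup 2) (a : A), Commute (φ q) (A.subtype a) := by
    rintro (k | k) a
    · rw [hφ, f_a]; exact ((hAC a a.2).1.pow_right _).symm
    · rw [hφ, f_xa]; exact ((hAC a a.2).2.mul_right ((hAC a a.2).1.pow_right _)).symm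
  let Φ : QuaternionGroup 2 × A →* G := MonoidHom.noncommCoprod φ A.subtype hcommφ
  have hΦ : ∀ q a, Φ (q, a) = f q * a := fun q a => rfl
  have hfz : f (.a 2) = z := by rw [f_a]; exact hi
  have hfi : f (.a 1) = i := by rw [f_a]; exact pow_one i
  have hf1 : f (.a 0) = 1 := by rw [f_a]; exact pow_zero i
  have hf3 : f (.a 3) = i * z := by rw [f_a, ← hiinv, inv_eq_of_mul_eq_one_right]; rw [← hi4]; exact (pow_succ' i 3).symm
  have hfj : f (.xa 0) = j := by rw [f_xa]; show j * i ^ 0 = j; rw [pow_zero, mul_one]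
  have hinj : Function.Injective Φ := by
    rw [injective_iff_map_eq_one]
    rintro ⟨q, a⟩ hq
    rw [hΦ] at hq
    have hfq : f q = (a : G)⁻¹ := eq_inv_of_mul_eq_one_left hq
    have hfA : f q ∈ A := by rw [hfq]; exact inv_mem a.2
    have hci := (hAC _ hfA).1
    have hcj := (hAC _ hfA).2
    have hq1 : q = 1 := by
      rcases q with k | k
      · have hk : k = 0 ∨ k = 1 ∨ k = 2 ∨ k = 3 := by
          have h0 : ∀ k : ZMod (2 * 2), k = 0 ∨ k = 1 ∨ k = 2 ∨ k = 3 := by decide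
          exact h0 k
        rcases hk with rfl | rfl | rfl | rfl
        · rfl
        · rw [hfi] at hcj; exact absurd hcj hnij
        · rw [hfz] at hfA; exact absurd hfA hzA
        · rw [hf3] at hcj
          exfalso; apply hnij
          have := hcj.mul_left hjz
          rwa [mul_assoc, hzz, mul_one] at this
      · exfalso
        rw [f_xa] at hci
        have := hci.mul_left ((Commute.refl i).pow_left (ZMod.val (n := 4) k)).inv_left
        rw [mul_inv_cancel_right] at this
        exact hnij this.symm
    rw [hq1] at hfq
    have : (a : G) = 1 := by
      have h0 : f 1 = 1 := hf1
      rw [h0] at hfq; simpa using hfq.symm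
    ext1
    · exact hq1
    · exact Subtype.ext this
  have hrange : ∀ c, Commute c i → Commute c j → c ∈ Φ.range := by
    intro c h1 h2
    rcases hcA c h1 h2 with h | h
    · exact ⟨(.a 0, ⟨c, h⟩), by rw [hΦ, hf1, one_mul]⟩
    · exact ⟨(.a 2, ⟨z * c, h⟩), by rw [hΦ, hfz]; show z * (z * c) = c; rw [← mul_assoc, hzz, one_mul]⟩
  have hri : i ∈ Φ.range := ⟨(.a 1, 1), by rw [hΦ, hfi]; simp⟩
  have hrj : j ∈ Φ.range := ⟨(.xa 0, 1), by rw [hΦ, hfj]; simp⟩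
  -- conjugation
  have hconj : ∀ t : G, t ^ 2 = z → ∀ g : G, g⁻¹ * t * g = t ∨ g⁻¹ * t * g = t * z := by
    intro t ht g
    have ht4 : t ^ 4 = 1 := by rw [show 4 = 2 * 2 by norm_num, pow_mul, ht, hz2]
    have hmem := hN t g
    rw [← mem_powers_iff_mem_zpowers, Submonoid.mem_powers_iff] at hmem
    obtain ⟨n, hn⟩ := hmem
    rw [← quat_pow_mod ht4] at hn
    have hlt := Nat.mod_lt n (show 4 > 0 by norm_num)
    have hgsq : (g⁻¹ * t * g) ^ 2 ≠ 1 := by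
      intro h
      have e : (g⁻¹ * t * g) ^ 2 = g⁻¹ * t ^ 2 * g := by rw [pow_two, pow_two]; group
      rw [e, ht] at h
      apply hz1
      calc z = g * (g⁻¹ * z * g) * g⁻¹ := by group
        _ = 1 := by rw [h]; group
    generalize n % 4 = r at *
    interval_cases r
    · exfalso; apply hgsq; rw [← hn]; simp
    · left; rw [← hn, pow_one]
    · exfalso; apply hgsq; rw [← hn, ht, hz2]
    · right; rw [← hn, pow_succ' t 2, ht]
  have hsurj : Function.Surjective Φ := by
    intro g
    change g ∈ Φ.range
    -- conjugates
    have toC : ∀ t y : G, y⁻¹ * t * y = t → Commute y t := by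
      intro t y h
      have : t * y = y * t := by
        calc t * y = y * (y⁻¹ * t * y) := by group
          _ = _ := by rw [h]
      exact this.symm
    have cij : i⁻¹ * j * i = j * z := by rw [mul_assoc, hji]; group
    have cji : j⁻¹ * i * j = i * z := by rw [mul_assoc, hij]; group
    have step : ∀ t y s : G, (y * s)⁻¹ * t * (y * s) = s⁻¹ * (y⁻¹ * t * y) * s := by
      intros; group
    have cz : ∀ t s : G, Commute z s → s⁻¹ * (t * z) * s = s⁻¹ * t * s * z := by
      intro t s h
      calc s⁻¹ * (t * z) * s = s⁻¹ * t * (z * s) := by group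
        _ = _ := by rw [h.eq]; group
    have czz : ∀ t : G, t * z * z = t := fun t => by rw [mul_assoc, hzz, mul_one]
    have cii : i⁻¹ * i * i = i := by group
    have cjj : j⁻¹ * j * j = j := by group
    rcases hconj i hi g with h1 | h1 <;> rcases hconj j hj g with h2 | h2
    · exact hrange g (toC _ _ h1) (toC _ _ h2)
    · have h3 : (g * i) ∈ Φ.range := hrange _
        (toC _ _ (by rw [step, h1, cii])) (toC _ _ (by rw [step, h2, cz _ _ hiz, cij, czz]))
      exact (Subgroup.mul_mem_cancel_right _ hri).1 h3
    · have h3 : (g * j) ∈ Φ.range := hrange _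
        (toC _ _ (by rw [step, h1, cz _ _ hjz, cji, czz])) (toC _ _ (by rw [step, h2, cjj]))
      exact (Subgroup.mul_mem_cancel_right _ hrj).1 h3
    · have h3 : (g * j * i) ∈ Φ.range := hrange _
        (toC _ _ (by rw [step, step, h1, cz _ _ hjz, cji, czz, cii]))
        (toC _ _ (by rw [step, step, h2, cz _ _ hjz, cjj, cz _ _ hiz, cij, czz]))
      exact (Subgroup.mul_mem_cancel_right _ hrj).1 ((Subgroup.mul_mem_cancel_right _ hri).1 h3)
  refine ⟨A, instA, ?_, ⟨(MulEquiv.ofBijective Φ ⟨hinj, hsurj⟩).symm⟩⟩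
  intro a
  apply Subtype.ext
  exact hC a (hAC a a.2).1 (hAC a a.2).2

end GroupTheory2

section RingPart

/-- every two units have commuting positive powers -/
def PowComm (A : Type*) [Ring A] : Prop :=
  ∀ u v : Aˣ, ∃ m : ℕ, 0 < m ∧ Commute ((u : A) ^ m) ((v : A) ^ m)

/-- no additive torsion -/
def TorFree (A : Type*) [Ring A] : Prop :=
  ∀ n : ℕ, n ≠ 0 → ∀ x : A, (n : A) * x = 0 → x = 0

theorem powComm_of_virtually {A : Type*} [Ring A] (H : Subgroup Aˣ) (hH : H.FiniteIndex)
    (hc : ∀ x y : H, x * y = y * x) : PowComm A := by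
  intro u v
  obtain ⟨m, hm, -, hum⟩ := H.exists_pow_mem_of_index_ne_zero hH.index_ne_zero u
  obtain ⟨n, hn, -, hvn⟩ := H.exists_pow_mem_of_index_ne_zero hH.index_ne_zero v
  refine ⟨m * n, Nat.mul_pos hm hn, ?_⟩
  have h1 : u ^ (m * n) ∈ H := by rw [pow_mul]; exact pow_mem hum n
  have h2 : v ^ (m * n) ∈ H := by rw [mul_comm, pow_mul]; exact pow_mem hvn m
  have h3 := hc ⟨_, h1⟩ ⟨_, h2⟩
  have h4 : u ^ (m * n) * v ^ (m * n) = v ^ (m * n) * u ^ (m * n) := congrArg Subtype.val h3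
  have h5 := congrArg Units.val h4
  rw [Units.val_mul, Units.val_mul, Units.val_pow_eq_pow_val, Units.val_pow_eq_pow_val] at h5
  exact h5

theorem powComm_of_injective {A B : Type*} [Ring A] [Ring B] (f : B →+* A)
    (hf : Function.Injective f) (h : PowComm A) : PowComm B := by
  intro u v
  obtain ⟨m, hm, hc⟩ := h (Units.map f.toMonoidHom u) (Units.map f.toMonoidHom v)
  refine ⟨m, hm, ?_⟩
  apply hf
  have := hc.eq
  simpa using this

theorem nilsq_commute {A : Type*} [Ring A] (hP : PowComm A) (hT : TorFree A) {e f : A}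
    (he : e * e = 0) (hf : f * f = 0) : e * f = f * e := by
  have key : ∀ x : A, x * x = 0 → ∀ m : ℕ, (1 + x) ^ m = 1 + (m : A) * x := by
    intro x hx m
    induction m with
    | zero => simp
    | succ m ih =>
      rw [pow_succ, ih]
      push_cast
      have : (m : A) * x * x = 0 := by rw [mul_assoc, hx, mul_zero]
      rw [mul_add, add_mul, add_mul, add_mul, mul_one, mul_one, one_mul, this]
      abel
  have inv : ∀ x : A, x * x = 0 → ∃ u : Aˣ, (u : A) = 1 + x := by
    intro x hx
    refine ⟨⟨1 + x, 1 - x, ?_, ?_⟩, rfl⟩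
    · rw [add_mul, mul_sub, mul_sub, hx]; simp
    · rw [sub_mul, mul_add, mul_add, hx]; simp
  obtain ⟨u, hu⟩ := inv e he
  obtain ⟨v, hv⟩ := inv f hf
  obtain ⟨m, hm, hc⟩ := hP u v
  rw [hu, hv, key e he, key f hf] at hc
  have h1 := hc.eq
  have h2 : ((m * m : ℕ) : A) * (e * f - f * e) = 0 := by
    have hmf : (m : A) * e * ((m : A) * f) = ((m * m : ℕ) : A) * (e * f) := by
      push_cast
      rw [mul_assoc, ← mul_assoc e, (Nat.cast_commute m e).symm.eq, mul_assoc, mul_assoc]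
    have hmf2 : (m : A) * f * ((m : A) * e) = ((m * m : ℕ) : A) * (f * e) := by
      push_cast
      rw [mul_assoc, ← mul_assoc f, (Nat.cast_commute m f).symm.eq, mul_assoc, mul_assoc]
    rw [mul_sub, ← hmf, ← hmf2]
    have e1 : (1 + (m:A) * e) * (1 + (m:A) * f) = 1 + (m:A)*e + (m:A)*f + (m:A)*e*((m:A)*f) := by
      noncomm_ring
    have e2 : (1 + (m:A) * f) * (1 + (m:A) * e) = 1 + (m:A)*e + (m:A)*f + (m:A)*f*((m:A)*e) := by
      noncomm_ring
    rw [e1, e2] at h1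
    rw [sub_eq_zero]
    exact add_left_cancel h1
  have := hT (m * m) (Nat.mul_pos hm hm).ne' _ h2
  exact sub_eq_zero.1 this

open MonoidAlgebra

variable {k : Type*} [CommRing k] {G : Type*} [Group G]

/-- the canonical involution of a group ring -/
noncomputable def gstar (x : MonoidAlgebra k G) : MonoidAlgebra k G :=
  MonoidAlgebra.ofCoeff (Finsupp.equivMapDomain (Equiv.inv G) x.coeff)

theorem coeff_gstar (x : MonoidAlgebra k G) (g : G) : (gstar x).coeff g = x.coeff g⁻¹ := by
  simp [gstar, Finsupp.equivMapDomain_apply]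

theorem gstar_single (g : G) (r : k) : gstar (single g r) = single g⁻¹ r := by
  apply MonoidAlgebra.coeff_injective
  simp [gstar, Finsupp.equivMapDomain_single]

theorem gstar_add (x y : MonoidAlgebra k G) : gstar (x + y) = gstar x + gstar y := by
  ext g; simp [coeff_gstar]

theorem gstar_zero : gstar (0 : MonoidAlgebra k G) = 0 := by
  ext g; simp [coeff_gstar]

theorem gstar_gstar (x : MonoidAlgebra k G) : gstar (gstar x) = x := by
  ext g; simp [coeff_gstar]

theorem gstar_one : gstar (1 : MonoidAlgebra k G) = 1 := by
  rw [MonoidAlgebra.one_def, gstar_single, inv_one]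

theorem gstar_mul (x y : MonoidAlgebra k G) : gstar (x * y) = gstar y * gstar x := by
  induction x using MonoidAlgebra.induction_linear with
  | zero => simp [gstar_zero]
  | add a b ha hb => rw [add_mul, gstar_add, ha, hb, gstar_add, mul_add]
  | single g r =>
    induction y using MonoidAlgebra.induction_linear with
    | zero => simp [gstar_zero]
    | add a b ha hb => rw [mul_add, gstar_add, ha, hb, gstar_add, add_mul]
    | single h s =>
      rw [single_mul_single, gstar_single, gstar_single, gstar_single, single_mul_single,
        mul_inv_rev, mul_comm]

theorem coeff_one_mul_gstar [Fintype G] (x : MonoidAlgebra k G) :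
    (x * gstar x).coeff 1 = ∑ g, x.coeff g ^ 2 := by
  rw [MonoidAlgebra.coeff_mul_apply_left]
  rw [Finsupp.sum_fintype _ _ (by simp)]
  simp [coeff_gstar, pow_two]

theorem torFree_monoidAlgebra [IsDomain k] [CharZero k] : TorFree (MonoidAlgebra k G) := by
  intro n hn x hx
  ext g
  have := congrArg (fun y => y.coeff g) hx
  simp only [MonoidAlgebra.natCast_def] at this
  rw [MonoidAlgebra.coeff_single_one_mul] at this
  simpa [hn] using this

/-- the unit group condition makes all cyclic subgroups normal -/
theorem normal_of_powComm [Finite G] (hP : PowComm (MonoidAlgebra ℤ G)) (a b : G) :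
    b⁻¹ * a * b ∈ Subgroup.zpowers a := by
  classical
  have := Fintype.ofFinite G
  let ah : MonoidAlgebra ℤ G := ∑ x : Subgroup.zpowers a, single (x : G) 1
  have hah : ∀ g, ah.coeff g = if g ∈ Subgroup.zpowers a then 1 else 0 := by
    intro g
    simp only [ah, MonoidAlgebra.coeff_sum, Finsupp.finsetSum_apply, MonoidAlgebra.coeff_single,
      Finsupp.single_apply]
    split_ifs with h
    · rw [Finset.sum_eq_single ⟨g, h⟩]
      · simp
      · intro b _ hb; rw [if_neg]; rintro rfl; exact hb rfl
      · simp
    · apply Finset.sum_eq_zero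
      intro x _
      rw [if_neg]; rintro rfl; exact h x.2
  have haa : ah * single a 1 = ah := by
    ext g
    rw [MonoidAlgebra.coeff_mul_single_apply, hah, hah, mul_one]
    congr 1
    rw [Subgroup.mul_mem_cancel_right _ (inv_mem (Subgroup.mem_zpowers a))]
  let e : MonoidAlgebra ℤ G := (1 - single a 1) * single b 1 * ah
  have he : e * e = 0 := by
    have : ah * (1 - single a 1) = 0 := by rw [mul_sub, haa, mul_one, sub_self]
    calc e * e = (1 - single a 1) * single b 1 * (ah * (1 - single a 1)) * single b 1 * ah := by
          simp only [e]; noncomm_ring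
      _ = 0 := by rw [this]; simp
  have hpos : ∀ x : MonoidAlgebra ℤ G, x * gstar x = 0 → x = 0 := by
    intro x hx
    have h1 := coeff_one_mul_gstar x
    rw [hx] at h1
    have h2 : ∑ g, x.coeff g ^ 2 = 0 := by rw [← h1]; simp
    rw [Finset.sum_eq_zero_iff_of_nonneg (fun _ _ => sq_nonneg _)] at h2
    ext g
    simpa using h2 g (Finset.mem_univ g)
  have hse : gstar e * gstar e = 0 := by rw [← gstar_mul, he, gstar_zero]
  have hc := nilsq_commute hP torFree_monoidAlgebra he hse
  have h0 : e * gstar e = 0 := by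
    apply hpos
    rw [gstar_mul e (gstar e), gstar_gstar]
    calc e * gstar e * (e * gstar e) = e * (gstar e * e) * gstar e := by noncomm_ring
      _ = e * (e * gstar e) * gstar e := by rw [hc]
      _ = (e * e) * (gstar e * gstar e) := by noncomm_ring
      _ = 0 := by rw [he, zero_mul]
  have he0 := hpos e h0
  have h3 : single b 1 * ah = single (a * b) 1 * ah := by
    have : e = single b 1 * ah - single (a * b) 1 * ah := by
      simp only [e]
      rw [sub_mul, sub_mul, one_mul, single_mul_single, one_mul]
    rw [this] at he0
    exact sub_eq_zero.1 he0
  have h4 := congrArg (fun y => y.coeff (a * b)) h3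
  simp only [MonoidAlgebra.coeff_single_mul_apply, hah] at h4
  rw [← mul_assoc] at h4
  by_contra hcon
  rw [if_neg hcon] at h4
  simp [one_mem] at h4


theorem pigeonhole_mod {A : Type*} [Ring A] [Module.Finite ℤ A] (N : ℕ) (hN : N ≠ 0)
    (f : ℕ → A) : ∃ m n : ℕ, m < n ∧ ∃ y, f n - f m = (N : A) * y := by
  let S : AddSubgroup A := (AddMonoidHom.mulLeft (N : A)).range
  have hfin : Finite (A ⧸ S) := by
    have : Module.Finite ℤ (A ⧸ S) :=
      Module.Finite.of_surjective (QuotientAddGroup.mk' S).toIntLinearMap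
        (QuotientAddGroup.mk'_surjective S)
    apply AddCommGroup.finite_of_fg_isAddTorsion (hG' := Module.Finite.iff_addGroup_fg.1 this)
    intro x
    rw [isOfFinAddOrder_iff_nsmul_eq_zero]
    refine ⟨N, Nat.pos_of_ne_zero hN, ?_⟩
    obtain ⟨y, rfl⟩ := QuotientAddGroup.mk'_surjective S x
    rw [← map_nsmul]
    rw [QuotientAddGroup.mk'_apply, QuotientAddGroup.eq_zero_iff]
    exact ⟨y, by simp [nsmul_eq_mul]⟩
  obtain ⟨m, n, hne, h⟩ := Finite.exists_ne_map_eq_of_infinite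
    (fun k : ℕ => (QuotientAddGroup.mk' S (f k)))
  wlog hlt : m < n generalizing m n
  · exact this n m hne.symm h.symm (by omega)
  refine ⟨m, n, hlt, ?_⟩
  have h1 : f n - f m ∈ S := by
    rw [← QuotientAddGroup.eq_zero_iff]
    have : QuotientAddGroup.mk' S (f n - f m) = 0 := by rw [map_sub, sub_eq_zero]; exact h.symm
    exact this
  obtain ⟨y, hy⟩ := h1
  exact ⟨y, hy.symm⟩

theorem lift_unit {A : Type*} [Ring A] [Module.Finite ℤ A] (hT : TorFree A) (N : ℕ) (hN : N ≠ 0)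
    (E α β : A) (hαβ : Commute α β) (hEα : Commute E α) (hEβ : Commute E β)
    (hE2 : E * E = (N : A) * E) (hαβE : α * β * E = E) :
    ∃ m : ℕ, 0 < m ∧ ∃ U : Aˣ, (U : A) * E = α ^ m * E := by
  have hpow : ∀ r : ℕ, α ^ r * β ^ r * E = E := by
    intro r
    rw [← hαβ.mul_pow]
    induction r with
    | zero => simp
    | succ r ih => rw [pow_succ, mul_assoc, hαβE, ih]
  obtain ⟨m, n, hmn, y, hy⟩ := pigeonhole_mod N hN (fun k => α ^ k * E)
  obtain ⟨r, hr, rfl⟩ : ∃ r, 0 < r ∧ n = m + r := ⟨n - m, by omega, by omega⟩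
  have hNc : ∀ x : A, x * (N : A) = (N : A) * x := fun x => (Nat.cast_commute N x).symm.eq
  -- y1
  have hy1 : (N : A) * (β ^ m * y) = (α ^ r - 1) * E := by
    rw [← mul_assoc, ← hNc, mul_assoc, ← hy, mul_sub, sub_mul, one_mul]
    congr 1
    · rw [pow_add, ← mul_assoc, ← mul_assoc, ← (hαβ.pow_pow m m).eq]
      have : Commute (α ^ r) (α ^ m * β ^ m) :=
        ((Commute.refl α).pow_pow r m).mul_right (hαβ.pow_pow r m)
      rw [← this.eq, mul_assoc, hpow]
    · rw [← mul_assoc, ← (hαβ.pow_pow m m).eq, hpow]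
  generalize β ^ m * y = y1 at hy1
  obtain ⟨y2, hy2e⟩ : ∃ y2, y2 = -(β ^ r * y1) := ⟨_, rfl⟩
  have hy2 : (N : A) * y2 = (β ^ r - 1) * E := by
    rw [hy2e, mul_neg, ← mul_assoc, ← hNc, mul_assoc, hy1, ← mul_assoc, mul_sub, sub_mul,
      ← (hαβ.pow_pow r r).eq, hpow, sub_mul, mul_one, one_mul]
    abel
  obtain ⟨a, ha⟩ : ∃ a, a = α ^ r := ⟨_, rfl⟩
  obtain ⟨b, hb⟩ : ∃ b, b = β ^ r := ⟨_, rfl⟩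
  have hab : a * b * E = E := by rw [ha, hb, hpow]
  have hba : b * a * E = E := by rw [ha, hb, ← (hαβ.pow_pow r r).eq, hpow]
  have hEa : E * a = a * E := by rw [ha]; exact (hEα.pow_right r).eq
  have hEb : E * b = b * E := by rw [hb]; exact (hEβ.pow_right r).eq
  rw [← ha] at hy1
  rw [← hb] at hy2
  have main : ∀ (a b y1 y2 : A), a * b * E = E → E * b = b * E →
      (N : A) * y1 = (a - 1) * E → (N : A) * y2 = (b - 1) * E → (1 + y1) * (1 + y2) = 1 := by
    intro a b y1 y2 hab hEb h1 h2
    have hNN : ((N * N : ℕ) : A) * ((1 + y1) * (1 + y2) - 1) = 0 := by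
      have e1 : ((N * N : ℕ) : A) * ((1 + y1) * (1 + y2) - 1)
          = (N : A) * ((N : A) * y1) + (N : A) * ((N:A) * y2) + ((N:A) * y1) * ((N : A) * y2) := by
        push_cast
        have : ((N:A) * y1) * ((N : A) * y2) = (N : A) * (N : A) * (y1 * y2) := by
          rw [mul_assoc, ← mul_assoc y1, hNc y1]; noncomm_ring
        rw [this]; noncomm_ring
      rw [e1, h1, h2]
      have e2 : (a - 1) * E * ((b - 1) * E) = (N : A) * (E - a * E - b * E + E) := by
        calc (a - 1) * E * ((b - 1) * E) = (a - 1) * (E * b - E) * E := by noncomm_ring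
          _ = (a - 1) * (b - 1) * (E * E) := by rw [hEb]; noncomm_ring
          _ = (a - 1) * (b - 1) * (N : A) * E := by rw [hE2]; noncomm_ring
          _ = (N : A) * ((a - 1) * (b - 1) * E) := by rw [hNc]; noncomm_ring
          _ = (N : A) * (a * b * E - a * E - b * E + E) := by noncomm_ring
          _ = _ := by rw [hab]
      rw [e2]; noncomm_ring
    exact sub_eq_zero.1 (hT _ (Nat.mul_pos (Nat.pos_of_ne_zero hN) (Nat.pos_of_ne_zero hN)).ne' _ hNN)
  refine ⟨r, hr, ⟨1 + y1, 1 + y2, main a b y1 y2 hab hEb hy1 hy2,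
    main b a y2 y1 hba hEa hy2 hy1⟩, ?_⟩
  show (1 + y1) * E = α ^ r * E
  rw [← ha]
  have : (N : A) * ((1 + y1) * E - a * E) = 0 := by
    calc (N : A) * ((1 + y1) * E - a * E) = (N:A) * E + ((N : A) * y1) * E - (N : A) * (a * E) := by
          noncomm_ring
      _ = (N:A) * E + (a - 1) * (E * E) - (N : A) * (a * E) := by rw [hy1]; noncomm_ring
      _ = (N:A) * E + (a - 1) * (N : A) * E - (N : A) * (a * E) := by rw [hE2]; noncomm_ring
      _ = 0 := by rw [hNc]; noncomm_ring
  exact sub_eq_zero.1 (hT N hN _ this)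

/-- evaluate a formal `p + q ι` at a group element -/
def qeval {A B : Type*} [Ring A] [CommRing B] (ψ : B →+* A) (t : A)
    (w : QuadraticAlgebra B (-1) 0) : A := ψ w.re + ψ w.im * t

theorem qeval_mul {A B : Type*} [Ring A] [CommRing B] (ψ : B →+* A) (t z E : A)
    (ht : t * t = z) (hzE : z * E = -E) (hψ : ∀ b, Commute (ψ b) t)
    (w w' : QuadraticAlgebra B (-1) 0) :
    qeval ψ t w * qeval ψ t w' * E = qeval ψ t (w * w') * E := by
  simp only [qeval, QuadraticAlgebra.re_mul, QuadraticAlgebra.im_mul, map_add, map_mul, map_neg,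
    map_one, map_zero]
  have h1 : ψ w.im * t * (ψ w'.im * t) * E = - (ψ w.im * ψ w'.im * E) := by
    calc ψ w.im * t * (ψ w'.im * t) * E = ψ w.im * (t * ψ w'.im) * t * E := by noncomm_ring
      _ = ψ w.im * ψ w'.im * ((t * t) * E) := by rw [← (hψ _).eq]; noncomm_ring
      _ = _ := by rw [ht, hzE]; noncomm_ring
  have h2 : ψ w.im * t * ψ w'.re = ψ w.im * ψ w'.re * t := by
    rw [mul_assoc, ← (hψ _).eq, mul_assoc]
  rw [add_mul, mul_add, mul_add, add_mul, add_mul, add_mul, h1, h2]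
  noncomm_ring

theorem qeval_pow {A B : Type*} [Ring A] [CommRing B] (ψ : B →+* A) (t z E : A)
    (ht : t * t = z) (hzE : z * E = -E) (hψ : ∀ b, Commute (ψ b) t)
    (w : QuadraticAlgebra B (-1) 0) (n : ℕ) :
    qeval ψ t w ^ n * E = qeval ψ t (w ^ n) * E := by
  induction n with
  | zero =>
    have h1 : (1 : QuadraticAlgebra B (-1) 0).re = 1 := rfl
    have h2 : (1 : QuadraticAlgebra B (-1) 0).im = 0 := rfl
    rw [pow_zero, pow_zero, qeval, h1, h2, map_one, map_zero, zero_mul, add_zero]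
  | succ n ih =>
    rw [pow_succ', mul_assoc, ih, ← mul_assoc, qeval_mul ψ t z E ht hzE hψ, ← pow_succ']

theorem qeval_commute {A B : Type*} [Ring A] [CommRing B] (ψ : B →+* A) (t : A)
    (hψ : ∀ b, Commute (ψ b) t)
    (w w' : QuadraticAlgebra B (-1) 0) : Commute (qeval ψ t w) (qeval ψ t w') := by
  have hc : ∀ b c, Commute (ψ b) (ψ c) := fun b c => by
    show ψ b * ψ c = ψ c * ψ b
    rw [← map_mul, mul_comm, map_mul]
  unfold qeval
  exact ((hc _ _).add_right ((hc _ _).mul_right (hψ _))).add_left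
    (((hc _ _).mul_left (hψ _).symm).add_right
      (((hc _ _).mul_right (hψ _)).mul_left ((hψ _).symm.mul_right (Commute.refl t))))

theorem quat_units {A B : Type*} [Ring A] [Module.Finite ℤ A] (hP : PowComm A) (hT : TorFree A)
    [CommRing B] (ψ : B →+* A) (i j z E : A) (N : ℕ) (hN : N ≠ 0)
    (hi : i * i = z) (hj : j * j = z) (hz : z * z = 1) (hij : i * j = j * i * z)
    (hzE : z * E = -E) (hEi : Commute E i) (hEj : Commute E j) (hEψ : ∀ b, Commute E (ψ b))
    (hE2 : E * E = (N : A) * E)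
    (hψi : ∀ b, Commute (ψ b) i) (hψj : ∀ b, Commute (ψ b) j)
    (w w' : QuadraticAlgebra B (-1) 0)
    (hw1 : ψ (w * w').re * E = E) (hw2 : ψ (w * w').im * E = 0) :
    ∃ s : ℕ, 0 < s ∧ ψ ((w ^ s).im) ^ 2 * E = 0 := by
  have hlift : ∀ t : A, t * t = z → Commute E t → (∀ b, Commute (ψ b) t) →
      ∃ m : ℕ, 0 < m ∧ ∃ U : Aˣ, ∀ n : ℕ, (U : A) ^ n * E = qeval ψ t (w ^ (m * n)) * E := by
    intro t ht hEt hψt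
    have hcE : ∀ x, Commute E (qeval ψ t x) := fun x =>
      (hEψ _).add_right ((hEψ _).mul_right hEt)
    obtain ⟨m, hm, U, hU⟩ := lift_unit hT N hN E (qeval ψ t w) (qeval ψ t w')
      (qeval_commute ψ t hψt w w') (hcE _) (hcE _) hE2 (by
        rw [qeval_mul ψ t z E ht hzE hψt]
        unfold qeval
        rw [add_mul, hw1, mul_assoc, ← hEt.eq, ← mul_assoc, hw2, zero_mul, add_zero])
    refine ⟨m, hm, U, ?_⟩
    intro n
    rw [← qeval_pow ψ t z E ht hzE hψt, pow_mul]
    induction n with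
    | zero => simp
    | succ n ih =>
      rw [pow_succ, mul_assoc, hU, ← ((hcE w).pow_right m).eq, ← mul_assoc, ih, mul_assoc,
        ((hcE w).pow_right m).eq, ← mul_assoc, ← pow_succ]
  obtain ⟨m, hm, U, hU⟩ := hlift i hi hEi hψi
  obtain ⟨m', hm', V, hV⟩ := hlift j hj hEj hψj
  obtain ⟨r, hr, hc⟩ := hP (U ^ m') (V ^ m)
  refine ⟨m * (m' * r), by positivity, ?_⟩
  have hU' := hU (m' * r)
  have hV' := hV (m * r)
  rw [show m' * (m * r) = m * (m' * r) by ring] at hV'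
  rw [pow_mul] at hU' hV'
  rw [Units.val_pow_eq_pow_val, Units.val_pow_eq_pow_val] at hc
  generalize ((U : A) ^ m') ^ r = u at *
  generalize ((V : A) ^ m) ^ r = v at *
  generalize w ^ (m * (m' * r)) = W at *
  have hcEi : Commute E (qeval ψ i W) := (hEψ _).add_right ((hEψ _).mul_right hEi)
  have hcEj : Commute E (qeval ψ j W) := (hEψ _).add_right ((hEψ _).mul_right hEj)
  have h1 : qeval ψ i W * qeval ψ j W * E = u * v * E := by
    rw [mul_assoc, ← hcEj.eq, ← mul_assoc, ← hU', mul_assoc, hcEj.eq, ← hV', mul_assoc]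
  have h2 : qeval ψ j W * qeval ψ i W * E = v * u * E := by
    rw [mul_assoc, ← hcEi.eq, ← mul_assoc, ← hV', mul_assoc, hcEi.eq, ← hU', mul_assoc]
  have h3 : qeval ψ i W * qeval ψ j W * E = qeval ψ j W * qeval ψ i W * E := by
    rw [h1, h2, hc.eq]
  have hpq : ψ W.re * ψ W.im = ψ W.im * ψ W.re := by rw [← map_mul, mul_comm, map_mul]
  have h4 : ψ W.im * ψ W.im * (i * j) * E = ψ W.im * ψ W.im * (j * i) * E := by
    have e : ∀ s t : A, (∀ b, Commute (ψ b) s) → qeval ψ s W * qeval ψ t W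
        = ψ W.re * ψ W.re + ψ W.re * ψ W.im * t + ψ W.re * ψ W.im * s
          + ψ W.im * ψ W.im * (s * t) := by
      intro s t hs
      unfold qeval
      have a1 : ψ W.im * s * ψ W.re = ψ W.re * ψ W.im * s := by
        rw [mul_assoc, ← (hs _).eq, ← mul_assoc, hpq]
      have a2 : ψ W.im * s * (ψ W.im * t) = ψ W.im * ψ W.im * (s * t) := by
        calc ψ W.im * s * (ψ W.im * t) = ψ W.im * (s * ψ W.im) * t := by noncomm_ring
          _ = _ := by rw [← (hs _).eq]; noncomm_ring
      rw [add_mul, mul_add, mul_add, a1, a2]; noncomm_ring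
    rw [e i j hψi, e j i hψj] at h3
    have h5 : ψ W.re * ψ W.re + ψ W.re * ψ W.im * j + ψ W.re * ψ W.im * i
        = ψ W.re * ψ W.re + ψ W.re * ψ W.im * i + ψ W.re * ψ W.im * j := by abel
    rw [h5] at h3
    generalize ψ W.re * ψ W.re + ψ W.re * ψ W.im * i + ψ W.re * ψ W.im * j = X at h3
    rw [add_mul X _ E, add_mul X _ E] at h3
    exact add_left_cancel h3
  have h6 : ψ W.im * ψ W.im * (j * i) * E = - (ψ W.im * ψ W.im * (i * j) * E) := by
    have hzc : j * i = i * j * z := by rw [hij, mul_assoc, hz, mul_one]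
    rw [hzc, ← mul_assoc _ (i * j) z, mul_assoc _ z E, hzE, mul_neg]
  rw [h6] at h4
  have h7 : ((2 : ℕ) : A) * (ψ W.im * ψ W.im * (i * j) * E) = 0 := by
    have : ((2 : ℕ) : A) = 1 + 1 := by norm_num
    rw [this, add_mul, one_mul]
    nth_rewrite 1 [h4]
    abel
  have h8 := hT 2 (by norm_num) _ h7
  have hEij : Commute E (i * j) := hEi.mul_right hEj
  have h9 : ψ W.im * ψ W.im * E * (i * j) = 0 := by rw [mul_assoc, hEij.eq, ← mul_assoc, h8]
  have hunit : (i * j) * (j * (i * (z * z))) = 1 := by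
    have hiz : i * z = z * i := by rw [← hi]; noncomm_ring
    calc (i * j) * (j * (i * (z * z))) = i * (j * j) * i * (z * z) := by noncomm_ring
      _ = (i * z) * i := by rw [hj, hz]; noncomm_ring
      _ = z * (i * i) := by rw [hiz]; noncomm_ring
      _ = 1 := by rw [hi, hz]
  calc ψ W.im ^ 2 * E = ψ W.im * ψ W.im * E * ((i * j) * (j * (i * (z * z)))) := by
        rw [hunit, mul_one, pow_two]
    _ = 0 := by rw [← mul_assoc, h9, zero_mul]

end RingPart

section OddPart
open MonoidAlgebra Polynomial

theorem aeval_commute {A : Type*} [Ring A] (x t : A) (h : Commute x t) (p : ℤ[X]) :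
    Commute (aeval x p) t := by
  induction p using Polynomial.induction_on' with
  | add p q hp hq => rw [map_add]; exact hp.add_left hq
  | monomial n a =>
    rw [aeval_monomial]
    exact Commute.mul_left (Algebra.commutes a t) (h.pow_left n)

theorem sum_range_double {M : Type*} [AddCommMonoid M] (f : ℕ → M) (m : ℕ) :
    ∑ k ∈ Finset.range (2 * m), f k
      = ∑ k ∈ Finset.range m, f (2 * k) + ∑ k ∈ Finset.range m, f (2 * k + 1) := by
  induction m with
  | zero => simp
  | succ m ih =>
    rw [show 2 * (m + 1) = 2 * m + 1 + 1 by ring, Finset.sum_range_succ, Finset.sum_range_succ, ih,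
      Finset.sum_range_succ, Finset.sum_range_succ]
    abel

theorem pow_mod_natCard_aux {n : ℕ} (ζ : ℂ) (hζ : ζ ^ n = 1) (k : ℕ) : ζ ^ (k % n) = ζ ^ k := by
  conv_rhs => rw [← Nat.mod_add_div k n, pow_add, pow_mul, hζ, one_pow, mul_one]

theorem exists_functional {G : Type} [Group G] [Finite G] (g z : G) (n : ℕ) (hn : orderOf g = n)
    (hzg : z ∉ Subgroup.zpowers g) (ζ : ℂ) (hζ : ζ ^ n = 1) :
    ∃ l : MonoidAlgebra ℤ G →+ ℂ, ∀ b : ℤ[X],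
      l (aeval (single g (1 : ℤ)) b * (1 - single z 1)) = aeval ζ b := by
  classical
  have := Fintype.ofFinite G
  let f : G → ℂ := fun x => if h : ∃ k : ℕ, x = g ^ k then ζ ^ (h.choose) else 0
  have hf1 : ∀ k : ℕ, f (g ^ k) = ζ ^ k := by
    intro k
    have h : ∃ l : ℕ, g ^ k = g ^ l := ⟨k, rfl⟩
    have h2 := h.choose_spec
    simp only [f, dif_pos h]
    generalize h.choose = l at *
    rw [pow_eq_pow_iff_modEq, hn] at h2
    rw [← pow_mod_natCard_aux ζ hζ k, ← pow_mod_natCard_aux ζ hζ l, h2]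
  have hf2 : ∀ k : ℕ, f (g ^ k * z) = 0 := by
    intro k
    have h : ¬ ∃ l : ℕ, g ^ k * z = g ^ l := by
      rintro ⟨l, hl⟩
      apply hzg
      have : z = (g ^ k)⁻¹ * g ^ l := by rw [← hl]; group
      rw [this]
      exact mul_mem (inv_mem (Subgroup.npow_mem_zpowers g k)) (Subgroup.npow_mem_zpowers g l)
    simp only [f, dif_neg h]
  let l : MonoidAlgebra ℤ G →+ ℂ :=
    { toFun := fun x => ∑ y, (x.coeff y : ℂ) * f y
      map_zero' := by simp
      map_add' := by
        intro x y
        simp [add_mul, Finset.sum_add_distrib] }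
  have hl : ∀ y : G, ∀ a : ℤ, l (single y a) = a * f y := by
    intro y a
    show ∑ x, ((single y a : MonoidAlgebra ℤ G).coeff x : ℂ) * f x = _
    rw [Finset.sum_eq_single y]
    · simp
    · intro b _ hb
      simp [hb.symm]
    · simp
  refine ⟨l, ?_⟩
  intro b
  induction b using Polynomial.induction_on' with
  | add p q hp hq => rw [map_add, add_mul, map_add, hp, hq, map_add]
  | monomial k a =>
    rw [aeval_monomial, aeval_monomial, mul_sub, mul_one, map_sub]
    have : (algebraMap ℤ (MonoidAlgebra ℤ G)) a = single 1 a := by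
      rw [eq_intCast, MonoidAlgebra.intCast_def]; simp
    rw [this, single_pow, single_mul_single, single_mul_single, hl, hl]
    simp [hf1, hf2]


theorem pow_left_injective_aux {x y : ℂ} {s : ℕ} (h : ‖x‖ ^ s = ‖y‖ ^ s) (hs : s ≠ 0) :
    ‖x‖ = ‖y‖ := (pow_left_inj₀ (norm_nonneg _) (norm_nonneg _) hs).1 h

theorem odd_commute_trivial {G : Type} [Group G] [Finite G] (hP : PowComm (MonoidAlgebra ℤ G))
    {i j z : G} (hi : i ^ 2 = z) (hj : j ^ 2 = z) (hz2 : z ^ 2 = 1) (hz1 : z ≠ 1)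
    (hij : i * j = j * i * z) (g : G) (hgi : Commute g i) (hgj : Commute g j)
    (hodd : Odd (orderOf g)) : g = 1 := by
  classical
  have hgz : Commute g z := by rw [← hi]; exact hgi.pow_right 2
  have hiz : Commute i z := by rw [← hi]; exact (Commute.refl i).pow_right 2
  have hjz : Commute j z := by rw [← hj]; exact (Commute.refl j).pow_right 2
  obtain ⟨m, hm⟩ := hodd
  set n := orderOf g with hn
  have hn0 : n ≠ 0 := by omega
  have hgn : g ^ n = 1 := pow_orderOf_eq_one g
  have hzg : z ∉ Subgroup.zpowers g := by
    intro h
    obtain ⟨k, rfl⟩ := Subgroup.mem_zpowers_iff.1 h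
    apply hz1
    have h1 : (g ^ k) ^ n = 1 := by rw [← zpow_natCast, zpow_comm, zpow_natCast, hgn, one_zpow]
    rw [hm, pow_succ, pow_mul, hz2, one_pow, one_mul] at h1
    exact h1
  have hprim := Complex.isPrimitiveRoot_exp n hn0
  set ζ := Complex.exp (2 * Real.pi * Complex.I / n) with hζ
  have hζn : ζ ^ n = 1 := hprim.pow_eq_one
  obtain ⟨l, hl⟩ := exists_functional g z n rfl hzg ζ hζn
  -- the ring elements
  let A := MonoidAlgebra ℤ G
  let o : G →* A := MonoidAlgebra.of ℤ G
  let γ : A := o g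
  let ψ : ℤ[X] →+* A := (aeval γ : ℤ[X] →ₐ[ℤ] A).toRingHom
  have hψ : ∀ b, ψ b = aeval γ b := fun b => rfl
  have hψc : ∀ (x : G), Commute g x → ∀ b, Commute (ψ b) (o x) := by
    intro x hx b
    exact aeval_commute γ (o x) (hx.map o) b
  have hψψ : ∀ b c, Commute (ψ b) (ψ c) := fun b c => by
    show ψ b * ψ c = ψ c * ψ b
    rw [← map_mul, mul_comm, map_mul]
  have hγn : γ ^ n = 1 := by
    show o g ^ n = 1
    rw [← map_pow, hgn, map_one]
  let P : ℤ[X] := ∑ k ∈ Finset.range n, (X ^ 2) ^ k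
  let h : A := ψ P
  have hh1 : ψ (X ^ 2) * h = h := by
    have h1 : (X ^ 2 - 1 : ℤ[X]) * P = (X ^ 2) ^ n - 1 := mul_geom_sum _ _
    have h2 : ψ ((X ^ 2) ^ n - 1) = 0 := by
      rw [← pow_mul, mul_comm, pow_mul, map_sub, map_pow, map_pow, hψ, aeval_X, hγn, map_one,
        one_pow, sub_self]
    rw [← h1, map_mul, map_sub, map_one, sub_mul, one_mul] at h2
    exact sub_eq_zero.1 h2
  have hh2 : h * h = (n : A) * h := by
    have : ∀ k : ℕ, ψ ((X ^ 2) ^ k) * h = h := by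
      intro k
      induction k with
      | zero => simp
      | succ k ih => rw [pow_succ, map_mul, mul_assoc, hh1, ih]
    calc h * h = (∑ k ∈ Finset.range n, ψ ((X ^ 2) ^ k)) * h := by rw [← map_sum]
      _ = _ := by rw [Finset.sum_mul, Finset.sum_congr rfl (fun k _ => this k)]; simp
  let Q : ℤ[X] := (n : ℤ[X]) - P
  have hQ : ψ Q = (n : A) - h := by rw [map_sub, map_natCast]
  have hQ2 : ψ Q * ψ Q = (n : A) * ψ Q := by
    have hc : h * (n : A) = (n : A) * h := (Nat.cast_commute n h).eq.symm
    rw [hQ, sub_mul, mul_sub, mul_sub, hh2, hc, sub_self, sub_zero]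
  have hhQ : h * ψ Q = 0 := by
    rw [hQ, mul_sub, hh2, (Nat.cast_commute n h).eq, sub_self]
  have hZ2 : o z * o z = 1 := by rw [← map_mul, ← pow_two, hz2, map_one]
  let E : A := (1 - o z) * ψ Q
  have hzQ : Commute (ψ Q) (1 - o z) :=
    (Commute.one_right _).sub_right (hψc z hgz Q)
  have hzz : (1 - o z) * (1 - o z) = 2 * (1 - o z) := by
    rw [mul_sub, sub_mul, sub_mul, hZ2]; simp only [mul_one, one_mul]; rw [two_mul]; abel
  have hS : ∑ k ∈ Finset.range (2 * (m + 1)), ((X : ℤ[X]) ^ 2) ^ k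
      = ∑ k ∈ Finset.range (m + 1), (X ^ 4) ^ k
        + X ^ 2 * ∑ k ∈ Finset.range (m + 1), (X ^ 4) ^ k := by
    rw [sum_range_double, Finset.mul_sum]
    congr 1 <;> refine Finset.sum_congr rfl fun k _ => ?_ <;> ring
  let S : ℤ[X] := ∑ k ∈ Finset.range (m + 1), (X ^ 4) ^ k
  have hS2 : ψ (S + X ^ 2 * S) = h + 1 := by
    rw [← hS, show 2 * (m + 1) = n + 1 by omega, Finset.sum_range_succ, map_add]
    congr 1
    rw [← pow_mul, mul_comm, pow_mul, map_pow, map_pow, hψ, aeval_X, hγn, one_pow]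
  have hhE : h * E = 0 := by
    show h * ((1 - o z) * ψ Q) = 0
    rw [← hzQ.eq, ← mul_assoc, hhQ, zero_mul]
  have key := quat_units (A := A) hP torFree_monoidAlgebra ψ (o i) (o j) (o z) E (2 * n) (by omega)
    (by rw [← map_mul, ← pow_two, hi]) (by rw [← map_mul, ← pow_two, hj]) hZ2
    (by simp only [← map_mul]; rw [hij])
    (by
      show o z * ((1 - o z) * ψ Q) = -((1 - o z) * ψ Q)
      rw [← mul_assoc, mul_sub, hZ2, mul_one, ← neg_mul, neg_sub])
    (by
      refine Commute.mul_left ((Commute.one_left _).sub_left (hiz.symm.map o)) (hψc i hgi Q))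
    (by
      refine Commute.mul_left ((Commute.one_left _).sub_left (hjz.symm.map o)) (hψc j hgj Q))
    (fun b => Commute.mul_left ((Commute.one_left _).sub_left (hψc z hgz b).symm) (hψψ _ _))
    (by
      show (1 - o z) * ψ Q * ((1 - o z) * ψ Q) = _
      calc (1 - o z) * ψ Q * ((1 - o z) * ψ Q) = (1 - o z) * (ψ Q * (1 - o z)) * ψ Q := by
            noncomm_ring
        _ = ((1 - o z) * (1 - o z)) * (ψ Q * ψ Q) := by rw [hzQ.eq]; noncomm_ring
        _ = 2 * ((1 - o z) * (n : A)) * ψ Q := by rw [hzz, hQ2]; noncomm_ring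
        _ = _ := by rw [← (Nat.cast_commute n (1 - o z)).eq]; push_cast; simp only [mul_assoc]; rfl)
    (fun b => hψc i hgi b) (fun b => hψc j hgj b)
    ⟨1, -X⟩ ⟨S, X * S⟩
    (by
      rw [QuadraticAlgebra.re_mul]
      show ψ (1 * S + (-1) * (-X) * (X * S)) * E = E
      rw [show (1 * S + (-1) * (-X) * (X * S)) = S + X ^ 2 * S by ring, hS2, add_mul, hhE,
        zero_add, one_mul])
    (by
      rw [QuadraticAlgebra.im_mul]
      show ψ (1 * (X * S) + (-X) * S + 0 * (-X) * (X * S)) * E = 0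
      rw [show (1 * (X * S) + (-X) * S + 0 * (-X) * (X * S) : ℤ[X]) = 0 by ring, map_zero, zero_mul])
  obtain ⟨s, hs, hq⟩ := key
  by_contra hg1
  have hn1 : n ≠ 1 := fun h => hg1 (orderOf_eq_one_iff.1 h)
  have hP0 : aeval ζ P = 0 := by
    have h1 : (X ^ 2 - 1 : ℤ[X]) * P = (X ^ 2) ^ n - 1 := mul_geom_sum _ _
    have h2 := congrArg (aeval ζ) h1
    simp only [map_mul, map_sub, map_pow, aeval_X, map_one] at h2
    rw [← pow_mul, mul_comm 2 n, pow_mul, hζn, one_pow, sub_self] at h2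
    rcases mul_eq_zero.1 h2 with h3 | h3
    · exfalso
      have := hprim.dvd_of_pow_eq_one 2 (sub_eq_zero.1 h3)
      have := Nat.le_of_dvd (by norm_num) this
      omega
    · exact h3
  set q := ((⟨1, -X⟩ : QuadraticAlgebra ℤ[X] (-1) 0) ^ s).im with hqdef
  have hq0 : aeval ζ q = 0 := by
    have h1 : ψ (q ^ 2 * Q) * (1 - o z) = 0 := by
      rw [← hq, map_mul, map_pow, mul_assoc, hzQ.eq]
    have h2 := hl (q ^ 2 * Q)
    have h3 : l (ψ (q ^ 2 * Q) * (1 - o z)) = aeval ζ (q ^ 2 * Q) := h2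
    rw [h1, map_zero, map_mul, map_sub, hP0, map_natCast, map_pow] at h3
    have hnC : (n : ℂ) ≠ 0 := by exact_mod_cast hn0
    have := h3.symm
    simpa [hnC] using this
  let ψ' : ℤ[X] →+* ℂ := (aeval ζ : ℤ[X] →ₐ[ℤ] ℂ).toRingHom
  have e : ∀ t : ℂ, t * t = -1 → (1 - ζ * t) ^ s
      = aeval ζ ((⟨1, -X⟩ : QuadraticAlgebra ℤ[X] (-1) 0) ^ s).re := by
    intro t ht
    have := qeval_pow ψ' t (-1) 1 ht (by ring) (fun b => Commute.all _ _) ⟨1, -X⟩ s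
    rw [mul_one, mul_one] at this
    unfold qeval at this
    have h1 : ψ' ((⟨1, -X⟩ : QuadraticAlgebra ℤ[X] (-1) 0) ^ s).im = 0 := hq0
    rw [h1, zero_mul, add_zero] at this
    have h2 : ψ' ((⟨1, -X⟩ : QuadraticAlgebra ℤ[X] (-1) 0) ^ s).re =
      aeval ζ ((⟨1, -X⟩ : QuadraticAlgebra ℤ[X] (-1) 0) ^ s).re := rfl
    rw [← h2, ← this]
    congr 1
    simp [ψ']; ring
  have e1 := (e Complex.I Complex.I_mul_I).trans (e (-Complex.I) (by simp)).symm
  have e2 := congrArg norm e1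
  rw [norm_pow, norm_pow] at e2
  have e3 := pow_left_injective_aux e2 hs.ne'
  have e4 : Complex.normSq (1 - ζ * Complex.I) = Complex.normSq (1 - ζ * -Complex.I) := by
    rw [Complex.normSq_eq_norm_sq, Complex.normSq_eq_norm_sq, e3]
  simp only [Complex.normSq_apply] at e4
  simp at e4
  have e5 : ζ.im = 0 := by linarith
  have e6 : ‖ζ‖ = 1 := Complex.norm_eq_one_of_pow_eq_one hζn hn0
  have e7 : ζ ^ 2 = 1 := by
    have h1 : Complex.normSq ζ = 1 := by rw [Complex.normSq_eq_norm_sq, e6, one_pow]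
    rw [Complex.normSq_apply, e5] at h1
    apply Complex.ext
    · rw [pow_two, Complex.mul_re, e5, Complex.one_re]; linarith
    · rw [pow_two, Complex.mul_im, e5, Complex.one_im]; ring
  have := Nat.le_of_dvd (by norm_num) (hprim.dvd_of_pow_eq_one 2 e7)
  omega

end OddPart

section TotallyReal
open MonoidAlgebra NumberField

theorem nil_case {A : Type*} [Ring A] (hP : PowComm A) (hT : TorFree A) (J L I Z E ρ : A) (n : ℕ)
    (hn : n ≠ 0) (hρ : ∀ x, Commute ρ x) (hJ : J * J = Z) (hL : L * L = Z) (hJL : J * L = I)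
    (hLJ : L * J = I * Z) (hZE : Z * E = -E) (hEE : E * E = 2 * E) (hEJ : Commute E J)
    (hEL : Commute E L) (hρ2 : ρ * ρ = -(n : A) * n) : ρ * I * E = 0 := by
  have hnc : ∀ x : A, Commute (n : A) x := fun x => Nat.cast_commute n x
  have F : ∀ μ ν : A, (∀ x, Commute μ x) → (∀ x, Commute ν x) →
      ((n : A) * J + μ * L) * ((n : A) * J + ν * L) * E
        = (-(n : A) * n + (n : A) * ν * I - (n : A) * μ * I - μ * ν) * E := by
    intro μ ν hμ hν
    have e1 : ((n : A) * J + μ * L) * ((n : A) * J + ν * L)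
        = (n : A) * n * (J * J) + n * ν * (J * L) + (n * μ * (L * J) + μ * ν * (L * L)) := by
      rw [add_mul, mul_add, mul_add, (hnc J).symm.mul_mul_mul_comm, (hν J).symm.mul_mul_mul_comm,
        (hnc L).symm.mul_mul_mul_comm, (hν L).symm.mul_mul_mul_comm, (hnc μ).eq]
    rw [e1, hJ, hL, hJL, hLJ]
    simp only [add_mul, sub_mul, mul_assoc, hZE]
    noncomm_ring
  have hρn : ∀ x, Commute (-ρ) x := fun x => (hρ x).neg_left
  have hcE : ∀ μ : A, (∀ x, Commute μ x) → Commute E ((n : A) * J + μ * L) := fun μ hμ =>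
    ((hnc E).symm.mul_right hEJ).add_right ((hμ E).symm.mul_right hEL)
  have pr : ∀ μ ν : A, (∀ x, Commute μ x) → (∀ x, Commute ν x) →
      ((n : A) * J + μ * L) * E * (((n : A) * J + ν * L) * E) =
      2 * ((-(n : A) * n + (n : A) * ν * I - (n : A) * μ * I - μ * ν) * E) := by
    intro μ ν hμ hν
    rw [← F μ ν hμ hν, (hcE ν hν).mul_mul_mul_comm, hEE]
    noncomm_ring
  have h := nilsq_commute hP hT (e := ((n : A) * J + ρ * L) * E)
    (f := ((n : A) * J + (-ρ) * L) * E)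
    (by rw [pr ρ ρ hρ hρ, hρ2]; noncomm_ring)
    (by rw [pr _ _ hρn hρn, neg_mul_neg, hρ2]; noncomm_ring)
  rw [pr ρ _ hρ hρn, pr _ ρ hρn hρ] at h
  have h2 : ((8 * n : ℕ) : A) * (ρ * I * E) = 0 := by
    have : ((8 * n : ℕ) : A) * (ρ * I * E)
      = 2 * ((-(n : A) * n + (n : A) * ρ * I - (n : A) * (-ρ) * I - (-ρ) * ρ) * E)
       - 2 * ((-(n : A) * n + (n : A) * (-ρ) * I - (n : A) * ρ * I - ρ * (-ρ)) * E) := by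
      push_cast
      noncomm_ring
    rw [this, h, sub_self]
  exact hT _ (by omega) _ h2

theorem order_den {K : Type} [Field K] [Algebra ℚ K] (R : Subring K)
    (hR : Submodule.span ℚ (R : Set K) = ⊤) (x : K) : ∃ N : ℕ, N ≠ 0 ∧ (N : K) * x ∈ R := by
  have hx : x ∈ Submodule.span ℚ (R : Set K) := by rw [hR]; trivial
  induction hx using Submodule.span_induction with
  | mem x h => exact ⟨1, one_ne_zero, by simpa using h⟩
  | zero => exact ⟨1, one_ne_zero, by simp⟩
  | add x y _ _ hx hy =>
    obtain ⟨a, ha, hx⟩ := hx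
    obtain ⟨b, hb, hy⟩ := hy
    refine ⟨a * b, Nat.mul_ne_zero ha hb, ?_⟩
    have : ((a * b : ℕ) : K) * (x + y) = (b : K) * ((a : K) * x) + (a : K) * ((b : K) * y) := by
      push_cast; ring
    rw [this]
    exact add_mem (mul_mem (natCast_mem R b) hx) (mul_mem (natCast_mem R a) hy)
  | smul q x _ hx =>
    obtain ⟨a, ha, hx⟩ := hx
    refine ⟨q.den * a, Nat.mul_ne_zero q.den_ne_zero ha, ?_⟩
    have : ((q.den * a : ℕ) : K) * (q • x) = (q.num : K) * ((a : K) * x) := by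
      rw [Algebra.smul_def]
      have h1 : (q.den : K) * algebraMap ℚ K q = (q.num : K) := by
        rw [← map_natCast (algebraMap ℚ K), ← map_mul, Rat.den_mul_eq_num, map_intCast]
      push_cast
      rw [← h1]; ring
    rw [this]
    exact mul_mem (intCast_mem R _) hx

/-- extension of a complex embedding to the quadratic algebra -/
noncomputable def quadEmb {K : Type} [Field K] (σ : K →+* ℂ) (t : ℂ) (ht : t * t = -1) :
    QuadraticAlgebra K (-1) 0 →+* ℂ where
  toFun w := σ w.re + t * σ w.im
  map_one' := by
    show σ 1 + t * σ 0 = 1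
    simp
  map_zero' := by
    show σ 0 + t * σ 0 = 0
    simp
  map_add' x y := by
    simp only [QuadraticAlgebra.re_add, QuadraticAlgebra.im_add, map_add]; ring
  map_mul' x y := by
    simp only [QuadraticAlgebra.re_mul, QuadraticAlgebra.im_mul, map_add, map_mul, map_neg,
      map_one, map_zero]
    linear_combination (- σ x.im * σ y.im) * ht

/-- inclusion of quadratic algebras -/
def quadIncl {K : Type} [Field K] (R : Subring K) :
    QuadraticAlgebra R (-1) 0 →+* QuadraticAlgebra K (-1) 0 where
  toFun w := ⟨w.re, w.im⟩
  map_one' := rfl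
  map_zero' := rfl
  map_add' x y := by
    ext <;> simp
  map_mul' x y := by
    ext <;> simp

theorem quadIncl_injective {K : Type} [Field K] (R : Subring K) :
    Function.Injective (quadIncl R) := by
  intro x y h
  have h1 : (x.re : K) = y.re := congrArg QuadraticAlgebra.re h
  have h2 : (x.im : K) = y.im := congrArg QuadraticAlgebra.im h
  ext
  · exact h1
  · exact h2

theorem exists_unit_quad (K : Type) [Field K] [NumberField K] (R : Subring K)
    (hden : ∀ x : K, ∃ N : ℕ, N ≠ 0 ∧ (N : K) * x ∈ R) (hι : ∀ r : K, r ^ 2 ≠ -1)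
    (σ : K →+* ℂ) (x0 : K) (hx0 : (σ x0).im ≠ 0) :
    ∃ w w' : QuadraticAlgebra R (-1) 0, w * w' = 1 ∧ ∀ s : ℕ, 0 < s → (w ^ s).im ≠ 0 := by
  classical
  have : Fact (∀ r : K, r ^ 2 ≠ -1 + 0 * r) := ⟨fun r => by simpa using hι r⟩
  let L := QuadraticAlgebra K (-1) 0
  have : NumberField L := NumberField.of_module_finite K L
  let τ1 : L →+* ℂ := quadEmb σ Complex.I Complex.I_mul_I
  let τ2 : L →+* ℂ := quadEmb σ (-Complex.I) (by simp)
  have hτ1 : ∀ w, τ1 w = σ w.re + Complex.I * σ w.im := fun w => rfl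
  have hτ2 : ∀ w, τ2 w = σ w.re + (-Complex.I) * σ w.im := fun w => rfl
  have hne : InfinitePlace.mk τ2 ≠ InfinitePlace.mk τ1 := by
    intro h
    rcases InfinitePlace.mk_eq_iff.1 h with h | h
    · have := RingHom.congr_fun h (⟨0, 1⟩ : L)
      rw [hτ1, hτ2] at this
      have := congrArg Complex.im this
      simp at this
      norm_num at this
    · have := RingHom.congr_fun h (⟨x0, 0⟩ : L)
      rw [ComplexEmbedding.conjugate_coe_eq, hτ1, hτ2] at this
      have := congrArg Complex.im this
      simp at this
      apply hx0
      linarith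
  obtain ⟨u, hu⟩ := Units.dirichletUnitTheorem.exists_unit L (InfinitePlace.mk τ1)
  -- the subring with coordinates in `R`
  let S : Subring L := (quadIncl R).range
  have hS : ∀ x : L, x.re ∈ R → x.im ∈ R → x ∈ S := fun x h1 h2 =>
    ⟨⟨⟨x.re, h1⟩, ⟨x.im, h2⟩⟩, rfl⟩
  have hSden : ∀ x : L, ∃ N : ℕ, N ≠ 0 ∧ (N : L) * x ∈ S := by
    intro x
    obtain ⟨a, ha, h1⟩ := hden x.re
    obtain ⟨b, hb, h2⟩ := hden x.im
    have hre : (((a * b : ℕ) : L)).re = ((a * b : ℕ) : K) := QuadraticAlgebra.re_natCast _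
    have him : (((a * b : ℕ) : L)).im = 0 := QuadraticAlgebra.im_natCast _
    refine ⟨a * b, Nat.mul_ne_zero ha hb, hS _ ?_ ?_⟩
    · rw [QuadraticAlgebra.re_mul, hre, him]
      have : ((a * b : ℕ) : K) * x.re + -1 * 0 * x.im = (b : K) * ((a : K) * x.re) := by
        push_cast; ring
      rw [this]; exact mul_mem (natCast_mem R b) h1
    · rw [QuadraticAlgebra.im_mul, hre, him]
      have : ((a * b : ℕ) : K) * x.im + 0 * x.re + 0 * 0 * x.im = (a : K) * ((b : K) * x.im) := by
        push_cast; ring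
      rw [this]; exact mul_mem (natCast_mem R a) h2
  have hD : ∃ D : ℕ, D ≠ 0 ∧ ∀ y : 𝓞 L, (D : L) * algebraMap (𝓞 L) L y ∈ S := by
    obtain ⟨s, hs⟩ := (Module.finite_def.1 (inferInstance : Module.Finite ℤ (𝓞 L)))
    choose N hN0 hN using fun y : 𝓞 L => hSden (algebraMap (𝓞 L) L y)
    refine ⟨∏ y ∈ s, N y, Finset.prod_ne_zero_iff.2 fun y _ => hN0 y, ?_⟩
    intro y
    have hy : y ∈ Submodule.span ℤ (s : Set (𝓞 L)) := by rw [hs]; trivial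
    induction hy using Submodule.span_induction with
    | mem y h =>
      rw [← Finset.mul_prod_erase s N h]
      have : ((N y * ∏ x ∈ s.erase y, N x : ℕ) : L) * algebraMap (𝓞 L) L y
          = ((∏ x ∈ s.erase y, N x : ℕ) : L) * ((N y : L) * algebraMap (𝓞 L) L y) := by push_cast; ring
      rw [this]
      exact mul_mem (natCast_mem S _) (hN y)
    | zero => simp
    | add x y _ _ hx hy =>
      rw [map_add, mul_add]; exact add_mem hx hy
    | smul a x _ hx =>
      rw [zsmul_eq_mul, map_mul, map_intCast, mul_left_comm]
      exact mul_mem (intCast_mem S a) hx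
  obtain ⟨D, hD0, hD⟩ := hD
  obtain ⟨m, n, hmn, y, hy⟩ := pigeonhole_mod (A := 𝓞 L) D hD0 (fun k => (u : 𝓞 L) ^ k)
  obtain ⟨k, hk, rfl⟩ : ∃ k, 0 < k ∧ n = m + k := ⟨n - m, by omega, by omega⟩
  let v := u ^ k
  have hv : (v : 𝓞 L) - 1 = (D : 𝓞 L) * (y * ((u ^ m)⁻¹ : (𝓞 L)ˣ)) := by
    rw [← mul_assoc, ← hy]
    have : (u : 𝓞 L) ^ (m + k) - (u : 𝓞 L) ^ m = ((v : 𝓞 L) - 1) * ((u ^ m : (𝓞 L)ˣ) : 𝓞 L) := by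
      simp only [v, Units.val_pow_eq_pow_val]; ring
    rw [this, Units.mul_inv_cancel_right]
  have hv2 : ((v⁻¹ : (𝓞 L)ˣ) : 𝓞 L) - 1
      = (D : 𝓞 L) * (-(y * ((u ^ m)⁻¹ : (𝓞 L)ˣ)) * ((v⁻¹ : (𝓞 L)ˣ) : 𝓞 L)) := by
    have h1 : ((v⁻¹ : (𝓞 L)ˣ) : 𝓞 L) - 1 = -((v : 𝓞 L) - 1) * ((v⁻¹ : (𝓞 L)ˣ) : 𝓞 L) := by
      rw [neg_mul, sub_mul, Units.mul_inv]; ring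
    rw [h1, hv]; ring
  have memS : ∀ a b : 𝓞 L, a - 1 = (D : 𝓞 L) * b → algebraMap (𝓞 L) L a ∈ S := by
    intro a b hab
    have h1 : a = 1 + (D : 𝓞 L) * b := by rw [← hab]; ring
    rw [h1, map_add, map_one, map_mul, map_natCast]
    exact add_mem (one_mem _) (hD b)
  obtain ⟨w, hw⟩ := memS _ _ hv
  obtain ⟨w', hw'⟩ := memS _ _ hv2
  refine ⟨w, w', ?_, ?_⟩
  · apply quadIncl_injective R
    rw [map_mul, hw, hw', ← map_mul, Units.mul_inv, map_one, map_one]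
  · intro s hs h0
    have h1 : ((algebraMap (𝓞 L) L) (v : 𝓞 L) ^ s).im = 0 := by
      rw [← hw, ← map_pow]
      show ((w ^ s).im : K) = 0
      rw [h0]; rfl
    have h2 : τ1 ((algebraMap (𝓞 L) L) (v : 𝓞 L) ^ s) = τ2 ((algebraMap (𝓞 L) L) (v : 𝓞 L) ^ s) := by
      rw [hτ1, hτ2, h1, map_zero, mul_zero, mul_zero]
    have h3 : (InfinitePlace.mk τ1) ((algebraMap (𝓞 L) L) (u : 𝓞 L)) =
        (InfinitePlace.mk τ2) ((algebraMap (𝓞 L) L) (u : 𝓞 L)) := by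
      rw [InfinitePlace.apply, InfinitePlace.apply]
      have h4 := congrArg norm h2
      simp only [v, Units.val_pow_eq_pow_val, map_pow, norm_pow, ← pow_mul] at h4
      exact (pow_left_inj₀ (norm_nonneg _) (norm_nonneg _) (by positivity)).1 h4
    have h5 : ∀ w : InfinitePlace L, Real.log (w ((algebraMap (𝓞 L) L) (u : 𝓞 L))) < 0 := by
      intro w
      by_cases hw : w = InfinitePlace.mk τ1
      · rw [hw, h3]; exact hu _ hne
      · exact hu w hw
    have h6 := Units.sum_mult_mul_log u
    have h7 : ∑ w : InfinitePlace L, (w.mult : ℝ) * Real.log (w ((algebraMap (𝓞 L) L) (u : 𝓞 L))) < 0 := by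
      apply Finset.sum_neg
      · intro w _
        exact mul_neg_of_pos_of_neg (by exact_mod_cast InfinitePlace.mult_pos) (h5 w)
      · exact ⟨InfinitePlace.mk τ1, Finset.mem_univ _⟩
    linarith

end TotallyReal

section Forward
open MonoidAlgebra NumberField

theorem order_finite {K : Type} [Field K] [Algebra ℚ K] (R : Subring K) (hR : IsOrderIn R) :
    Module.Finite ℤ R := by
  have h := hR.1
  have h2 : AddGroup.FG R := (AddGroup.fg_iff_addSubgroup_fg R.toAddSubgroup).2 h
  exact Module.Finite.iff_addGroup_fg.2 h2

theorem real_of_powComm (K : Type) [Field K] [NumberField K] (R : Subring K) (hR : IsOrderIn R)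
    (G : Type) [Group G] [Finite G] (hP : PowComm (MonoidAlgebra R G))
    {i j z : G} (hi : i ^ 2 = z) (hj : j ^ 2 = z) (hz2 : z ^ 2 = 1) (hz1 : z ≠ 1)
    (hij : i * j = j * i * z) (σ : K →+* ℂ) (x : K) : (σ x).im = 0 := by
  classical
  have hden := order_den R hR.2
  have hfin : Module.Finite ℤ R := order_finite R hR
  let A := MonoidAlgebra R G
  have hfinA : Module.Finite ℤ A := Module.Finite.trans R A
  have hT : TorFree A := torFree_monoidAlgebra
  have hiz : Commute i z := by rw [← hi]; exact (Commute.refl i).pow_right 2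
  have hjz : Commute j z := by rw [← hj]; exact (Commute.refl j).pow_right 2
  let o : G →* A := MonoidAlgebra.of R G
  let ψ : R →+* A := algebraMap R A
  have hψ : ∀ r x, Commute (ψ r) x := fun r x => Algebra.commutes r x
  have hZ2 : o z * o z = 1 := by rw [← map_mul, ← pow_two, hz2, map_one]
  have hzE : o z * (1 - o z) = -(1 - o z) := by rw [mul_sub, hZ2, mul_one, neg_sub]
  have hEE : (1 - o z) * (1 - o z) = 2 * (1 - o z) := by
    rw [sub_mul 1, hzE, one_mul, two_mul]; abel
  have hEi : Commute (1 - o z) (o i) := (Commute.one_left _).sub_left (hiz.symm.map o)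
  have hEj : Commute (1 - o z) (o j) := (Commute.one_left _).sub_left (hjz.symm.map o)
  have hcoef : ∀ (r : R) (g : G), ψ r * o g * (1 - o z) = 0 → r = 0 := by
    intro r g h
    have h1 : ψ r * o g * (1 - o z) = single g r - single (g * z) r := by
      rw [mul_sub, mul_one]
      show single (1 : G) r * single g 1 - single (1 : G) r * single g 1 * single z 1 = _
      rw [single_mul_single, single_mul_single, one_mul, mul_one, mul_one]
    rw [h1] at h
    have h2 := congrArg (fun y : A => y.coeff g) h
    simpa [hz1] using h2
  by_contra hx
  by_cases hι : ∃ ι : K, ι ^ 2 = -1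
  · obtain ⟨ι, hι⟩ := hι
    obtain ⟨N, hN, hr⟩ := hden ι
    have h := nil_case hP hT (o j) (o (i * j)) (o i) (o z) (1 - o z) (ψ ⟨(N : K) * ι, hr⟩) N hN
      (hψ _) (by rw [← map_mul, ← pow_two, hj])
      (by
        rw [← map_mul]; congr 1
        calc i * j * (i * j) = i * j * (j * i * z) := by rw [hij]
          _ = i * (j ^ 2) * i * z := by simp only [pow_two, mul_assoc]
          _ = (i * z) * i * z := by rw [hj]
          _ = z * (i ^ 2) * z := by rw [hiz.eq]; simp only [pow_two, mul_assoc]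
          _ = z := by rw [hi, ← pow_two, hz2, one_mul])
      (by
        rw [← map_mul]; congr 1
        calc j * (i * j) = j * (j * i * z) := by rw [hij]
          _ = (j ^ 2) * (i * z) := by simp only [pow_two, mul_assoc]
          _ = z ^ 2 * i := by rw [hj, hiz.eq]; simp only [pow_two, mul_assoc]
          _ = i := by rw [hz2, one_mul])
      (by
        rw [← map_mul, ← map_mul]; congr 1
        rw [mul_assoc, ← pow_two, hj])
      hzE hEE hEj
      (by rw [map_mul]; exact hEi.mul_right hEj)
      (by
        rw [← map_mul, ← map_natCast ψ N, ← map_neg, ← map_mul]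
        congr 1
        apply Subtype.ext
        show (N : K) * ι * ((N : K) * ι) = -(N : K) * (N : K)
        linear_combination (N : K) ^ 2 * hι)
    have h0 := congrArg Subtype.val (hcoef _ _ h)
    have h1 : (N : K) * ι = 0 := h0
    rcases mul_eq_zero.1 h1 with h2 | h2
    · exact hN (by exact_mod_cast h2)
    · rw [h2] at hι; norm_num at hι
  · push Not at hι
    obtain ⟨w, w', hww, hw⟩ := exists_unit_quad K R hden hι σ x hx
    obtain ⟨s, hs, h⟩ := quat_units hP hT ψ (o i) (o j) (o z) (1 - o z) 2 two_ne_zero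
      (by rw [← map_mul, ← pow_two, hi]) (by rw [← map_mul, ← pow_two, hj]) hZ2
      (by simp only [← map_mul]; rw [hij]) hzE hEi hEj (fun b => (hψ b _).symm)
      (by exact_mod_cast hEE) (fun b => hψ b _) (fun b => hψ b _) w w'
      (by rw [hww]; show ψ 1 * _ = _; rw [map_one, one_mul])
      (by rw [hww]; show ψ 0 * _ = _; rw [map_zero, zero_mul])
    apply hw s hs
    have h1 := hcoef ((w ^ s).im ^ 2) 1 (by rw [map_one, mul_one, map_pow, h])
    exact pow_eq_zero_iff two_ne_zero |>.1 h1

theorem forward (K : Type) [Field K] [NumberField K] (R : Subring K) (hR : IsOrderIn R)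
    (G : Type) [Group G] [Finite G]
    (h : ∃ H : Subgroup (MonoidAlgebra ↥R G)ˣ, H.FiniteIndex ∧
        ∀ x y : H, x * y = y * x) :
      (∀ a b : G, a * b = b * a) ∨
      ((∀ σ : K →+* ℂ, ∀ x : K, (σ x).im = 0) ∧
        ∃ (A : Type) (_ : CommGroup A), (∀ a : A, a ^ 2 = 1) ∧
          Nonempty (G ≃* QuaternionGroup 2 × A)) := by
  obtain ⟨H, hH, hc⟩ := h
  have hP := powComm_of_virtually H hH hc
  have hPZ : PowComm (MonoidAlgebra ℤ G) := by
    refine powComm_of_injective (MonoidAlgebra.mapRingHom G (Int.castRingHom R)) ?_ hP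
    intro x y hxy
    ext g
    have := congrArg (fun t => t.coeff g) hxy
    simpa using this
  have hN := normal_of_powComm hPZ
  by_cases hG : ∀ a b : G, a * b = b * a
  · exact Or.inl hG
  right
  obtain ⟨i, j, z, hi, hj, hz2, hz1, hij⟩ := exists_quaternion_pair hN hG
  refine ⟨real_of_powComm K R hR G hP hi hj hz2 hz1 hij, ?_⟩
  refine quat_iso hi hj hz2 hz1 hij hN ?_
  intro x hxi hxj
  exact quat_centralizer_sq hi hj hz2 hz1 hij hN
    (fun g h1 h2 h3 => odd_commute_trivial hPZ hi hj hz2 hz1 hij g h1 h2 h3) hxi hxj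

end Forward

section Backward
open MonoidAlgebra NumberField

theorem sq_finiteIndex (C : Type*) [CommGroup C] [h : Module.Finite ℤ (Additive C)] :
    ((powMonoidHom 2 : C →* C).range).FiniteIndex := by
  have : Group.FG C := GroupFG.iff_add_fg.2 (Module.Finite.iff_addGroup_fg.1 h)
  rw [Subgroup.finiteIndex_iff_finite_quotient]
  apply CommGroup.finite_of_fg_isMulTorsion
  intro x
  rw [isOfFinOrder_iff_pow_eq_one]
  refine ⟨2, two_pos, ?_⟩
  obtain ⟨y, rfl⟩ := QuotientGroup.mk'_surjective _ x
  rw [← map_pow, QuotientGroup.mk'_apply, QuotientGroup.eq_one_iff]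
  exact ⟨y, rfl⟩

theorem units_fg (K : Type) [Field K] [NumberField K] (S B : Type) [CommRing S] [CommRing B]
    [Module.Finite ℤ S] [Algebra K B] [Module.Finite K B] [IsReduced B] (φ : S →+* B)
    (hφ : Function.Injective φ) : Module.Finite ℤ (Additive Sˣ) := by
  classical
  have : IsArtinianRing B := IsArtinianRing.of_finite K B
  let F : MaximalSpectrum B → Type := fun m => B ⧸ m.asIdeal
  let : ∀ m, Field (F m) := fun m => Ideal.Quotient.field m.asIdeal
  let : ∀ m, Algebra K (F m) := fun m => Ideal.Quotient.algebra K
  have hfin : ∀ m, Module.Finite K (F m) := fun m => Module.Finite.quotient K m.asIdeal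
  have hNF : ∀ m, NumberField (F m) := fun m => NumberField.of_module_finite K (F m)
  let f0 : ∀ m, S →+* F m := fun m => (Ideal.Quotient.mk m.asIdeal).comp φ
  have hintegral : ∀ m s, f0 m s ∈ integralClosure ℤ (F m) := by
    intro m s
    have hs : IsIntegral ℤ s := Algebra.IsIntegral.isIntegral s
    exact hs.map (f0 m).toIntAlgHom
  let f : ∀ m, S →+* 𝓞 (F m) := fun m => (f0 m).codRestrict (integralClosure ℤ (F m)) (hintegral m)
  let g : Additive Sˣ →+ ∀ m, Additive (𝓞 (F m))ˣ :=
    AddMonoidHom.pi fun m => (Units.map (f m).toMonoidHom).toAdditive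
  have hg : Function.Injective g := by
    intro x y hxy
    apply Additive.toMul.injective
    apply Units.ext
    apply hφ
    apply (IsArtinianRing.equivPi B).injective
    funext m
    have h1 := congrFun hxy m
    have h2 : (Units.map (f m).toMonoidHom) x.toMul = (Units.map (f m).toMonoidHom) y.toMul := h1
    have h3 := congrArg (fun t : (𝓞 (F m))ˣ => algebraMap (𝓞 (F m)) (F m) (t : 𝓞 (F m))) h2
    exact h3
  exact Module.Finite.of_injective g.toIntLinearMap hg

theorem sum_sq_zero {K : Type} [Field K] [NumberField K] (hK : ∀ σ : K →+* ℂ, ∀ x, (σ x).im = 0)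
    {G : Type} [Fintype G] (c : G → K) (h : ∑ g, c g ^ 2 = 0) (g : G) : c g = 0 := by
  obtain ⟨σ⟩ : Nonempty (K →+* ℂ) := inferInstance
  have h1 := congrArg (fun x => (σ x).re) h
  have h2 : ∑ g, (σ (c g)).re ^ 2 = 0 := by
    rw [← Complex.zero_re, ← map_zero σ, ← h1]
    simp only [map_sum, Complex.re_sum, map_pow]
    refine Finset.sum_congr rfl fun g _ => ?_
    rw [pow_two (σ (c g)), Complex.mul_re, hK]; ring
  rw [Finset.sum_eq_zero_iff_of_nonneg (fun _ _ => sq_nonneg _)] at h2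
  have h3 := h2 g (Finset.mem_univ g)
  have h4 : σ (c g) = 0 := Complex.ext (pow_eq_zero_iff two_ne_zero |>.1 h3) (hK σ _)
  exact (map_eq_zero σ).1 h4

theorem mul_gstar_eq_zero {K : Type} [Field K] [NumberField K]
    (hK : ∀ σ : K →+* ℂ, ∀ x, (σ x).im = 0) {G : Type} [Group G] [Finite G]
    (x : MonoidAlgebra K G) (h : x * gstar x = 0) : x = 0 := by
  have := Fintype.ofFinite G
  have h1 := coeff_one_mul_gstar x
  rw [h] at h1
  ext g
  simpa using sum_sq_zero hK (fun g => x.coeff g) (by rw [← h1]; simp) g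

theorem center_reduced {K : Type} [Field K] [NumberField K]
    (hK : ∀ σ : K →+* ℂ, ∀ x, (σ x).im = 0) {G : Type} [Group G] [Finite G] :
    IsReduced (Subalgebra.center K (MonoidAlgebra K G)) := by
  rw [isReduced_iff_pow_one_lt 2 one_lt_two]
  rintro ⟨x, hx⟩ h
  have h0 : x ^ 2 = 0 := congrArg Subtype.val h
  rw [Subalgebra.mem_center_iff] at hx
  apply Subtype.ext
  show x = 0
  apply mul_gstar_eq_zero hK
  apply mul_gstar_eq_zero hK
  rw [gstar_mul, gstar_gstar, mul_assoc, ← mul_assoc (gstar x), hx (gstar x), mul_assoc x,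
    ← mul_assoc x, ← pow_two, h0, zero_mul]

theorem kernel_finite {K : Type} [Field K] [NumberField K] (R : Subring K) [Module.Finite ℤ R]
    (hK : ∀ σ : K →+* ℂ, ∀ x, (σ x).im = 0) {G : Type} [Group G] [Finite G] :
    Finite {u : (MonoidAlgebra R G)ˣ // (u : MonoidAlgebra R G) * gstar (u : MonoidAlgebra R G) = 1} := by
  classical
  have := Fintype.ofFinite G
  have hT := NumberField.Embeddings.finite_of_norm_le K ℂ 1
  set T := {x : K | IsIntegral ℤ x ∧ ∀ φ : K →+* ℂ, ‖φ x‖ ≤ 1} with hTdef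
  have : Finite T := hT
  have hmem : ∀ u : {u : (MonoidAlgebra R G)ˣ //
      (u : MonoidAlgebra R G) * gstar (u : MonoidAlgebra R G) = 1}, ∀ g : G,
      (((u.1 : MonoidAlgebra R G).coeff g : R) : K) ∈ T := by
    rintro ⟨u, hu⟩ g
    refine ⟨?_, ?_⟩
    · have hs : IsIntegral ℤ ((u : MonoidAlgebra R G).coeff g) := Algebra.IsIntegral.isIntegral _
      exact hs.map R.subtype.toIntAlgHom
    · intro φ
      have h1 := coeff_one_mul_gstar (u : MonoidAlgebra R G)
      rw [hu] at h1
      have h2 : ((1 : MonoidAlgebra R G).coeff 1) = 1 := by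
        rw [MonoidAlgebra.one_def]; simp
      rw [h2] at h1
      have h3 := congrArg (fun x : R => (φ (x : K)).re) h1
      have h4 : ∑ g, (φ ((u : MonoidAlgebra R G).coeff g : K)).re ^ 2 = 1 := by
        have : (1 : ℝ) = (φ ((1 : R) : K)).re := by simp
        rw [this]
        refine Eq.trans ?_ h3.symm
        simp only [AddSubmonoidClass.coe_finsetSum, SubmonoidClass.coe_pow, map_sum,
          Complex.re_sum, map_pow]
        refine Finset.sum_congr rfl fun g _ => ?_
        rw [pow_two (φ _), Complex.mul_re, hK]; ring
      have h5 : (φ ((u : MonoidAlgebra R G).coeff g : K)).re ^ 2 ≤ 1 := by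
        rw [← h4]
        exact Finset.single_le_sum
          (f := fun g => (φ ((u : MonoidAlgebra R G).coeff g : K)).re ^ 2)
          (fun _ _ => sq_nonneg _) (Finset.mem_univ g)
      have h6 : ‖φ ((u : MonoidAlgebra R G).coeff g : K)‖ ^ 2 ≤ 1 := by
        rw [← Complex.normSq_eq_norm_sq, Complex.normSq_apply, hK]
        linarith
      show ‖φ ((u : MonoidAlgebra R G).coeff g : K)‖ ≤ 1
      nlinarith [norm_nonneg (φ ((u : MonoidAlgebra R G).coeff g : K))]
  refine Finite.of_injective (fun u => (fun g => (⟨_, hmem u g⟩ : T))) ?_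
  intro u v h
  apply Subtype.ext
  apply Units.ext
  ext g
  have := congrFun h g
  have := congrArg Subtype.val this
  exact this

theorem sym_central {k G : Type} [CommRing k] [Group G]
    (hconj : ∀ g h : G, h * g * h⁻¹ = g ∨ h * g * h⁻¹ = g⁻¹) (x : MonoidAlgebra k G)
    (hx : gstar x = x) (y : MonoidAlgebra k G) : y * x = x * y := by
  have hc : ∀ g, x.coeff g⁻¹ = x.coeff g := fun g => by rw [← coeff_gstar, hx]
  induction y using MonoidAlgebra.induction_linear with
  | zero => simp
  | add a b ha hb => rw [add_mul, mul_add, ha, hb]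
  | single h r =>
    ext g
    rw [MonoidAlgebra.coeff_single_mul_apply, MonoidAlgebra.coeff_mul_single_apply, mul_comm]
    congr 1
    rcases hconj (h⁻¹ * g) h with h1 | h1
    · rw [← h1]; congr 1; group
    · rw [← hc, ← h1]; congr 1; group

theorem central_sym {k G : Type} [CommRing k] [Group G]
    (hinv : ∀ g : G, ∃ h : G, h * g * h⁻¹ = g⁻¹) (x : MonoidAlgebra k G)
    (hx : ∀ y, y * x = x * y) : gstar x = x := by
  ext g
  rw [coeff_gstar]
  obtain ⟨h, hh⟩ := hinv g
  have h1 := congrArg (fun t => t.coeff (h * g)) (hx (single h 1))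
  beta_reduce at h1
  rw [MonoidAlgebra.coeff_single_mul_apply, MonoidAlgebra.coeff_mul_single_apply, mul_one, one_mul,
    hh, inv_mul_cancel_left] at h1
  exact h1.symm

theorem finite_index_abs {A S : Type} [Ring A] [CommRing S] (j0 : S →+* A) (n : A →* S)
    (hfg : Module.Finite ℤ (Additive Sˣ)) (hn : ∀ c : S, n (j0 c) = c ^ 2)
    (hker : Finite {u : Aˣ // n (u : A) = 1}) :
    ∃ H : Subgroup Aˣ, H.FiniteIndex ∧ ∀ x y : H, x * y = y * x := by
  have hsq : ((powMonoidHom 2 : Sˣ →* Sˣ).range).FiniteIndex := sq_finiteIndex Sˣ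
  let N : Aˣ →* Sˣ := Units.map n
  let j : Sˣ →* Aˣ := Units.map j0.toMonoidHom
  have hNj : ∀ c : Sˣ, N (j c) = c ^ 2 := by
    intro c
    apply Units.ext
    show n (j0 (c : S)) = _
    rw [hn, Units.val_pow_eq_pow_val]
  let M : Subgroup Aˣ := ((powMonoidHom 2 : Sˣ →* Sˣ).range).comap N
  have hM : M.FiniteIndex := ⟨by
    rw [Subgroup.index_comap]
    intro h0
    exact hsq.index_ne_zero (Subgroup.index_eq_zero_of_relIndex_eq_zero h0)⟩
  have hMf : Finite (Aˣ ⧸ M) := Subgroup.finiteIndex_iff_finite_quotient.1 hM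
  refine ⟨j.range, ?_, ?_⟩
  · rw [Subgroup.finiteIndex_iff_finite_quotient]
    refine Finite.of_surjective
      (fun p : (Aˣ ⧸ M) × {u : Aˣ // n (u : A) = 1} =>
        (QuotientGroup.mk (p.1.out * p.2.1) : Aˣ ⧸ j.range)) ?_
    intro q
    obtain ⟨u, rfl⟩ := QuotientGroup.mk_surjective q
    obtain ⟨m, hm⟩ := QuotientGroup.mk_out_eq_mul M u
    have hm2 : (m : Aˣ)⁻¹ ∈ M := inv_mem m.2
    obtain ⟨c, hc⟩ := hm2
    have hc' : c ^ 2 = N (m : Aˣ)⁻¹ := hc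
    have hk : N ((m : Aˣ)⁻¹ * (j c)⁻¹) = 1 := by
      rw [map_mul, map_inv N (j c), hNj, hc', mul_inv_cancel]
    have hk2 : n (((m : Aˣ)⁻¹ * (j c)⁻¹ : Aˣ) : A) = 1 := congrArg Units.val hk
    refine ⟨(QuotientGroup.mk u, ⟨(m : Aˣ)⁻¹ * (j c)⁻¹, hk2⟩), ?_⟩
    show (QuotientGroup.mk ((QuotientGroup.mk u : Aˣ ⧸ M).out * ((m : Aˣ)⁻¹ * (j c)⁻¹)) :
      Aˣ ⧸ j.range) = QuotientGroup.mk u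
    rw [hm, QuotientGroup.eq]
    refine ⟨c, ?_⟩
    group
  · rintro ⟨_, x, rfl⟩ ⟨_, y, rfl⟩
    apply Subtype.ext
    show j x * j y = j y * j x
    rw [← map_mul, mul_comm, map_mul]

theorem exists_center (A : Type) [Ring A] : ∃ (S : Type) (_ : CommRing S) (j : S →+* A),
    Function.Injective j ∧ (∀ s y, y * j s = j s * y) ∧
      ∀ x, (∀ y, y * x = x * y) → ∃ s, j s = x := by
  refine ⟨Subring.center A, inferInstance, (Subring.center A).subtype,
    Subtype.val_injective, ?_, ?_⟩
  · intro s y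
    exact Subring.mem_center_iff.1 s.2 y
  · intro x hx
    exact ⟨⟨x, Subring.mem_center_iff.2 hx⟩, rfl⟩

/-- centre of the group algebra over the field -/
noncomputable abbrev cenK (K : Type) [Field K] (G : Type) [Group G] :
    Subalgebra K (MonoidAlgebra K G) := Subalgebra.center K (MonoidAlgebra K G)

theorem cen_units_fg (K : Type) [Field K] [NumberField K] (R : Subring K) (hR : IsOrderIn R)
    (G : Type) [Group G] [Finite G] (hK : ∀ σ : K →+* ℂ, ∀ x, (σ x).im = 0)
    (S : Type) [CommRing S] (j : S →+* MonoidAlgebra R G) (hj : Function.Injective j)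
    (hjc : ∀ s y, y * j s = j s * y) :
    Module.Finite ℤ (Additive Sˣ) := by
  classical
  have hfin : Module.Finite ℤ R := order_finite R hR
  have hfinA : Module.Finite ℤ (MonoidAlgebra R G) := Module.Finite.trans R _
  have hfinS : Module.Finite ℤ S :=
    Module.Finite.of_injective j.toAddMonoidHom.toIntLinearMap hj
  have hred : IsReduced (cenK K G) := center_reduced hK
  let ι : MonoidAlgebra R G →+* MonoidAlgebra K G := MonoidAlgebra.mapRingHom G R.subtype
  have hιc : ∀ (x : MonoidAlgebra R G) (g : G), (ι x).coeff g = ((x.coeff g : R) : K) :=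
    fun x g => MonoidAlgebra.coeff_mapRingHom R.subtype x g
  have hιs : ∀ (g : G), ι (single g 1) = single g 1 := fun g =>
    (MonoidAlgebra.mapRingHom_single R.subtype g 1).trans (by rw [map_one])
  have hι : Function.Injective ι := by
    intro x y hxy
    ext g
    have := congrArg (fun t => t.coeff g) hxy
    have h2 : (ι x).coeff g = (ι y).coeff g := this
    rw [hιc, hιc] at h2
    exact h2
  have hιB : ∀ s : S, (ι.comp j) s ∈ (cenK K G) := by
    intro s
    rw [RingHom.comp_apply, Subalgebra.mem_center_iff]
    intro y
    induction y using MonoidAlgebra.induction_linear with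
    | zero => simp
    | add a b ha hb => rw [add_mul, mul_add, ha, hb]
    | single h r =>
      have h1 : (single h r : MonoidAlgebra K G) = algebraMap K _ r * ι (single h 1) := by
        rw [hιs, MonoidAlgebra.coe_algebraMap]
        simp
      rw [h1, mul_assoc, ← map_mul, hjc, map_mul, ← mul_assoc, Algebra.commutes, mul_assoc]
  let φ : S →+* (cenK K G) := (ι.comp j).codRestrict (cenK K G) hιB
  have hφ : Function.Injective φ := by
    intro x y h
    have h1 : ι (j x) = ι (j y) := congrArg Subtype.val h
    exact hj (hι h1)
  exact units_fg K S (cenK K G) φ hφ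

theorem backward_quat (K : Type) [Field K] [NumberField K] (R : Subring K) (hR : IsOrderIn R)
    (G : Type) [Group G] [Finite G] (hK : ∀ σ : K →+* ℂ, ∀ x, (σ x).im = 0)
    (hconj : ∀ g h : G, h * g * h⁻¹ = g ∨ h * g * h⁻¹ = g⁻¹)
    (hinv : ∀ g : G, ∃ h : G, h * g * h⁻¹ = g⁻¹) :
    ∃ H : Subgroup (MonoidAlgebra ↥R G)ˣ, H.FiniteIndex ∧ ∀ x y : H, x * y = y * x := by
  classical
  have hfin : Module.Finite ℤ R := order_finite R hR
  obtain ⟨S, hS, j, hj, hjc, hjs⟩ := exists_center (MonoidAlgebra R G)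
  have hcen : ∀ x : MonoidAlgebra R G, ∃ s, j s = x * gstar x := by
    intro x
    exact hjs _ (sym_central hconj _ (by rw [gstar_mul, gstar_gstar]))
  choose f hf using hcen
  let n : MonoidAlgebra R G →* S :=
    { toFun := f
      map_one' := by
        apply hj
        rw [hf, gstar_one, one_mul, map_one]
      map_mul' := by
        intro x y
        apply hj
        rw [map_mul, hf, hf, hf]
        have h1 := hjc (f y) (gstar x)
        rw [hf] at h1
        rw [gstar_mul, mul_assoc x (gstar x), h1]
        simp only [mul_assoc] }
  have hn : ∀ c : S, n (j c) = c ^ 2 := by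
    intro c
    apply hj
    show j (f (j c)) = _
    rw [hf, central_sym hinv _ (hjc c), map_pow, ← pow_two]
  have hker : Finite {u : (MonoidAlgebra R G)ˣ // n (u : MonoidAlgebra R G) = 1} := by
    have := kernel_finite (G := G) R hK
    refine Finite.of_injective (β := {u : (MonoidAlgebra R G)ˣ //
      (u : MonoidAlgebra R G) * gstar (u : MonoidAlgebra R G) = 1})
      (fun u => ⟨u.1, ?_⟩) ?_
    · have h1 : f (u.1 : MonoidAlgebra R G) = 1 := u.2
      rw [← hf, h1, map_one]
    · intro u v h
      exact Subtype.ext (Subtype.mk.inj h)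
  exact finite_index_abs j n (cen_units_fg K R hR G hK S j hj hjc) hn hker

theorem quat_conj : ∀ a b : QuaternionGroup 2, b * a * b⁻¹ = a ∨ b * a * b⁻¹ = a⁻¹ := by decide

theorem quat_conj_inv : ∀ a : QuaternionGroup 2, ∃ b, b * a * b⁻¹ = a⁻¹ := by decide

theorem backward (K : Type) [Field K] [NumberField K] (R : Subring K) (hR : IsOrderIn R)
    (G : Type) [Group G] [Finite G]
    (h : (∀ a b : G, a * b = b * a) ∨
      ((∀ σ : K →+* ℂ, ∀ x : K, (σ x).im = 0) ∧
        ∃ (A : Type) (_ : CommGroup A), (∀ a : A, a ^ 2 = 1) ∧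
          Nonempty (G ≃* QuaternionGroup 2 × A))) :
    ∃ H : Subgroup (MonoidAlgebra ↥R G)ˣ, H.FiniteIndex ∧ ∀ x y : H, x * y = y * x := by
  rcases h with h | ⟨hK, A, hA, hA2, ⟨e⟩⟩
  · refine ⟨⊤, inferInstance, ?_⟩
    let : CommGroup G := { (inferInstance : Group G) with mul_comm := h }
    rintro ⟨x, -⟩ ⟨y, -⟩
    apply Subtype.ext
    apply Units.ext
    show (x : MonoidAlgebra R G) * (y : MonoidAlgebra R G) = y * x
    exact mul_comm (x : MonoidAlgebra R G) (y : MonoidAlgebra R G)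
  · have hinvA : ∀ a : A, a⁻¹ = a := fun a => by
      rw [inv_eq_iff_mul_eq_one, ← pow_two, hA2]
    have hc : ∀ a b : A, b * a * b⁻¹ = a := fun a b => by rw [mul_comm b a, mul_inv_cancel_right]
    apply backward_quat K R hR G hK
    · intro g h
      rcases quat_conj (e g).1 (e h).1 with h1 | h1
      · left
        apply e.injective
        rw [map_mul, map_mul, map_inv]
        exact Prod.ext h1 (hc _ _)
      · right
        apply e.injective
        rw [map_mul, map_mul, map_inv, map_inv]
        refine Prod.ext h1 ?_
        show (e h).2 * (e g).2 * ((e h).2)⁻¹ = ((e g).2)⁻¹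
        rw [hc, hinvA]
    · intro g
      obtain ⟨b, hb⟩ := quat_conj_inv (e g).1
      refine ⟨e.symm (b, 1), ?_⟩
      apply e.injective
      rw [map_mul, map_mul, map_inv, map_inv, e.apply_symm_apply]
      refine Prod.ext hb ?_
      show 1 * (e g).2 * (1 : A)⁻¹ = ((e g).2)⁻¹
      rw [hc, hinvA]

end Backward

/-- Let `R` be an order in a number field `K` and `G` a finite
group. Then the unit group of the group ring `RG` is virtually abelian iff either
`G` is abelian, or `K` is totally real and `G ≅ Q₈ × A` for `A` an elementary
abelian 2-group. -/
theorem group_ring_units_virtually_abelian_iff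
    (K : Type) [Field K] [NumberField K] (R : Subring K) (hR : IsOrderIn R)
    (G : Type) [Group G] [Finite G] :
    (∃ H : Subgroup (MonoidAlgebra ↥R G)ˣ, H.FiniteIndex ∧
        ∀ x y : H, x * y = y * x) ↔
      (∀ a b : G, a * b = b * a) ∨
      ((∀ σ : K →+* ℂ, ∀ x : K, (σ x).im = 0) ∧
        ∃ (A : Type) (_ : CommGroup A), (∀ a : A, a ^ 2 = 1) ∧
          Nonempty (G ≃* QuaternionGroup 2 × A)) := ⟨forward K R hR G, backward K R hR G⟩
end
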